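/- A nontrivial, recurrent, orientation-preserving homeomorphism of the closed disc D² has a unique fixed point. -/

import Mathlib

open Filter Topology Metric

/-- `f` is recurrent with respect to the metric `m`: some sequence of iterates
`f^[n k]` with `n k → ∞` converges uniformly to the identity. -/
def RecurrentWith {X : Type*} (m : MetricSpace X) (f : X → X) : Prop :=
  ∃ n : ℕ → ℕ, Filter.Tendsto n Filter.atTop Filter.atTop ∧
    ∀ ε > 0, ∀ᶠ k in Filter.atTop, ∀ x, @dist X m.toDist (f^[n k] x) x < ε

/-- `f` is a recurrent map of the metric space `X`. -/
def IsRecurrent {X : Type*} [m : MetricSpace X] (f : X → X) : Prop :=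
  RecurrentWith m f

/-- The closed unit disc in the plane. -/
abbrev Disc2 : Set (EuclideanSpace ℝ (Fin 2)) := Metric.closedBall 0 1

/-- The standard parametrization of the boundary circle of the disc. -/
noncomputable def circlePt (t : ℝ) : EuclideanSpace ℝ (Fin 2) :=
  (EuclideanSpace.equiv (Fin 2) ℝ).symm ![Real.cos (2 * Real.pi * t), Real.sin (2 * Real.pi * t)]

/-- A homeomorphism of the closed disc is orientation-preserving iff its
restriction to the boundary circle is an orientation-preserving circle
homeomorphism, i.e. admits a strictly increasing lift commuting with `t ↦ t+1`. -/
def DiscOrientationPreserving (f : Disc2 ≃ₜ Disc2) : Prop :=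
  ∃ F : ℝ → ℝ, StrictMono F ∧ (∀ t, F (t + 1) = F t + 1) ∧
    ∀ (t : ℝ) (h : circlePt t ∈ Disc2),
      ((f ⟨circlePt t, h⟩ : Disc2) : EuclideanSpace ℝ (Fin 2)) = circlePt (F t)

/-- A homeomorphism of the closed disc is orientation-reversing iff its
restriction to the boundary circle admits a strictly decreasing lift with
period relation `F (t+1) = F t - 1`. -/
def DiscOrientationReversing (f : Disc2 ≃ₜ Disc2) : Prop :=
  ∃ F : ℝ → ℝ, StrictAnti F ∧ (∀ t, F (t + 1) = F t - 1) ∧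
    ∀ (t : ℝ) (h : circlePt t ∈ Disc2),
      ((f ⟨circlePt t, h⟩ : Disc2) : EuclideanSpace ℝ (Fin 2)) = circlePt (F t)

/-! ### Continuous logarithms -/

theorem exists_clog {A : Type*} [TopologicalSpace A] [SimplyConnectedSpace A]
    [LocallyPathConnectedSpace A] {g : A → ℂ} (hg : Continuous g) (h0 : ∀ a, g a ≠ 0) :
    ∃ L : A → ℂ, Continuous L ∧ ∀ a, Complex.exp (L a) = g a := by
  obtain ⟨a₀⟩ : Nonempty A := inferInstance
  obtain ⟨F, ⟨-, hF⟩, -⟩ := Complex.isCoveringMapOn_exp.existsUnique_continuousMap_lifts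
    (⟨g, hg⟩ : C(A, ℂ)) (a₀ := a₀) (e₀ := Complex.log (g a₀)) (Complex.exp_log (h0 a₀))
    (fun a => by simpa using h0 a)
  exact ⟨F, F.continuous, fun a => congrFun hF a⟩

theorem exists_clog_on {E : Type*} [NormedAddCommGroup E] [NormedSpace ℝ E] {S : Set E}
    (hc : Convex ℝ S) (ho : IsOpen S) {g : E → ℂ} (hg : ContinuousOn g S)
    (h0 : ∀ a ∈ S, g a ≠ 0) :
    ∃ L : E → ℂ, ContinuousOn L S ∧ ∀ a ∈ S, Complex.exp (L a) = g a := by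
  classical
  rcases S.eq_empty_or_nonempty with rfl | hne
  · exact ⟨fun _ => 0, by simp, by simp⟩
  have := hc.contractibleSpace hne
  have := ho.locallyPathConnectedSpace
  obtain ⟨L, hL, he⟩ := exists_clog (A := S) (g := S.domRestrict g) hg.domRestrict
    (fun a => h0 a a.2)
  refine ⟨fun e => if h : e ∈ S then L ⟨e, h⟩ else 0, ?_, ?_⟩
  · rw [continuousOn_iff_continuous_domRestrict]
    convert hL using 1
    ext x; simp
  · intro a ha
    simp only [ha, dif_pos]
    exact he ⟨a, ha⟩

/-- Two continuous logarithms on a preconnected set differ by a constant. -/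
theorem clog_diff {A : Type*} [TopologicalSpace A] {S : Set A} (hS : IsPreconnected S)
    {L₁ L₂ : A → ℂ} (h₁ : ContinuousOn L₁ S) (h₂ : ContinuousOn L₂ S)
    (he : ∀ a ∈ S, Complex.exp (L₁ a) = Complex.exp (L₂ a)) {a b : A} (ha : a ∈ S) (hb : b ∈ S) :
    L₁ b - L₁ a = L₂ b - L₂ a := by
  have := Complex.isCoveringMap_exp.constOn_of_comp (g := fun x => L₁ x - L₂ x) hS
    (h₁.sub h₂) (fun x hx y hy => by
      apply Subtype.ext
      simp [Complex.exp_sub, he x hx, he y hy]) ha hb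
  linear_combination -this

/-- `W` is a continuous logarithm of the difference quotient of `Φ`. -/
def IsW (Φ : ℂ → ℂ) (W : ℂ × ℂ → ℂ) : Prop :=
  ContinuousOn W {p | p.1 ≠ p.2} ∧
    ∀ x y, x ≠ y → Complex.exp (W (x, y)) * (y - x) = Φ y - Φ x

theorem offdiag_preconnected : IsPreconnected {p : ℂ × ℂ | p.1 ≠ p.2} := by
  have : {p : ℂ × ℂ | p.1 ≠ p.2} = Set.range (fun p : ℂ × ℂ => (p.1, p.1 + Complex.exp p.2)) := by
    ext ⟨x, y⟩
    simp only [Set.mem_ofPred_eq, Set.mem_range, Prod.mk.injEq, Prod.exists]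
    constructor
    · intro h
      refine ⟨x, Complex.log (y - x), rfl, ?_⟩
      rw [Complex.exp_log (sub_ne_zero.2 h.symm)]; ring
    · rintro ⟨a, b, rfl, rfl⟩ h
      exact Complex.exp_ne_zero b (by linear_combination -h)
  rw [this]
  exact isPreconnected_range (by fun_prop)

theorem offdiag_open : IsOpen {p : ℂ × ℂ | p.1 ≠ p.2} :=
  isOpen_ne_fun continuous_fst continuous_snd

theorem IsW.inj {Φ : ℂ → ℂ} {W} (h : IsW Φ W) : Function.Injective Φ := by
  intro x y hxy
  by_contra hne
  have := h.2 x y hne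
  rw [hxy, sub_self] at this
  simp [sub_eq_zero, Ne.symm hne, Complex.exp_ne_zero] at this

theorem IsW.symm {Φ : ℂ → ℂ} {W} (h : IsW Φ W) {x y : ℂ} (hxy : x ≠ y) :
    W (x, y) = W (y, x) := by
  have hc : ContinuousOn (fun p : ℂ × ℂ => W (p.2, p.1)) {p | p.1 ≠ p.2} :=
    h.1.comp (by fun_prop) (fun p hp => Ne.symm hp)
  have := clog_diff offdiag_preconnected h.1 hc (fun p hp => by
    have h1 := h.2 p.1 p.2 hp
    have h2 := h.2 p.2 p.1 (Ne.symm hp)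
    have h3 : p.2 - p.1 ≠ 0 := sub_ne_zero.2 (Ne.symm hp)
    apply mul_right_cancel₀ h3
    rw [show ((p.1, p.2) : ℂ × ℂ) = p from rfl] at h1
    rw [h1]; linear_combination h2) (a := (x, y)) (b := (y, x)) hxy hxy.symm
  simp only at this
  linear_combination -this / 2

theorem isW_id : IsW id (fun _ => 0) := ⟨continuousOn_const, by simp⟩

theorem IsW.comp {Φ Ψ : ℂ → ℂ} {W V} (h : IsW Φ W) (h' : IsW Ψ V) (hc : Continuous Ψ) :
    IsW (Φ ∘ Ψ) (fun p => W (Ψ p.1, Ψ p.2) + V p) := by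
  refine ⟨ContinuousOn.add (h.1.comp (by fun_prop) ?_) h'.1, ?_⟩
  · intro p hp; exact fun e => hp (h'.inj e)
  · intro x y hxy
    rw [Complex.exp_add, mul_assoc, h'.2 x y hxy, h.2 _ _ (fun e => hxy (h'.inj e))]
    rfl

theorem IsW.inv {Φ : ℂ ≃ₜ ℂ} {W} (h : IsW Φ W) :
    IsW Φ.symm (fun p => - W (Φ.symm p.1, Φ.symm p.2)) := by
  refine ⟨(h.1.comp (by fun_prop) ?_).neg, ?_⟩
  · intro p hp; exact fun e => hp (Φ.symm.injective e)
  · intro x y hxy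
    have := h.2 (Φ.symm x) (Φ.symm y) (fun e => hxy (Φ.symm.injective e))
    simp only [Homeomorph.apply_symm_apply] at this
    rw [← this, Complex.exp_neg, ← mul_assoc, inv_mul_cancel₀ (Complex.exp_ne_zero _), one_mul]

/-- A lift of the difference map. -/
def IsLiftL (Φ : ℂ → ℂ) (L : ℂ × ℂ → ℂ) : Prop :=
  Continuous L ∧ ∀ p : ℂ × ℂ, Complex.exp (L p) = Φ (p.1 + Complex.exp p.2) - Φ p.1

theorem exists_liftL {Φ : ℂ → ℂ} (hc : Continuous Φ) (hi : Function.Injective Φ) :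
    ∃ L, IsLiftL Φ L := by
  obtain ⟨L, h1, h2⟩ := exists_clog (A := ℂ × ℂ)
    (g := fun p => Φ (p.1 + Complex.exp p.2) - Φ p.1) (by fun_prop) (fun p => by
      rw [sub_ne_zero]
      intro h
      have := hi h
      exact Complex.exp_ne_zero p.2 (by linear_combination this))
  exact ⟨L, h1, h2⟩

theorem IsLiftL.deg {Φ : ℂ → ℂ} {L} (h : IsLiftL Φ L) :
    ∃ d : ℤ, ∀ x w, L (x, w + 2 * Real.pi * Complex.I) =
      L (x, w) + d * (2 * Real.pi * Complex.I) := by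
  have hL := h.1
  have key : ∀ p : ℂ × ℂ, Complex.exp (L (p.1, p.2 + 2 * Real.pi * Complex.I)) =
      Complex.exp (L p) := by
    intro p; rw [h.2, h.2]; simp [Complex.exp_periodic _]
  obtain ⟨d, hd⟩ := Complex.exp_eq_exp_iff_exists_int.1 (key (0, 0))
  refine ⟨d, fun x w => ?_⟩
  have := clog_diff (A := ℂ × ℂ) (S := Set.univ) isPreconnected_univ
    (L₁ := fun p => L (p.1, p.2 + 2 * Real.pi * Complex.I)) (L₂ := L)
    (by fun_prop) (by fun_prop) (fun p _ => key p)
    (a := (0, 0)) (b := (x, w)) trivial trivial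
  simp only at this hd
  linear_combination this + hd

theorem add_int_mul {L : ℂ → ℂ} {d : ℤ} (h : ∀ w, L (w + 2 * Real.pi * Complex.I) =
      L w + d * (2 * Real.pi * Complex.I)) (k : ℤ) (w : ℂ) :
    L (w + k * (2 * Real.pi * Complex.I)) = L w + k * d * (2 * Real.pi * Complex.I) := by
  induction k using Int.induction_on with
  | zero => simp
  | succ n ih =>
    have := h (w + n * (2 * Real.pi * Complex.I))
    push_cast at ih ⊢
    rw [show w + (n + 1) * (2 * Real.pi * Complex.I) =
      w + n * (2 * Real.pi * Complex.I) + 2 * Real.pi * Complex.I by ring, this, ih]; ring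
  | pred n ih =>
    have := h (w + (-n - 1) * (2 * Real.pi * Complex.I))
    push_cast at ih ⊢
    rw [show w + (-n - 1) * (2 * Real.pi * Complex.I) + 2 * Real.pi * Complex.I =
      w + -n * (2 * Real.pi * Complex.I) by ring, ih] at this
    linear_combination -this

theorem IsLiftL.toW {Φ : ℂ → ℂ} {L} (h : IsLiftL Φ L)
    (hd : ∀ x w, L (x, w + 2 * Real.pi * Complex.I) = L (x, w) + 2 * Real.pi * Complex.I) :
    IsW Φ (fun p => L (p.1, Complex.log (p.2 - p.1)) - Complex.log (p.2 - p.1)) := by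
  have hL := h.1
  constructor
  · intro p hp
    apply ContinuousAt.continuousWithinAt
    have hz : p.2 - p.1 ≠ 0 := sub_ne_zero.2 (Ne.symm hp)
    let ℓ : ℂ × ℂ → ℂ := fun q =>
      Complex.log ((q.2 - q.1) / (p.2 - p.1)) + Complex.log (p.2 - p.1)
    have hℓ : ContinuousAt ℓ p := by
      refine ContinuousAt.add (ContinuousAt.clog (by fun_prop) ?_) continuousAt_const
      simp [div_self hz]
    have hcont : ContinuousAt (fun q : ℂ × ℂ => L (q.1, ℓ q) - ℓ q) p :=
      (hL.continuousAt.comp (f := fun q : ℂ × ℂ => (q.1, ℓ q))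
        (continuousAt_fst.prodMk hℓ)).sub hℓ
    refine hcont.congr ?_
    filter_upwards [offdiag_open.mem_nhds hp] with q hq
    have hzq : q.2 - q.1 ≠ 0 := sub_ne_zero.2 (Ne.symm hq)
    obtain ⟨k, hk⟩ := Complex.exp_eq_exp_iff_exists_int.1
      (show Complex.exp (ℓ q) = Complex.exp (Complex.log (q.2 - q.1)) by
        simp only [ℓ]
        rw [Complex.exp_add, Complex.exp_log (div_ne_zero hzq hz), Complex.exp_log hz,
          Complex.exp_log hzq]
        field_simp)
    rw [hk, add_int_mul (L := fun w => L (q.1, w)) (d := 1) (by simpa using hd q.1)]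
    push_cast; ring
  · intro x y hxy
    have hz : y - x ≠ 0 := sub_ne_zero.2 hxy.symm
    simp only
    rw [Complex.exp_sub, h.2, Complex.exp_log hz]
    simp only [add_sub_cancel]
    field_simp

theorem exists_isW_sq (Φ : ℂ ≃ₜ ℂ) : ∃ W, IsW (Φ ∘ Φ) W := by
  obtain ⟨L, hL⟩ := exists_liftL Φ.continuous Φ.injective
  obtain ⟨L', hL'⟩ := exists_liftL Φ.symm.continuous Φ.symm.injective
  obtain ⟨d, hd⟩ := hL.deg
  obtain ⟨d', hd'⟩ := hL'.deg
  have hc := hL.1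
  have hc' := hL'.1
  have hpi : (2 * Real.pi * Complex.I : ℂ) ≠ 0 := Complex.two_pi_I_ne_zero
  have h1 : d * d' = 1 := by
    have := clog_diff (A := ℂ × ℂ) (S := Set.univ) isPreconnected_univ
      (L₁ := fun p => L' (Φ p.1, L p)) (L₂ := fun p => p.2)
      (by fun_prop) (by fun_prop) (fun p _ => by
        rw [hL'.2]
        simp [hL.2]) (a := (0, 0)) (b := (0, 0 + 2 * Real.pi * Complex.I)) trivial trivial
    simp only [hd] at this
    rw [add_int_mul (L := fun w => L' (Φ 0, w)) (d := d') (hd' _)] at this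
    have h2 : ((d : ℂ) * d' - 1) * (2 * Real.pi * Complex.I) = 0 := by
      linear_combination this
    have h3 := (mul_eq_zero.1 h2).resolve_right hpi
    have h4 : ((d * d' : ℤ) : ℂ) = ((1 : ℤ) : ℂ) := by push_cast; linear_combination h3
    exact_mod_cast h4
  have h2 : d * d = 1 := by
    rcases Int.eq_one_or_neg_one_of_mul_eq_one h1 with h | h <;> simp [h]
  have hLL : IsLiftL (Φ ∘ Φ) (fun p => L (Φ p.1, L p)) := by
    refine ⟨by fun_prop, fun p => ?_⟩
    rw [hL.2]; simp [hL.2]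
  refine ⟨_, hLL.toW ?_⟩
  intro x w
  simp only [hd]
  rw [add_int_mul (L := fun w => L (Φ x, w)) (d := d) (hd _)]
  have : (d : ℂ) * d = 1 := by exact_mod_cast h2
  rw [this, one_mul]

theorem exists_isW_of_local_id (Φ : ℂ → ℂ) (hc : Continuous Φ) (hi : Function.Injective Φ)
    {x₀ : ℂ} (hx : ∀ᶠ y in 𝓝 x₀, Φ y = y) : ∃ W, IsW Φ W := by
  obtain ⟨L, hL⟩ := exists_liftL hc hi
  obtain ⟨d, hd⟩ := hL.deg
  refine ⟨_, hL.toW ?_⟩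
  obtain ⟨r, hr, hb⟩ := Metric.eventually_nhds_iff_ball.1 hx
  have hc := hL.1
  set w₀ : ℂ := (Real.log (r/2) : ℂ)
  have := clog_diff (A := ℝ) (S := Set.univ) isPreconnected_univ
      (L₁ := fun s => L (x₀, w₀ + s * Complex.I)) (L₂ := fun s => w₀ + s * Complex.I)
      (by fun_prop) (by fun_prop) (fun p _ => by
        rw [hL.2]
        simp only
        have h1 : Φ x₀ = x₀ := hb x₀ (mem_ball_self hr)
        rw [h1, hb]
        · ring
        · rw [mem_ball, dist_eq_norm, add_sub_cancel_left, Complex.norm_exp]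
          simp only [w₀, Complex.add_re, Complex.ofReal_re, Complex.mul_re, Complex.I_re,
            Complex.ofReal_im, Complex.I_im]
          rw [mul_zero, zero_mul, sub_zero, add_zero, Real.exp_log (by positivity)]
          linarith) (a := 0) (b := 2 * Real.pi) trivial trivial
  have e1 : w₀ + ((2 * Real.pi : ℝ) : ℂ) * Complex.I = w₀ + 2 * Real.pi * Complex.I := by
    push_cast; ring
  simp only [e1, Complex.ofReal_zero, zero_mul, add_zero, hd] at this
  have hd1 : (d : ℂ) * (2 * Real.pi * Complex.I) = 2 * Real.pi * Complex.I := by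
    linear_combination this
  intro x w
  rw [hd, hd1]

theorem index_lemma {Φ : ℂ ≃ₜ ℂ} {W} (hW : IsW Φ W) (hfix : ∀ p, Φ p ≠ p) {Γ : ℝ → ℂ}
    (hΓ : Continuous Γ) (hstep : ∀ t, Γ (t + 1) = Φ (Γ t)) {T : ℝ} (hT : 2 ≤ T)
    (hclose : Γ T = Γ 0) (hinj : ∀ s t, 0 ≤ s → s < t → t < T → Γ s ≠ Γ t) : False := by
  have hT0 : 0 < T := by linarith
  obtain ⟨θ, hθc, hθ⟩ := exists_clog (A := ℂ) (g := fun p => Φ p - p) (by fun_prop)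
    (fun p => sub_ne_zero.2 (hfix p))
  set c : ℝ → ℂ := fun t => Γ (T * Int.fract (t / T)) with hcdef
  have hcc : Continuous c := by
    have h1 : Continuous ((fun u : ℝ => Γ (T * u)) ∘ Int.fract) :=
      ContinuousOn.comp_fract'' (by fun_prop) (by simp [hclose])
    exact h1.comp (continuous_id.div_const T)
  have hcper : ∀ t, c (t + T) = c t := by
    intro t
    simp only [hcdef]
    rw [add_div, div_self hT0.ne', Int.fract_add_one]
  have hcΓ : ∀ t, 0 ≤ t → t ≤ T → c t = Γ t := by
    intro t h0 h1
    rcases h1.lt_or_eq with h1 | rfl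
    · simp only [hcdef]
      rw [Int.fract_eq_self.2 ⟨by positivity, by rw [div_lt_one hT0]; exact h1⟩]
      congr 1; field_simp
    · simp only [hcdef]
      rw [div_self hT0.ne', Int.fract_one, mul_zero, hclose]
  have hcinj : ∀ s t, s < t → t < s + T → c t ≠ c s := by
    intro s t h1 h2 he
    have hfs := Int.fract_lt_one (s / T)
    have hft := Int.fract_lt_one (t / T)
    have hfs0 := Int.fract_nonneg (s / T)
    have hft0 := Int.fract_nonneg (t / T)
    have h3 : Int.fract (t / T) = Int.fract (s / T) := by
      simp only [hcdef] at he
      rcases lt_trichotomy (Int.fract (t / T)) (Int.fract (s / T)) with h | h | h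
      · exact absurd he (hinj _ _ (by positivity) (by gcongr) (by nlinarith))
      · exact h
      · exact absurd he.symm (hinj _ _ (by positivity) (by gcongr) (by nlinarith))
    obtain ⟨z, hz⟩ := Int.fract_eq_fract.1 h3
    have h4 : t - s = z * T := by field_simp at hz; linarith
    have h5 : (0:ℝ) < z := by
      by_contra hn
      push Not at hn
      nlinarith
    have h6 : (z:ℝ) < 1 := by
      by_contra hn
      push Not at hn
      nlinarith
    have h7 : 0 < z := by exact_mod_cast h5
    have h8 : z < 1 := by exact_mod_cast h6
    omega
  set Δ : Set (ℝ × ℝ) := {p | p.1 < p.2 ∧ p.2 < p.1 + T} with hΔ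
  have hΔc : Convex ℝ Δ := by
    rintro ⟨a, b⟩ ⟨h1, h2⟩ ⟨a', b'⟩ ⟨h3, h4⟩ u v hu hv huv
    simp only [hΔ, Set.mem_ofPred_eq, Prod.smul_mk, Prod.mk_add_mk, smul_eq_mul] at *
    rcases hu.eq_or_lt with rfl | hu
    · have : v = 1 := by linarith
      subst this; constructor <;> linarith
    · have e : T = u * T + v * T := by rw [← add_mul, huv, one_mul]
      constructor
      · nlinarith
      · nlinarith
  have hΔo : IsOpen Δ :=
    (isOpen_lt continuous_fst continuous_snd).inter
      (isOpen_lt continuous_snd (by fun_prop))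
  obtain ⟨A, hAc, hA⟩ := exists_clog_on hΔc hΔo (g := fun p => c p.2 - c p.1)
    (by fun_prop) (fun p hp => sub_ne_zero.2 (hcinj _ _ hp.1 hp.2))
  have hΔpre := hΔc.isPreconnected
  -- the flip
  have hflip : ∀ p ∈ Δ, ((p.2, p.1 + T) : ℝ × ℝ) ∈ Δ := by
    rintro ⟨s, t⟩ ⟨h1, h2⟩
    exact ⟨h2, by simpa using h1⟩
  set κ : ℂ := A (1, T) - A (0, 1) with hκ
  have h01 : ((0, 1) : ℝ × ℝ) ∈ Δ := ⟨by norm_num, by simp; linarith⟩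
  have hκA : ∀ s t, s < t → t < s + T → A (t, s + T) = A (s, t) + κ := by
    intro s t h1 h2
    have := clog_diff hΔpre (L₁ := fun p => A (p.2, p.1 + T))
      (L₂ := fun p => A p + Real.pi * Complex.I)
      (hAc.comp (by fun_prop) hflip) (hAc.add continuousOn_const)
      (fun p hp => by
        rw [hA _ (hflip p hp), Complex.exp_add, hA p hp, Complex.exp_pi_mul_I]
        simp only [hcper]; ring) h01 (b := (s, t)) ⟨h1, h2⟩
    simp only [zero_add] at this
    rw [hκ]; linear_combination this
  have hκ0 : κ ≠ 0 := by
    intro h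
    have h1 := hκA 0 1 (by norm_num) (by linarith)
    have h2 := hA (0, 1) h01
    have h3 := hA (1, 0 + T) (hflip _ h01)
    rw [h1, h, add_zero, h2] at h3
    simp only [zero_add] at h3
    have h4 := hcper 0
    rw [zero_add] at h4
    rw [h4] at h3
    exact hcinj 0 1 (by norm_num) (by linarith) (by linear_combination h3 / 2)
  -- the shifted logarithm
  set B : ℝ × ℝ → ℂ := fun p => A (p.1 - 1, p.2 - 1) + W (c (p.1 - 1), c (p.2 - 1)) with hB
  have hsh : ∀ p ∈ Δ, ((p.1 - 1, p.2 - 1) : ℝ × ℝ) ∈ Δ := by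
    rintro ⟨s, t⟩ ⟨h1, h2⟩
    simp only at h1 h2
    exact ⟨by simpa using h1, by simp only; linarith⟩
  have hBc : ContinuousOn B Δ := by
    refine (hAc.comp (by fun_prop) hsh).add (hW.1.comp (by fun_prop) ?_)
    intro p hp
    exact (hcinj _ _ (hsh p hp).1 (hsh p hp).2).symm
  have hBe : ∀ p ∈ Δ, Complex.exp (B p) = Φ (c (p.2 - 1)) - Φ (c (p.1 - 1)) := by
    intro p hp
    simp only [hB]
    rw [Complex.exp_add, hA _ (hsh p hp), mul_comm, hW.2]
    exact (hcinj _ _ (hsh p hp).1 (hsh p hp).2).symm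
  have hκB : B (T, 1 + T) = B (1, T) + κ := by
    simp only [hB]
    rw [show (1 + T - 1 : ℝ) = 0 + T by ring, show (1 - 1 : ℝ) = 0 by ring,
      hκA 0 (T - 1) (by linarith) (by linarith), hcper,
      hW.symm (hcinj 0 (T - 1) (by linarith) (by linarith))]
    ring
  -- comparison of A and B on the triangle
  set Tr : Set (ℝ × ℝ) := {p | 1 ≤ p.1 ∧ p.1 < p.2 ∧ p.2 ≤ T} with hTr
  have hTrc : Convex ℝ Tr := by
    rintro ⟨a, b⟩ ⟨h1, h2, h5⟩ ⟨a', b'⟩ ⟨h3, h4, h6⟩ u v hu hv huv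
    simp only [hTr, Set.mem_ofPred_eq, Prod.smul_mk, Prod.mk_add_mk, smul_eq_mul] at *
    rcases hu.eq_or_lt with rfl | hu
    · have : v = 1 := by linarith
      subst this; refine ⟨?_, ?_, ?_⟩ <;> linarith
    · refine ⟨by nlinarith, by nlinarith, by nlinarith⟩
  have hTrΔ : Tr ⊆ Δ := by
    rintro ⟨a, b⟩ ⟨h1, h2, h5⟩
    simp only at h1 h2 h5
    exact ⟨h2, by simp only; linarith⟩
  have hcΦ : ∀ t, 1 ≤ t → t ≤ T + 1 → Φ (c (t - 1)) = Γ t := by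
    intro t h1 h2
    rw [hcΓ (t - 1) (by linarith) (by linarith), ← hstep]; congr 1; ring
  have hcmp := clog_diff hTrc.isPreconnected (hAc.mono hTrΔ) (hBc.mono hTrΔ)
    (fun p hp => by
      rw [hA p (hTrΔ hp), hBe p (hTrΔ hp)]
      obtain ⟨h1, h2, h3⟩ := hp
      rw [hcΦ _ (by linarith) (by linarith), hcΦ _ (by linarith) (by linarith),
        hcΓ _ (by linarith) (by linarith), hcΓ _ (by linarith) (by linarith)])
    (a := (1, T)) (b := (T - 1, T)) ⟨le_refl _, by simp only; linarith, le_refl _⟩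
    ⟨by simp only; linarith, by simp, le_refl _⟩
  -- comparison with θ
  have hd1 := clog_diff (isPreconnected_Icc (a := 0) (b := T - 1))
    (L₁ := fun t => θ (Γ t)) (L₂ := fun t => A (t, t + 1)) (by fun_prop)
    (hAc.comp (by fun_prop) (fun t ht => ⟨by simp, by simp only; linarith⟩))
    (fun t ht => by
      rw [hθ, hA _ ⟨by simp, by simp only; linarith⟩, ← hstep]
      simp only
      rw [hcΓ _ (by linarith [ht.1]) (by linarith [ht.2]),
        hcΓ _ (by linarith [ht.1]) (by linarith [ht.2])])
    (a := 0) (b := T - 1) ⟨le_refl _, by linarith⟩ ⟨by linarith, le_refl _⟩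
  have hd2 := clog_diff (isPreconnected_Icc (a := T - 1) (b := T))
    (L₁ := fun t => θ (Γ t)) (L₂ := fun t => B (t, t + 1)) (by fun_prop)
    (hBc.comp (by fun_prop) (fun t ht => ⟨by simp, by simp only; linarith⟩))
    (fun t ht => by
      rw [hθ, hBe _ ⟨by simp, by simp only; linarith⟩, ← hstep]
      simp only
      rw [hcΦ _ (by linarith [ht.1]) (by linarith [ht.2]),
        hcΦ _ (by linarith [ht.1]) (by linarith [ht.2])])
    (a := T - 1) (b := T) ⟨le_refl _, by linarith⟩ ⟨by linarith, le_refl _⟩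
  simp only [zero_add, sub_add_cancel] at hd1 hd2
  rw [hclose] at hd2
  rw [add_comm T 1, hκB] at hd2
  apply hκ0
  have hk2 : A (1, T) = A (0, 1) + κ := by rw [hκ]; ring
  linear_combination -(hd1 + hd2 + hcmp + hk2) / 2

theorem no_two_cycle {Φ : ℂ ≃ₜ ℂ} {W} (hW : IsW Φ W) (hfix : ∀ p, Φ p ≠ p) (x : ℂ) :
    Φ (Φ x) ≠ x := by
  intro hx
  obtain ⟨θ, hθc, hθ⟩ := exists_clog (A := ℂ) (g := fun p => Φ p - p) (by fun_prop)
    (fun p => sub_ne_zero.2 (hfix p))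
  have hc : Continuous (fun p => W (p, Φ p)) := by
    rw [← continuousOn_univ]
    exact hW.1.comp (by fun_prop) (fun p _ => (hfix p).symm)
  have := clog_diff (A := ℂ) (S := Set.univ) isPreconnected_univ
    (L₁ := fun p => θ (Φ p)) (L₂ := fun p => θ p + W (p, Φ p)) (by fun_prop)
    (hθc.add hc).continuousOn
    (fun p _ => by
      rw [hθ, Complex.exp_add, hθ, mul_comm, hW.2 _ _ (hfix p).symm]) (a := x) (b := Φ x)
    trivial trivial
  simp only [hx] at this
  rw [hW.symm (hfix x)] at this
  have h1 := hθ x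
  have h2 := hθ (Φ x)
  have h3 : θ x = θ (Φ x) := by linear_combination this / 2
  rw [← h3, h1, hx] at h2
  exact hfix x (by linear_combination h2 / 2)

theorem push_center (x : ℂ) {r : ℝ} (hr : 0 < r) {v : ℂ} (hv : v ∈ ball x r) :
    ∃ φ : ℂ ≃ₜ ℂ, (∃ W, IsW φ W) ∧ φ x = v ∧ ∀ z, z ∉ ball x r → φ z = z := by
  set c : ℂ := v - x with hc
  have hcr : ‖c‖ < r := by simpa [hc, dist_eq_norm] using hv
  set ψ : ℂ → ℂ := fun z => ((max (1 - ‖z - x‖ / r) 0 : ℝ) : ℂ) * c with hψ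
  have hlip : ∀ a b, ‖ψ a - ψ b‖ ≤ (‖c‖ / r) * ‖a - b‖ := by
    intro a b
    simp only [hψ]
    rw [← sub_mul, norm_mul, ← Complex.ofReal_sub, Complex.norm_real, Real.norm_eq_abs]
    have h1 : |max (1 - ‖a - x‖ / r) 0 - max (1 - ‖b - x‖ / r) 0| ≤ ‖a - b‖ / r := by
      refine (abs_max_sub_max_le_abs _ _ _).trans ?_
      have : (1 - ‖a - x‖ / r) - (1 - ‖b - x‖ / r) = (‖b - x‖ - ‖a - x‖) / r := by ring
      rw [this, abs_div, abs_of_pos hr]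
      gcongr
      have := abs_norm_sub_norm_le (b - x) (a - x)
      rwa [sub_sub_sub_cancel_right, norm_sub_rev b a] at this
    calc _ ≤ ‖a - b‖ / r * ‖c‖ := by gcongr
      _ = _ := by ring
  set k : NNReal := ⟨‖c‖ / r, by positivity⟩ with hk
  have hk1 : (k : ℝ) < 1 := (div_lt_one hr).2 hcr
  have hA : ApproximatesLinearOn (fun z => z + ψ z) ((ContinuousLinearEquiv.refl ℝ ℂ : ℂ ≃L[ℝ] ℂ) : ℂ →L[ℝ] ℂ)
      Set.univ k := by
    intro a _ b _
    have := hlip a b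
    have e : (k : ℝ) = ‖c‖ / r := rfl
    rw [← e] at this
    simpa [show a + ψ a - (b + ψ b) - (a - b) = ψ a - ψ b by ring] using this
  refine ⟨hA.toHomeomorph _ (Or.inr ?_), ⟨fun p => Complex.log (1 + (ψ p.2 - ψ p.1) / (p.2 - p.1)), ?_, ?_⟩, ?_, ?_⟩
  · have : ‖((ContinuousLinearEquiv.refl ℝ ℂ).symm : ℂ →L[ℝ] ℂ)‖₊ = 1 := by
      ext
      simp
    rw [this]
    rw [inv_one]
    exact_mod_cast hk1
  · refine ContinuousOn.clog ?_ ?_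
    · have : Continuous ψ := by simp only [hψ]; fun_prop
      refine ContinuousOn.add continuousOn_const (ContinuousOn.div (by fun_prop) (by fun_prop) ?_)
      intro p hp
      exact sub_ne_zero.2 (Ne.symm hp)
    · intro p hp
      apply Complex.mem_slitPlane_of_norm_lt_one
      rw [norm_div]
      have h0 : 0 < ‖p.2 - p.1‖ := norm_pos_iff.2 (sub_ne_zero.2 (Ne.symm hp))
      rw [div_lt_one h0]
      refine (hlip _ _).trans_lt ?_
      have : ‖c‖ / r < 1 := (div_lt_one hr).2 hcr
      nlinarith
  · intro a b hab
    have h0 : b - a ≠ 0 := sub_ne_zero.2 (Ne.symm hab)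
    have h0' : 0 < ‖b - a‖ := norm_pos_iff.2 h0
    have hne : 1 + (ψ b - ψ a) / (b - a) ≠ 0 := by
      intro h
      have h1 : ‖(ψ b - ψ a) / (b - a)‖ = 1 := by
        rw [show (ψ b - ψ a) / (b - a) = -1 by linear_combination h]; simp
      rw [norm_div, div_eq_one_iff_eq h0'.ne'] at h1
      have := hlip b a
      have : ‖c‖ / r < 1 := (div_lt_one hr).2 hcr
      nlinarith
    rw [Complex.exp_log hne]
    change _ = (b + ψ b) - (a + ψ a)
    field_simp
    ring
  · change x + ψ x = v
    simp [hψ, hc]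
  · intro z hz
    change z + ψ z = z
    have : r ≤ ‖z - x‖ := by simpa [dist_eq_norm] using hz
    have h2 : 1 - ‖z - x‖ / r ≤ 0 := by
      have := (one_le_div hr).2 this
      linarith
    simp [hψ, max_eq_right h2]

theorem push_exists (x : ℂ) {r : ℝ} {u v : ℂ} (hu : u ∈ ball x r) (hv : v ∈ ball x r) :
    ∃ φ : ℂ ≃ₜ ℂ, (∃ W, IsW φ W) ∧ φ u = v ∧ ∀ z, z ∉ ball x r → φ z = z := by
  have hr : 0 < r := pos_of_mem_ball hu
  obtain ⟨φ, ⟨W, hW⟩, h1, h2⟩ := push_center x hr hu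
  obtain ⟨φ', ⟨W', hW'⟩, h1', h2'⟩ := push_center x hr hv
  refine ⟨φ.symm.trans φ', ⟨_, (hW'.comp hW.inv φ.symm.continuous)⟩, ?_, ?_⟩
  · simp [← h1, h1']
  · intro z hz
    have : φ.symm z = z := by rw [Homeomorph.symm_apply_eq, h2 z hz]
    simp [this, h2' z hz]

theorem push_lemma {Φ : ℂ ≃ₜ ℂ} {W} (hW : IsW Φ W) (hfix : ∀ p, Φ p ≠ p) {x : ℂ} {r : ℝ}
    (hfree : ∀ u ∈ ball x r, Φ u ∉ ball x r) {u : ℂ} (hu : u ∈ ball x r) {n : ℕ} (hn : 1 ≤ n)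
    (hun : Φ^[n] u ∈ ball x r) :
    ∃ (Φ' : ℂ ≃ₜ ℂ) (W' : _), IsW Φ' W' ∧ (∀ p, Φ' p ≠ p) ∧ ∃ m, 1 ≤ m ∧ m ≤ n ∧ Φ'^[m] u = u := by
  classical
  have hex : ∃ m, 1 ≤ m ∧ Φ^[m] u ∈ ball x r := ⟨n, hn, hun⟩
  set m := Nat.find hex with hm
  obtain ⟨hm1, hmu⟩ := Nat.find_spec hex
  have hmin : ∀ i, 1 ≤ i → i < m → Φ^[i] u ∉ ball x r := fun i h1 h2 h3 =>
    Nat.find_min hex h2 ⟨h1, h3⟩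
  obtain ⟨φ, ⟨V, hV⟩, h1, h2⟩ := push_exists x hmu hu
  refine ⟨Φ.trans φ, _, hV.comp hW Φ.continuous, ?_, m, hm1, Nat.find_min' hex ⟨hn, hun⟩, ?_⟩
  · intro p hp
    by_cases hb : Φ p ∈ ball x r
    · have : p ∈ ball x r := by
        by_contra hpb
        have h3 := h2 p hpb
        have : Φ p = p := φ.injective (by rw [h3]; exact hp)
        exact hfix p this
      exact hfree p this hb
    · have := h2 _ hb
      exact hfix p (this.symm.trans hp)
  · have key : ∀ i, i < m → (Φ.trans φ)^[i] u = Φ^[i] u := by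
      intro i
      induction i with
      | zero => simp
      | succ i ih =>
        intro hi
        rw [Function.iterate_succ_apply', ih (by omega), Function.iterate_succ_apply']
        have := hmin (i+1) (by omega) hi
        rw [Function.iterate_succ_apply'] at this
        exact h2 _ this
    obtain ⟨j, hj⟩ : ∃ j, m = j + 1 := ⟨m - 1, by omega⟩
    have h3 : Φ^[j+1] u = Φ^[m] u := by rw [hj]
    rw [hj, Function.iterate_succ_apply', key j (by omega)]
    rw [Function.iterate_succ_apply'] at h3
    change φ (Φ _) = u
    rw [h3, h1]

theorem free_closed {G : ℂ ≃ₜ ℂ} {x : ℂ} {r : ℝ} (hr : 0 < r) (hfree : ∀ u ∈ ball x r, G u ∉ ball x r) :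
    (∀ u ∈ ball x r, G u ∉ closedBall x r) ∧ ∀ u ∈ closedBall x r, G u ∉ ball x r := by
  constructor
  · intro u hu h
    rw [← closure_ball x hr.ne'] at h
    have hop : IsOpen (G '' ball x r) := G.isOpenMap _ isOpen_ball
    obtain ⟨y, ⟨v, hv, rfl⟩, hy⟩ := mem_closure_iff.1 h _ hop ⟨u, hu, rfl⟩
    exact hfree v hv hy
  · intro u hu h
    rw [← closure_ball x hr.ne'] at hu
    have hop : IsOpen (G ⁻¹' ball x r) := isOpen_ball.preimage G.continuous
    obtain ⟨y, hy, hy'⟩ := mem_closure_iff.1 hu _ hop h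
    exact hfree y hy' hy

theorem no_periodic {Φ : ℂ ≃ₜ ℂ} {W} (hW : IsW Φ W) (hfix : ∀ p, Φ p ≠ p) {x : ℂ} {n : ℕ}
    (hn : 1 ≤ n) (hx : Φ^[n] x = x) : False := by
  obtain ⟨w, hw⟩ : ∃ w, ∀ u, max (dist w x) (dist (Φ w) x) ≤ max (dist u x) (dist (Φ u) x) := by
    have hc : Continuous fun u => max (dist u x) (dist (Φ u) x) := by fun_prop
    refine hc.exists_forall_le ?_
    refine tendsto_atTop_mono (fun u => le_max_left _ _) ?_
    exact tendsto_dist_right_cocompact_atTop x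
  set r := max (dist w x) (dist (Φ w) x) with hrdef
  have hr : 0 < r := by
    by_contra h
    have h1 : dist w x ≤ 0 := (le_max_left _ _).trans (not_lt.1 h)
    have h2 : dist (Φ w) x ≤ 0 := (le_max_right _ _).trans (not_lt.1 h)
    rw [dist_le_zero] at h1 h2
    exact hfix w (h2.trans h1.symm)
  have hfree : ∀ u ∈ ball x r, Φ u ∉ ball x r := by
    intro u hu hu'
    exact absurd (hw u) (not_le.2 (max_lt hu hu'))
  have hfree2 : ∀ u ∈ ball x r, (Φ.trans Φ) u ∉ ball x r := by
    intro u hu hu'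
    obtain ⟨Φ', W', hW', hf', m, hm1, hm2, hm⟩ := push_lemma hW hfix hfree hu (n := 2) (by norm_num) hu'
    interval_cases m
    · exact hf' u hm
    · exact no_two_cycle hW' hf' u hm
  obtain ⟨fa, fb⟩ := free_closed hr hfree
  obtain ⟨fc, fd⟩ := free_closed hr hfree2
  have hwc : w ∈ closedBall x r := mem_closedBall.2 (le_max_left _ _)
  have hwc' : Φ w ∈ closedBall x r := mem_closedBall.2 (le_max_right _ _)
  have hwr : dist w x = r := le_antisymm hwc (not_lt.1 fun h => fa w h hwc')
  have hwr' : dist (Φ w) x = r := le_antisymm hwc' (not_lt.1 fun h => fb w hwc h)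
  set α : ℝ → ℂ := fun t => x + (max (1 - 2 * t) 0 : ℝ) * (w - x) + (max (2 * t - 1) 0 : ℝ) * (Φ w - x) with hα
  have hαc : Continuous α := by simp only [hα]; fun_prop
  have hα0 : α 0 = w := by simp [hα]
  have hα1 : α 1 = Φ w := by simp [hα]; norm_num
  have hαh : α (1/2) = x := by simp [hα]
  have hαd : ∀ t, dist (α t) x = |1 - 2 * t| * r := by
    intro t
    rw [dist_eq_norm] at hwr hwr' ⊢
    simp only [hα]
    rcases le_total (2 * t) 1 with h | h
    · rw [max_eq_left (by linarith), max_eq_right (by linarith), abs_of_nonneg (by linarith)]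
      rw [show x + ((1 - 2 * t : ℝ) : ℂ) * (w - x) + ((0:ℝ):ℂ) * (Φ w - x) - x
        = ((1 - 2 * t : ℝ) : ℂ) * (w - x) by push_cast; ring]
      rw [norm_mul, Complex.norm_real, Real.norm_eq_abs, abs_of_nonneg (by linarith), hwr]
    · rw [max_eq_right (by linarith), max_eq_left (by linarith), abs_of_nonpos (by linarith)]
      rw [show x + ((0:ℝ):ℂ) * (w - x) + ((2 * t - 1 : ℝ):ℂ) * (Φ w - x) - x
        = ((2 * t - 1 : ℝ) : ℂ) * (Φ w - x) by push_cast; ring]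
      rw [norm_mul, Complex.norm_real, Real.norm_eq_abs, abs_of_nonneg (by linarith), hwr']
      ring
  have hαcb : ∀ t, 0 ≤ t → t ≤ 1 → α t ∈ closedBall x r := by
    intro t h0 h1
    rw [mem_closedBall, hαd]
    have : |1 - 2 * t| ≤ 1 := abs_le.2 ⟨by linarith, by linarith⟩
    nlinarith
  have hαb : ∀ t, 0 < t → t < 1 → α t ∈ ball x r := by
    intro t h0 h1
    rw [mem_ball, hαd]
    have : |1 - 2 * t| < 1 := abs_lt.2 ⟨by linarith, by linarith⟩
    nlinarith
  have hαi : ∀ s t, 0 ≤ s → s < t → t ≤ 1 → α s ≠ α t := by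
    intro s t h0 hst h1 he
    have h2 : |1 - 2 * s| = |1 - 2 * t| := by
      have := congrArg (fun z => dist z x) he
      simp only [hαd] at this
      exact mul_right_cancel₀ hr.ne' this
    rw [abs_eq_abs] at h2
    have h3 : t = 1 - s := by rcases h2 with h | h <;> linarith
    have h4 : s < 1/2 := by linarith
    simp only [hα] at he
    rw [max_eq_left (by linarith), max_eq_right (by linarith), max_eq_right (by linarith),
      max_eq_left (by linarith), h3] at he
    have h5 : ((1 - 2 * s : ℝ) : ℂ) * (w - Φ w) = 0 := by
      push_cast at he ⊢
      linear_combination he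
    rcases mul_eq_zero.1 h5 with h | h
    · have : (1 - 2 * s : ℝ) = 0 := by exact_mod_cast h
      linarith
    · exact hfix w (sub_eq_zero.1 h).symm
  set Γ : ℝ → ℂ := fun t => (Φ ^ ⌊t⌋ : ℂ ≃ₜ ℂ) (α (Int.fract t)) with hΓ
  have hz : ∀ (k : ℤ) t, Γ (t + k) = (Φ ^ k : ℂ ≃ₜ ℂ) (Γ t) := by
    intro k t
    simp only [hΓ, Int.floor_add_intCast, Int.fract_add_intCast]
    rw [add_comm, zpow_add]; rfl
  have hstep : ∀ t, Γ (t + 1) = Φ (Γ t) := by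
    intro t
    simpa using hz 1 t
  have hΓα : ∀ t, 0 ≤ t → t < 1 → Γ t = α t := by
    intro t h0 h1
    simp only [hΓ]
    rw [Int.floor_eq_zero_iff.2 ⟨h0, h1⟩, Int.fract_eq_self.2 ⟨h0, h1⟩]; simp
  have hΓα' : ∀ t, 0 ≤ t → t ≤ 1 → Γ t = α t := by
    intro t h0 h1
    rcases h1.lt_or_eq with h | rfl
    · exact hΓα t h0 h
    · have := hstep 0
      rw [zero_add, hΓα 0 le_rfl one_pos, hα0] at this
      rw [this, hα1]
  have hsym : ∀ t, Γ t = (Φ ^ ⌊t⌋ : ℂ ≃ₜ ℂ) (Γ (t - ⌊t⌋)) := by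
    intro t
    rw [← hz]; simp
  have hshift : ∀ (k : ℤ) s t, Γ s = Γ t → Γ (s + k) = Γ (t + k) := by
    intro k s t h
    rw [hz, hz, h]
  have hΓc : Continuous Γ := by
    have h1 : ∀ t, 0 ≤ t → t < 1 → ContinuousAt Γ t := by
      intro t h0 h1
      have hg : Continuous fun s : ℝ => if s ≤ 0 then Φ.symm (α (s + 1)) else α s := by
        refine Continuous.if_le (by fun_prop) hαc continuous_id continuous_const ?_
        intro s hs
        rw [hs, zero_add, hα1, hα0]; simp
      refine hg.continuousAt.congr ?_
      filter_upwards [Ioo_mem_nhds (show (-1:ℝ) < t by linarith) h1] with s hs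
      split_ifs with h
      · rw [Homeomorph.symm_apply_eq, ← hstep, hΓα' _ (by linarith [hs.1]) (by linarith)]
      · rw [hΓα _ (by linarith) hs.2]
    rw [continuous_iff_continuousAt]
    intro t
    have h2 := h1 (t - ⌊t⌋) (by linarith [Int.floor_le t]) (by linarith [Int.lt_floor_add_one t])
    have h3 : Γ = fun s => (Φ ^ ⌊t⌋ : ℂ ≃ₜ ℂ) (Γ (s - ⌊t⌋)) := by
      funext s
      rw [← hz]; simp
    rw [h3]
    have h4 : ContinuousAt (fun s : ℝ => s - ⌊t⌋) t := by fun_prop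
    exact (Φ ^ ⌊t⌋ : ℂ ≃ₜ ℂ).continuous.continuousAt.comp (ContinuousAt.comp (f := fun s : ℝ => s - ⌊t⌋) h2 h4)
  have hgap0 : ∀ s t, 0 ≤ s → s < 1 → s < t → Γ s = Γ t → 2 ≤ t - s := by
    intro s t h0 h1 hst he
    by_contra hlt
    push Not at hlt
    rcases le_or_gt t 1 with ht1 | ht1
    · rw [hΓα' s h0 h1.le, hΓα' t (by linarith) ht1] at he
      exact hαi s t h0 hst ht1 he
    rcases lt_or_ge t 2 with ht2 | ht2
    · have e : Γ t = Φ (Γ (t - 1)) := by rw [← hstep]; simp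
      rw [e, hΓα s h0 h1, hΓα (t-1) (by linarith) (by linarith)] at he
      exact fa _ (hαb (t-1) (by linarith) (by linarith)) (he ▸ hαcb s h0 h1.le)
    · have hs : 0 < s := by linarith
      have e : Γ t = Φ (Φ (Γ (t - 2))) := by rw [← hstep, ← hstep]; congr 1; ring
      rw [e, hΓα s h0 h1, hΓα (t-2) (by linarith) (by linarith)] at he
      exact fd _ (hαcb (t-2) (by linarith) (by linarith)) (show Φ (Φ _) ∈ _ from he ▸ hαb s hs h1)
  have hgap : ∀ s t, s < t → Γ s = Γ t → 2 ≤ t - s := by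
    intro s t hst he
    have := hgap0 (s + (-⌊s⌋ : ℤ)) (t + (-⌊s⌋ : ℤ)) (by push_cast; linarith [Int.floor_le s])
      (by push_cast; linarith [Int.lt_floor_add_one s]) (by linarith) (hshift _ _ _ he)
    linarith
  have hret : Γ (1/2) = Γ (1/2 + n) := by
    have h := hz n (1/2)
    have h2 : Γ (1/2) = x := by rw [hΓα _ (by norm_num) (by norm_num), hαh]
    push_cast at h
    rw [h, h2]
    rw [zpow_natCast]
    have : ∀ m : ℕ, (Φ ^ m : ℂ ≃ₜ ℂ) x = Φ^[m] x := by
      intro m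
      induction m with
      | zero => rfl
      | succ m ih => rw [pow_succ', Function.iterate_succ_apply', ← ih]; rfl
    rw [this, hx]
  have hn2 : (2:ℝ) ≤ n := by
    have := hgap (1/2) (1/2 + n) (by have : (1:ℝ) ≤ n := by exact_mod_cast hn
                                     linarith) hret
    linarith
  set P : Set (ℝ × ℝ) := (Set.Icc 0 1 ×ˢ Set.Icc 0 (n + 2 : ℝ)) ∩ {p | p.1 + 2 ≤ p.2 ∧ Γ p.1 = Γ p.2} with hP
  have hPc : IsCompact P := by
    refine (isCompact_Icc.prod isCompact_Icc).inter_right ?_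
    have c1 : IsClosed {p : ℝ × ℝ | p.1 + 2 ≤ p.2} := isClosed_le (by fun_prop) (by fun_prop)
    have c2 : IsClosed {p : ℝ × ℝ | Γ p.1 = Γ p.2} := isClosed_eq (by fun_prop) (by fun_prop)
    exact c1.inter c2
  obtain ⟨⟨s0, t0⟩, ⟨⟨⟨hs0, hs1⟩, -⟩, h2, he⟩, hmin⟩ := hPc.exists_isMinOn
    (⟨(1/2, 1/2 + n), ⟨⟨by norm_num, by norm_num⟩, ⟨by positivity, by linarith⟩⟩, by simp only; linarith, hret⟩ : P.Nonempty)
    (f := fun p => p.2 - p.1) (by fun_prop)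
  have hTn : t0 - s0 ≤ n := by
    have := hmin (show ((1/2:ℝ), (1/2 + n : ℝ)) ∈ P from ⟨⟨⟨by norm_num, by norm_num⟩, ⟨by positivity, by linarith⟩⟩, by simp only; linarith, hret⟩)
    simp at this
    linarith
  simp only at hs0 hs1 h2 he
  refine index_lemma hW hfix (Γ := fun u => Γ (s0 + u)) (by fun_prop) ?_ (T := t0 - s0) (by linarith) ?_ ?_
  · intro t
    rw [← hstep]; congr 1; ring
  · simp [he]
  · intro s t h0 hst htT hse
    have hg := hgap _ _ (by linarith) hse
    have h3 := hshift (-⌊s0 + s⌋) _ _ hse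
    have h4 := Int.floor_le (s0 + s)
    have h5 := Int.lt_floor_add_one (s0 + s)
    push_cast at h3
    have := hmin (show (s0 + s + -(⌊s0 + s⌋:ℝ), s0 + t + -(⌊s0 + s⌋:ℝ)) ∈ P from
      ⟨⟨⟨by linarith, by linarith⟩, ⟨by linarith, by linarith⟩⟩, by simp only []; linarith, h3⟩)
    simp at this
    linarith

theorem no_recurrent {Φ : ℂ ≃ₜ ℂ} {W} (hW : IsW Φ W) (hfix : ∀ p, Φ p ≠ p) (x : ℂ) :
    ∃ δ > 0, ∀ n : ℕ, 1 ≤ n → δ ≤ dist (Φ^[n] x) x := by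
  obtain ⟨r, hr, hfree⟩ : ∃ r > 0, ∀ u ∈ ball x r, Φ u ∉ ball x r := by
    have h0 : 0 < dist (Φ x) x := dist_pos.2 (hfix x)
    have hc := Metric.continuous_iff.1 Φ.continuous x (dist (Φ x) x / 2) (by positivity)
    obtain ⟨δ, hδ, hd⟩ := hc
    refine ⟨min δ (dist (Φ x) x / 2), by positivity, fun u hu hu' => ?_⟩
    have h1 := hd u (lt_of_lt_of_le hu (min_le_left _ _))
    have h2 : dist (Φ u) x < dist (Φ x) x / 2 := lt_of_lt_of_le hu' (min_le_right _ _)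
    have := dist_triangle (Φ x) (Φ u) x
    rw [dist_comm (Φ x) (Φ u)] at this
    linarith
  refine ⟨r, hr, fun n hn => not_lt.1 fun h => ?_⟩
  obtain ⟨Φ', W', hW', hf', m, hm1, -, hm⟩ := push_lemma hW hfix hfree (mem_ball_self hr) hn h
  exact no_periodic hW' hf' hm1 hm

/-- Montel: ultralimits of bounded holomorphic functions. -/
theorem ultra_limit {S : Set ℂ} (hS : IsOpen S) (F : Ultrafilter ℕ) (f : ℕ → ℂ → ℂ)
    (hd : ∀ n, DifferentiableOn ℂ (f n) S) (hm : ∀ n, ∀ x ∈ S, ‖f n x‖ ≤ 1) :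
    ∃ g : ℂ → ℂ, DifferentiableOn ℂ g S ∧ (∀ x ∈ S, ‖g x‖ ≤ 1) ∧
      TendstoLocallyUniformlyOn f g (F : Filter ℕ) S := by
  have hlim : ∀ x : ℂ, ∃ l : ℂ, x ∈ S → ‖l‖ ≤ 1 ∧ Tendsto (fun n => f n x) (F : Filter ℕ) (𝓝 l) := by
    intro x
    by_cases hx : x ∈ S
    · have hc : IsCompact (closedBall (0:ℂ) 1) := isCompact_closedBall _ _
      obtain ⟨l, hl, hl2⟩ := hc.ultrafilter_le_nhds (F.map (fun n => f n x)) (by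
        simp only [le_principal_iff]
        apply Filter.mem_map.2
        exact Filter.Eventually.of_forall (fun n => by simpa using hm n x hx))
      exact ⟨l, fun _ => ⟨by simpa using hl, hl2⟩⟩
    · exact ⟨0, fun h => absurd h hx⟩
  choose g hg using hlim
  have hloc : TendstoLocallyUniformlyOn f g (F : Filter ℕ) S := by
    rw [Metric.tendstoLocallyUniformlyOn_iff]
    intro ε hε x hx
    obtain ⟨ρ, hρ, hball⟩ := Metric.isOpen_iff.1 hS x hx
    have hlip : ∀ n, ∀ y ∈ ball x ρ, dist (f n y) (f n x) ≤ 2 / ρ * dist y x := by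
      intro n y hy
      refine Complex.dist_le_div_mul_dist_of_mapsTo_ball ((hd n).mono hball) ?_ hy
      intro z hz
      rw [mem_closedBall, dist_eq_norm]
      have h1 := hm n z (hball hz)
      have h2 := hm n x hx
      linarith [norm_sub_le (f n z) (f n x)]
    have hlipg : ∀ y ∈ ball x ρ, dist (g y) (g x) ≤ 2 / ρ * dist y x := by
      intro y hy
      have t1 := ((hg y (hball hy)).2).dist ((hg x hx).2)
      exact le_of_tendsto t1 (Eventually.of_forall (fun n => hlip n y hy))
    set η := min ρ (ε * ρ / 6) with hη
    have hηpos : 0 < η := lt_min hρ (by positivity)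
    refine ⟨ball x η, mem_nhdsWithin_of_mem_nhds (ball_mem_nhds _ hηpos), ?_⟩
    have hev : ∀ᶠ n in (F : Filter ℕ), dist (f n x) (g x) < ε / 3 :=
      (Metric.tendsto_nhds.1 (hg x hx).2) _ (by positivity)
    filter_upwards [hev] with n hn y hy
    have hy1 : dist y x < ρ := lt_of_lt_of_le (mem_ball.1 hy) (min_le_left _ _)
    have hy2 : dist y x < ε * ρ / 6 := lt_of_lt_of_le (mem_ball.1 hy) (min_le_right _ _)
    have hb : 2 / ρ * dist y x < ε / 3 := by
      calc 2 / ρ * dist y x < 2 / ρ * (ε * ρ / 6) := by gcongr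
        _ = ε / 3 := by field_simp; norm_num
    have h1 := hlip n y hy1
    have h2 := hlipg y hy1
    have t1 := dist_triangle4 (g y) (g x) (f n x) (f n y)
    rw [dist_comm (g x), dist_comm (f n x) (f n y)] at t1
    linarith
  refine ⟨g, hloc.differentiableOn (Eventually.of_forall hd) hS, fun x hx => (hg x hx).1, hloc⟩

/-- Holomorphic square root on a ball. -/
theorem exists_hol_sqrt {c : ℂ} {r : ℝ} {g : ℂ → ℂ} (hg : DifferentiableOn ℂ g (ball c r))
    (h0 : ∀ y ∈ ball c r, g y ≠ 0) :
    ∃ ρ : ℂ → ℂ, DifferentiableOn ℂ ρ (ball c r) ∧ ∀ y ∈ ball c r, ρ y ^ 2 = g y := by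
  obtain ⟨L, hLc, hL⟩ := exists_clog_on (convex_ball c r) isOpen_ball hg.continuousOn h0
  have hLd : ∀ y ∈ ball c r, DifferentiableAt ℂ L y := by
    intro y hy
    have hn : ball c r ∈ 𝓝 y := isOpen_ball.mem_nhds hy
    have hgd : HasDerivAt g (deriv g y) y := (hg.differentiableAt hn).hasDerivAt
    -- L = L y + log (g / g y) near y
    have hLy : ContinuousAt L y := hLc.continuousAt hn
    have hev : ∀ᶠ z in 𝓝 y, L z = L y + Complex.log (g z / g y) := by
      have h1 : ∀ᶠ z in 𝓝 y, dist (L z) (L y) < 1 := Metric.tendsto_nhds.1 hLy 1 one_pos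
      filter_upwards [h1, hn] with z hz hzb
      have : g z / g y = Complex.exp (L z - L y) := by
        rw [Complex.exp_sub, hL z hzb, hL y hy]
      rw [this, Complex.log_exp]
      · ring
      · have := Complex.abs_im_le_norm (L z - L y)
        rw [← dist_eq_norm] at this
        have h3 := (abs_le.1 this).1
        linarith [Real.pi_gt_three]
      · have := Complex.abs_im_le_norm (L z - L y)
        rw [← dist_eq_norm] at this
        have h3 := (abs_le.1 this).2
        linarith [Real.pi_gt_three]
    refine DifferentiableAt.congr_of_eventuallyEq ?_ hev
    refine (DifferentiableAt.clog (hgd.differentiableAt.div_const _) ?_).const_add _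
    rw [div_self (h0 y hy)]; simp
  refine ⟨fun y => Complex.exp (L y / 2), fun y hy => ?_, fun y hy => ?_⟩
  · exact ((hLd y hy).div_const 2).cexp.differentiableWithinAt
  · rw [← Complex.exp_nat_mul, ← hL y hy]; congr 1; push_cast; ring

set_option linter.unusedVariables false

/-- The Moebius involution exchanging `0` and `a`. -/
noncomputable def mob (a z : ℂ) : ℂ := (a - z) / (1 - (starRingEnd ℂ) a * z)

theorem mob_den {a z : ℂ} (ha : ‖a‖ < 1) (hz : ‖z‖ < 1) : 1 - (starRingEnd ℂ) a * z ≠ 0 := by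
  intro h
  have : ‖(starRingEnd ℂ) a * z‖ = 1 := by rw [← sub_eq_zero.1 h]; simp
  rw [norm_mul, Complex.norm_conj] at this
  nlinarith [norm_nonneg a, norm_nonneg z]

theorem mob_id (a z : ℂ) : ‖1 - (starRingEnd ℂ) a * z‖ ^ 2 - ‖a - z‖ ^ 2
    = (1 - ‖a‖ ^ 2) * (1 - ‖z‖ ^ 2) := by
  simp only [Complex.sq_norm, Complex.normSq_apply]
  simp
  ring

theorem mob_norm {a z : ℂ} (ha : ‖a‖ < 1) (hz : ‖z‖ < 1) : ‖mob a z‖ < 1 := by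
  have hd := mob_den ha hz
  rw [mob, norm_div, div_lt_one (norm_pos_iff.2 hd)]
  have := mob_id a z
  have h1 : 0 < (1 - ‖a‖ ^ 2) * (1 - ‖z‖ ^ 2) := by
    apply mul_pos <;> nlinarith [norm_nonneg a, norm_nonneg z]
  exact lt_of_pow_lt_pow_left₀ 2 (norm_nonneg _) (by linarith)

theorem mob_mob {a z : ℂ} (ha : ‖a‖ < 1) (hz : ‖z‖ < 1) : mob a (mob a z) = z := by
  have hd := mob_den ha hz
  have hd2 := mob_den ha (mob_norm ha hz)
  have hs := mob_den ha ha
  unfold mob at hd2 ⊢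
  have e2 : 1 - (starRingEnd ℂ) a * ((a - z) / (1 - (starRingEnd ℂ) a * z))
      = (1 - (starRingEnd ℂ) a * a) / (1 - (starRingEnd ℂ) a * z) := by
    field_simp; ring
  have e3 : a - (a - z) / (1 - (starRingEnd ℂ) a * z)
      = z * (1 - (starRingEnd ℂ) a * a) / (1 - (starRingEnd ℂ) a * z) := by
    rw [eq_div_iff hd, sub_mul, div_mul_cancel₀ _ hd]; ring
  rw [e2, e3, div_div_div_cancel_right₀ hd, mul_div_cancel_right₀ _ hs]

@[simp] theorem mob_zero (a : ℂ) : mob a 0 = a := by simp [mob]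
@[simp] theorem mob_self (a : ℂ) : mob a a = 0 := by simp [mob]

theorem mob_hasDerivAt {a z : ℂ} (ha : ‖a‖ < 1) (hz : ‖z‖ < 1) :
    HasDerivAt (mob a) (-(1 - (starRingEnd ℂ) a * a) / (1 - (starRingEnd ℂ) a * z) ^ 2) z := by
  have hd := mob_den ha hz
  have h1 : HasDerivAt (fun z => a - z) (-1) z := by simpa using (hasDerivAt_id z).const_sub a
  have h2 : HasDerivAt (fun z => 1 - (starRingEnd ℂ) a * z) (-(starRingEnd ℂ) a) z := by
    simpa using ((hasDerivAt_id z).const_mul ((starRingEnd ℂ) a)).const_sub 1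
  have := h1.div h2 hd
  have e : (-(1 - (starRingEnd ℂ) a * a) / (1 - (starRingEnd ℂ) a * z) ^ 2)
      = ((-1) * (1 - (starRingEnd ℂ) a * z) - (a - z) * (-(starRingEnd ℂ) a))
        / (1 - (starRingEnd ℂ) a * z) ^ 2 := by congr 1; ring
  rw [e]; exact this

theorem mob_diff {a : ℂ} (ha : ‖a‖ < 1) : DifferentiableOn ℂ (mob a) (ball 0 1) := fun z hz =>
  (mob_hasDerivAt ha (by simpa using hz)).differentiableAt.differentiableWithinAt

/-- Local section property over balls contained in `V`. -/
def SecProp (V : Set ℂ) (q : ℂ → ℂ) : Prop :=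
  ∀ c : ℂ, ∀ r : ℝ, ball c r ⊆ V → ∀ a ∈ ball (0:ℂ) 1, q a ∈ ball c r →
    ∃ σ : ℂ → ℂ, DifferentiableOn ℂ σ (ball c r) ∧ (∀ y ∈ ball c r, σ y ∈ ball (0:ℂ) 1) ∧
      (∀ y ∈ ball c r, q (σ y) = y) ∧ σ (q a) = a

structure QFam (V : Set ℂ) (q : ℂ → ℂ) : Prop where
  d : DifferentiableOn ℂ q (ball 0 1)
  m : ∀ z ∈ ball (0:ℂ) 1, q z ∈ ball (0:ℂ) 1
  z : q 0 = 0
  s : SecProp V q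

theorem QFam.id_mem {V : Set ℂ} (hV : V ⊆ ball 0 1) : QFam V id :=
  ⟨differentiableOn_id, fun _ h => h, rfl, fun c r hb a ha hq =>
    ⟨id, differentiableOn_id, fun y hy => hV (hb hy), fun y _ => rfl, rfl⟩⟩

theorem QFam.deriv_ne {V : Set ℂ} (hVo : IsOpen V) (h0 : (0:ℂ) ∈ V) {q : ℂ → ℂ} (h : QFam V q) :
    deriv q 0 ≠ 0 := by
  obtain ⟨r, hr, hb⟩ := Metric.isOpen_iff.1 hVo 0 h0
  obtain ⟨σ, hd, hm, hs, h1⟩ := h.s 0 r hb 0 (by simp) (by rw [h.z]; simpa using hr)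
  rw [h.z] at h1
  intro hq
  have d1 : HasDerivAt q 0 (σ 0) := by
    rw [h1]
    have := (h.d.differentiableAt (ball_mem_nhds _ one_pos)).hasDerivAt
    rwa [hq] at this
  have d2 : HasDerivAt σ (deriv σ 0) 0 := (hd.differentiableAt (ball_mem_nhds _ hr)).hasDerivAt
  have d3 := d1.comp 0 d2
  have d4 : HasDerivAt (q ∘ σ) 1 0 :=
    (hasDerivAt_id (0:ℂ)).congr_of_eventuallyEq
      (by filter_upwards [ball_mem_nhds (0:ℂ) hr] with y hy using hs y hy)
  have := d3.unique d4
  simp at this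

theorem max_mod_ball {S : Set ℂ} (hSo : IsOpen S) (hSc : IsPreconnected S) {g : ℂ → ℂ}
    (hd : DifferentiableOn ℂ g S) (hm : ∀ x ∈ S, ‖g x‖ ≤ 1) {a : ℂ} (ha : a ∈ S) (hga : ‖g a‖ < 1) :
    ∀ x ∈ S, ‖g x‖ < 1 := by
  intro x hx
  rcases lt_or_eq_of_le (hm x hx) with h | h
  · exact h
  · exfalso
    have := Complex.norm_eqOn_of_isPreconnected_of_isMaxOn hSc hSo hd hx
      (fun y hy => by simpa [h] using hm y hy)
    have h2 := this ha
    simp only [Function.comp_apply, Function.const_apply] at h2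
    linarith

theorem QFam.limit {V : Set ℂ} (F : Ultrafilter ℕ) (q : ℕ → ℂ → ℂ)
    (hq : ∀ n, QFam V (q n)) : ∃ g, QFam V g ∧
      Tendsto (fun n => ‖deriv (q n) 0‖) (F : Filter ℕ) (𝓝 ‖deriv g 0‖) := by
  obtain ⟨g, hgd, hgm, hgl⟩ := ultra_limit isOpen_ball F q (fun n => (hq n).d)
    (fun n x hx => by have := (hq n).m x hx; simp at this; exact this.le)
  have h00 : (0:ℂ) ∈ ball (0:ℂ) 1 := by simp
  have hg0 : g 0 = 0 := by
    have h1 := hgl.tendsto_at h00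
    have h2 : Tendsto (fun n => q n 0) (F : Filter ℕ) (𝓝 0) := by
      simp only [(hq _).z]; exact tendsto_const_nhds
    exact tendsto_nhds_unique h1 h2
  have hgm' := max_mod_ball isOpen_ball (convex_ball (0:ℂ) 1).isPreconnected hgd hgm h00
    (by rw [hg0]; simp)
  refine ⟨g, ⟨hgd, fun z hz => by simpa using hgm' z hz, hg0, ?_⟩, ?_⟩
  · intro c r hb a ha hga
    have hta := hgl.tendsto_at ha
    have hev : ∀ᶠ n in (F : Filter ℕ), q n a ∈ ball c r := hta (isOpen_ball.mem_nhds hga)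
    have : ∀ n, ∃ σ : ℂ → ℂ, DifferentiableOn ℂ σ (ball c r) ∧
        (∀ y ∈ ball c r, σ y ∈ ball (0:ℂ) 1) ∧
        (q n a ∈ ball c r → (∀ y ∈ ball c r, q n (σ y) = y) ∧ σ (q n a) = a) := by
      intro n
      by_cases h : q n a ∈ ball c r
      · obtain ⟨σ, h1, h2, h3, h4⟩ := (hq n).s c r hb a ha h
        exact ⟨σ, h1, h2, fun _ => ⟨h3, h4⟩⟩
      · exact ⟨fun _ => 0, differentiableOn_const _, fun y _ => by simp, fun h' => absurd h' h⟩
    choose σ hσd hσm hσ using this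
    obtain ⟨s, hsd, hsm, hsl⟩ := ultra_limit isOpen_ball F σ hσd
      (fun n x hx => by have := hσm n x hx; simp at this; exact this.le)
    have hsa : s (g a) = a := by
      have h1 : Tendsto (fun n => σ n (q n a)) (F : Filter ℕ) (𝓝 (s (g a))) := by
        refine tendsto_comp_of_locally_uniform_limit_within
          (hsd.continuousOn.continuousWithinAt hga) (tendsto_nhdsWithin_iff.2 ⟨hta, hev⟩) ?_
        intro u hu
        exact hsl u hu _ hga
      have h2 : Tendsto (fun n => σ n (q n a)) (F : Filter ℕ) (𝓝 a) := by
        refine Tendsto.congr' ?_ tendsto_const_nhds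
        filter_upwards [hev] with n hn using ((hσ n hn).2).symm
      exact tendsto_nhds_unique h1 h2
    have hsm' := max_mod_ball isOpen_ball (convex_ball c r).isPreconnected hsd hsm hga
      (by rw [hsa]; simpa using ha)
    refine ⟨s, hsd, fun y hy => by simpa using hsm' y hy, fun y hy => ?_, hsa⟩
    have hsy : s y ∈ ball (0:ℂ) 1 := by simpa using hsm' y hy
    have hty := hsl.tendsto_at hy
    have h1 : Tendsto (fun n => q n (σ n y)) (F : Filter ℕ) (𝓝 (g (s y))) := by
      refine tendsto_comp_of_locally_uniform_limit_within
        (hgd.continuousOn.continuousWithinAt hsy)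
        (tendsto_nhdsWithin_iff.2 ⟨hty, Eventually.of_forall (fun n => hσm n y hy)⟩) ?_
      intro u hu
      exact hgl u hu _ hsy
    have h2 : Tendsto (fun n => q n (σ n y)) (F : Filter ℕ) (𝓝 y) := by
      refine Tendsto.congr' ?_ tendsto_const_nhds
      filter_upwards [hev] with n hn using ((hσ n hn).1 y hy).symm
    exact tendsto_nhds_unique h1 h2
  · exact ((hgl.deriv (Eventually.of_forall (fun n => (hq n).d)) isOpen_ball).tendsto_at h00).norm

theorem QFam.improve {V : Set ℂ} {q : ℂ → ℂ} (h : QFam V q) (hd0 : deriv q 0 ≠ 0)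
    (h0 : (0:ℂ) ∈ V) {a : ℂ} (ha : a ∈ ball (0:ℂ) 1) (haV : q a ∉ V) :
    ∃ q', QFam V q' ∧ ‖deriv q' 0‖ < ‖deriv q 0‖ := by
  have ha1 : ‖a‖ < 1 := by simpa using ha
  have ha0 : a ≠ 0 := by rintro rfl; rw [h.z] at haV; exact haV h0
  obtain ⟨s, hs⟩ : ∃ s : ℂ, s ^ 2 = a := IsAlgClosed.exists_pow_nat_eq a (by norm_num)
  have hsn : ‖s‖ ^ 2 = ‖a‖ := by rw [← norm_pow, hs]
  have hs0 : s ≠ 0 := by rintro rfl; simp at hs; exact ha0 hs.symm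
  have hs1 : ‖s‖ < 1 := by nlinarith [norm_nonneg s]
  have sq1 : ∀ z : ℂ, ‖z‖ < 1 → ‖z ^ 2‖ < 1 := fun z hz => by
    rw [norm_pow]; nlinarith [norm_nonneg z]
  set H : ℂ → ℂ := fun z => mob a ((mob s z) ^ 2) with hH
  have hHm : ∀ z, ‖z‖ < 1 → ‖H z‖ < 1 := fun z hz => mob_norm ha1 (sq1 _ (mob_norm hs1 hz))
  have hHd : DifferentiableOn ℂ H (ball 0 1) := by
    refine (mob_diff ha1).comp ((mob_diff hs1).pow 2) ?_
    intro z hz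
    simpa using sq1 _ (mob_norm hs1 (by simpa using hz))
  have hH0 : H 0 = 0 := by simp [hH, hs]
  refine ⟨q ∘ H, ⟨h.d.comp hHd (fun z hz => by simpa using hHm z (by simpa using hz)),
    fun z hz => h.m _ (by simpa using hHm z (by simpa using hz)), by simp [hH0, h.z], ?_⟩, ?_⟩
  · intro c r hb u hu hqu
    have hu1 : ‖u‖ < 1 := by simpa using hu
    obtain ⟨σ, h1, h2, h3, h4⟩ := h.s c r hb (H u) (by simpa using hHm u hu1) hqu
    have hne : ∀ y ∈ ball c r, mob a (σ y) ≠ 0 := by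
      intro y hy h0
      have : σ y = a := by
        have e := mob_mob ha1 (z := σ y) (by simpa using h2 y hy)
        rw [h0, mob_zero] at e; exact e.symm
      have e2 := h3 y hy
      rw [this] at e2
      exact haV (e2 ▸ hb hy)
    obtain ⟨ρ, hρd, hρ⟩ := exists_hol_sqrt (g := fun y => mob a (σ y))
      ((mob_diff ha1).comp h1 h2) hne
    have hρ1 : ∀ y ∈ ball c r, ‖ρ y‖ < 1 := by
      intro y hy
      have := mob_norm ha1 (z := σ y) (by simpa using h2 y hy)
      rw [← hρ y hy, norm_pow] at this
      nlinarith [norm_nonneg (ρ y)]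
    -- sign choice
    obtain ⟨ε, hε, hεu⟩ : ∃ ε : ℂ, ε ^ 2 = 1 ∧ ε * ρ (q (H u)) = mob s u := by
      have e1 : ρ (q (H u)) ^ 2 = mob s u ^ 2 := by
        rw [hρ (q (H u)) hqu, h4]
        exact mob_mob ha1 (sq1 _ (mob_norm hs1 hu1))
      rcases sq_eq_sq_iff_eq_or_eq_neg.1 e1 with e | e
      · exact ⟨1, by norm_num, by rw [e]; ring⟩
      · exact ⟨-1, by norm_num, by rw [e]; ring⟩
    have hεn : ‖ε‖ = 1 := by
      have : ‖ε‖ ^ 2 = 1 := by rw [← norm_pow, hε]; simp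
      nlinarith [norm_nonneg ε]
    have hn : ∀ y ∈ ball c r, ‖ε * ρ y‖ < 1 := fun y hy => by
      rw [norm_mul, hεn, one_mul]; exact hρ1 y hy
    refine ⟨fun y => mob s (ε * ρ y), ?_, ?_, ?_, ?_⟩
    · exact (mob_diff hs1).comp (hρd.const_mul ε) (fun y hy => by simpa using hn y hy)
    · intro y hy; simpa using mob_norm hs1 (hn y hy)
    · intro y hy
      have : H (mob s (ε * ρ y)) = σ y := by
        simp only [hH]
        rw [mob_mob hs1 (hn y hy), mul_pow, hε, one_mul, hρ y hy]
        exact mob_mob ha1 (by simpa using h2 y hy)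
      simp only [Function.comp_apply, this]
      exact h3 y hy
    · simp only [Function.comp_apply]
      rw [hεu, mob_mob hs1 hu1]
  · have d1 := mob_hasDerivAt hs1 (z := 0) (by simp)
    have d2 := (d1.fun_pow 2)
    have d3 : HasDerivAt (mob a) _ ((fun z => mob s z ^ 2) 0) := mob_hasDerivAt ha1 (by simpa [hs] using ha1)
    have d4 := d3.comp 0 d2
    have d5 : HasDerivAt q (deriv q 0) (((mob a) ∘ fun z => mob s z ^ 2) 0) := by
      have : ((mob a) ∘ fun z => mob s z ^ 2) 0 = 0 := hH0
      rw [this]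
      exact (h.d.differentiableAt (ball_mem_nhds _ one_pos)).hasDerivAt
    have d6 := d5.comp 0 d4
    have e : deriv (q ∘ H) 0 = _ := d6.deriv
    rw [e, norm_mul]
    have hlt : ‖(-(1 - (starRingEnd ℂ) a * a) / (1 - (starRingEnd ℂ) a * (fun z => mob s z ^ 2) 0) ^ 2 *
        ((2:ℕ) * mob s 0 ^ (2-1) * (-(1 - (starRingEnd ℂ) s * s) / (1 - (starRingEnd ℂ) s * 0) ^ 2)))‖ < 1 := by
      simp only [mob_zero, hs, mul_zero, sub_zero]
      have c1 : (starRingEnd ℂ) a * a = ((‖s‖ ^ 4 : ℝ) : ℂ) := by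
        rw [mul_comm, Complex.mul_conj, Complex.normSq_eq_norm_sq, ← hsn]; push_cast; ring
      have c2 : (starRingEnd ℂ) s * s = ((‖s‖ ^ 2 : ℝ) : ℂ) := by
        rw [mul_comm, Complex.mul_conj, Complex.normSq_eq_norm_sq]
      rw [c1, c2]
      set t := ‖s‖ with ht
      have ht0 : 0 < t := norm_pos_iff.2 hs0
      have e1 : -(1 - ((t ^ 4 : ℝ) : ℂ)) / (1 - ((t ^ 4 : ℝ) : ℂ)) ^ 2 *
          (((2:ℕ):ℂ) * s ^ (2-1) * (-(1 - ((t ^ 2 : ℝ) : ℂ)) / 1 ^ 2)) = s * ((2 / (1 + t ^ 2) : ℝ) : ℂ) := by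
        have h2 : (1 - (t:ℂ)^2) ≠ 0 := by
          have : (1 - t^2 : ℝ) ≠ 0 := by nlinarith
          exact_mod_cast this
        have h3 : (1 + (t:ℂ)^2) ≠ 0 := by
          have : (1 + t^2 : ℝ) ≠ 0 := by positivity
          exact_mod_cast this
        have h4 : (1 - (t:ℂ)^4) = (1 - (t:ℂ)^2) * (1 + (t:ℂ)^2) := by ring
        push_cast
        rw [h4]
        field_simp
      rw [e1, norm_mul, Complex.norm_real, ← ht, Real.norm_eq_abs, abs_of_pos (by positivity), mul_div_assoc',
        div_lt_one (by positivity)]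
      nlinarith [sq_nonneg (t - 1), mul_pos (sub_pos.2 hs1) (sub_pos.2 hs1)]
    calc _ < ‖deriv q 0‖ * 1 := by
          apply mul_lt_mul_of_pos_left _ (norm_pos_iff.2 hd0)
          exact hlt
      _ = _ := mul_one _

/-- Uniformization of open subsets of the disc. -/
theorem unif_disc {V : Set ℂ} (hVo : IsOpen V) (hV : V ⊆ ball 0 1) (h0 : (0:ℂ) ∈ V) :
    ∃ q : ℂ → ℂ, DifferentiableOn ℂ q (ball 0 1) ∧ (∀ z ∈ ball (0:ℂ) 1, q z ∈ V) ∧ q 0 = 0 ∧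
      SecProp V q := by
  set S : Set ℝ := {t | ∃ q, QFam V q ∧ t = ‖deriv q 0‖} with hS
  have hne : S.Nonempty := ⟨_, id, QFam.id_mem hV, rfl⟩
  have hbd : BddBelow S := ⟨0, by rintro _ ⟨q, _, rfl⟩; exact norm_nonneg _⟩
  obtain ⟨u, _, hut, hu⟩ := exists_seq_tendsto_sInf hne hbd
  choose q hq hqu using hu
  obtain ⟨g, hg, hgt⟩ := QFam.limit (hyperfilter ℕ) q hq
  have h1 : Tendsto u (hyperfilter ℕ : Filter ℕ) (𝓝 (sInf S)) := hut.mono_left (by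
    have := hyperfilter_le_cofinite (α := ℕ); rwa [Nat.cofinite_eq_atTop] at this)
  have h2 : ‖deriv g 0‖ = sInf S := by
    refine tendsto_nhds_unique hgt ?_
    simpa only [← hqu] using h1
  refine ⟨g, hg.d, fun z hz => ?_, hg.z, hg.s⟩
  by_contra hz2
  obtain ⟨q', hq', hlt⟩ := hg.improve (hg.deriv_ne hVo h0) h0 hz hz2
  rw [h2] at hlt
  exact absurd (csInf_le hbd ⟨q', hq', rfl⟩) (not_le.2 hlt)

theorem unif {V : Set ℂ} (hVo : IsOpen V) (hVb : Bornology.IsBounded V) {x : ℂ} (hx : x ∈ V) :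
    ∃ q : ℂ → ℂ, DifferentiableOn ℂ q (ball 0 1) ∧ (∀ z ∈ ball (0:ℂ) 1, q z ∈ V) ∧ q 0 = x ∧
      SecProp V q := by
  obtain ⟨R, hR, hVR⟩ := hVb.subset_ball_lt 0 x
  have hRc : (R:ℂ) ≠ 0 := by exact_mod_cast hR.ne'
  set A : ℂ → ℂ := fun z => x + R * z with hA
  have hAc : Continuous A := by fun_prop
  obtain ⟨q, h1, h2, h3, h4⟩ := unif_disc (V := A ⁻¹' V) (hVo.preimage hAc) (by
    intro z hz
    have := hVR hz
    simp only [hA, mem_ball, dist_eq_norm, add_sub_cancel_left, norm_mul, Complex.norm_real,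
      Real.norm_eq_abs, abs_of_pos hR] at this
    simp only [mem_ball, dist_zero_right]
    nlinarith) (by simpa [hA] using hx)
  refine ⟨fun z => A (q z), ?_, fun z hz => h2 z hz, by simp [hA, h3], ?_⟩
  · exact (h1.const_mul _).const_add _
  · intro c r hb a ha hqa
    have key : ∀ z, z ∈ ball ((c - x) / R) (r / R) ↔ A z ∈ ball c r := by
      intro z
      simp only [mem_ball, dist_eq_norm, hA]
      have : x + R * z - c = R * (z - (c - x) / R) := by field_simp; ring
      rw [this, norm_mul, Complex.norm_real, Real.norm_eq_abs, abs_of_pos hR, lt_div_iff₀ hR, mul_comm]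
    have hAi : ∀ y, A ((y - x) / R) = y := fun y => by simp only [hA]; field_simp; ring
    obtain ⟨σ, s1, s2, s3, s4⟩ := h4 ((c - x) / R) (r / R) (fun z hz => hb ((key z).1 hz)) a ha
      ((key _).2 hqa)
    refine ⟨fun y => σ ((y - x) / R), ?_, ?_, ?_, ?_⟩
    · refine s1.comp ?_ (fun y hy => (key _).2 (by rw [hAi]; exact hy))
      exact (differentiableOn_id.sub_const x).div_const _
    · intro y hy; exact s2 _ ((key _).2 (by rw [hAi]; exact hy))
    · intro y hy
      simp only
      rw [s3 _ ((key _).2 (by rw [hAi]; exact hy)), hAi]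
    · have : (A (q a) - x) / R = q a := by simp only [hA]; field_simp; ring
      simp only [this, s4]

/-- The open unit disc as a type. -/
abbrev BB : Type := ↥(ball (0:ℂ) 1)

noncomputable def bo : BB := ⟨0, by simp⟩

theorem BB.norm_lt (u : BB) : ‖(u:ℂ)‖ < 1 := mem_ball_zero_iff.1 u.2

theorem bb_conv : Convex ℝ (ball (0:ℂ) 1) := convex_ball _ _

instance : ContractibleSpace BB := bb_conv.contractibleSpace ⟨0, by simp⟩
instance : LocallyPathConnectedSpace BB := isOpen_ball.locallyPathConnectedSpace

/-- A holomorphic covering of (a union of components of) `V` by the disc. -/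
structure Cov (V : Set ℂ) (q : ℂ → ℂ) : Prop where
  o : IsOpen V
  d : DifferentiableOn ℂ q (ball 0 1)
  m : ∀ u : BB, q u ∈ V
  s : SecProp V q

namespace Cov
variable {V : Set ℂ} {q : ℂ → ℂ}

theorem cont (h : Cov V q) : Continuous (fun u : BB => q u) :=
  continuousOn_iff_continuous_domRestrict.1 h.d.continuousOn

theorem sec_open {c : ℂ} {r : ℝ} {σ : ℂ → ℂ} (hd : DifferentiableOn ℂ σ (ball c r))
    (hs : ∀ y ∈ ball c r, q (σ y) = y) : IsOpen (σ '' ball c r) := by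
  rcases le_or_gt r 0 with hr | hr
  · rw [ball_eq_empty.2 hr]; simp
  have ha : AnalyticOnNhd ℂ σ (ball c r) := hd.analyticOnNhd isOpen_ball
  rcases ha.is_constant_or_isOpen (convex_ball c r).isPreconnected with ⟨w, hw⟩ | h
  · exfalso
    have h1 := hs c (mem_ball_self hr)
    have hy : c + (r/2 : ℝ) ∈ ball c r := by
      simp [dist_eq_norm, abs_of_pos hr]; linarith
    have h2 := hs _ hy
    rw [hw _ hy] at h2
    rw [hw _ (mem_ball_self hr), h2] at h1
    have : ((r/2 : ℝ):ℂ) = 0 := by simpa using h1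
    have : r / 2 = 0 := by exact_mod_cast this
    linarith
  · exact h _ subset_rfl isOpen_ball

theorem sec_unique {c : ℂ} {r : ℝ} {σ τ : ℂ → ℂ} (hd : DifferentiableOn ℂ σ (ball c r))
    (hs : ∀ y ∈ ball c r, q (σ y) = y) (hd' : DifferentiableOn ℂ τ (ball c r))
    (hs' : ∀ y ∈ ball c r, q (τ y) = y) {y₀ : ℂ} (hy : y₀ ∈ ball c r) (he : σ y₀ = τ y₀) :
    Set.EqOn σ τ (ball c r) := by
  refine (hd.analyticOnNhd isOpen_ball).eqOn_of_preconnected_of_eventuallyEq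
    (hd'.analyticOnNhd isOpen_ball) (convex_ball c r).isPreconnected hy ?_
  have hn := isOpen_ball.mem_nhds hy
  have hc : ContinuousAt τ y₀ := (hd'.continuousOn).continuousAt hn
  have h1 : σ '' ball c r ∈ 𝓝 (τ y₀) := by
    rw [← he]; exact (sec_open hd hs).mem_nhds ⟨y₀, hy, rfl⟩
  filter_upwards [hc h1, hn] with y hy1 hy2
  obtain ⟨y', hy', e⟩ := hy1
  have := hs' y hy2
  rw [← e, hs y' hy'] at this
  rw [← this, e, this]

theorem locInj (h : Cov V q) (u : BB) : ∃ U : Set BB, IsOpen U ∧ u ∈ U ∧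
    Set.InjOn (fun v : BB => q v) U := by
  obtain ⟨r, hr, hb⟩ := Metric.isOpen_iff.1 h.o _ (h.m u)
  obtain ⟨σ, hd, hm, hs, h1⟩ := h.s _ r hb u u.2 (mem_ball_self hr)
  refine ⟨Subtype.val ⁻¹' (σ '' ball (q u) r), (sec_open hd hs).preimage continuous_subtype_val,
    ⟨q u, mem_ball_self hr, h1⟩, ?_⟩
  rintro v ⟨y, hy, ev⟩ w ⟨y', hy', ew⟩ e
  simp only at e
  apply Subtype.ext
  rw [← ev, ← ew, hs y hy, hs y' hy'] at e
  rw [← ev, ← ew, e]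

theorem isLocInj (h : Cov V q) : IsLocallyInjective (fun u : BB => q u) := fun u =>
  let ⟨U, h1, h2, h3⟩ := h.locInj u
  ⟨U, h1, h2, h3⟩

theorem uniq (h : Cov V q) {A : Type*} [TopologicalSpace A] [PreconnectedSpace A] {G G' : A → BB}
    (hG : Continuous G) (hG' : Continuous G') (he : ∀ a, q (G a) = q (G' a)) {a : A}
    (ha : G a = G' a) : G = G' :=
  T2Space.isSeparatedMap (fun u : BB => q u) |>.eq_of_comp_eq h.isLocInj hG hG' (funext he) a ha

theorem covering (h : Cov V q) : IsCoveringMapOn (fun u : BB => q u) V := by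
  intro x hx
  obtain ⟨r, hr, hb⟩ := Metric.isOpen_iff.1 h.o _ hx
  set f : BB → ℂ := fun u => q u with hf
  by_cases hne : Nonempty (f ⁻¹' {x})
  swap
  · have he : IsEmpty (f ⁻¹' {x}) := not_nonempty_iff.1 hne
    refine IsEvenlyCovered.of_preimage_eq_empty _ (ball_mem_nhds x hr) ?_
    by_contra hcon
    obtain ⟨u, hu⟩ := Set.nonempty_iff_ne_empty.2 hcon
    obtain ⟨σ, hd, hm, hs, h1⟩ := h.s _ r hb u u.2 hu
    exact he.false ⟨⟨σ x, hm x (mem_ball_self hr)⟩, hs x (mem_ball_self hr)⟩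
  have hsec : ∀ i : f ⁻¹' {x}, ∃ σ : ℂ → ℂ, DifferentiableOn ℂ σ (ball x r) ∧
      (∀ y ∈ ball x r, σ y ∈ ball (0:ℂ) 1) ∧ (∀ y ∈ ball x r, q (σ y) = y) ∧ σ x = i.1 := by
    intro i
    have hi : q i.1 = x := i.2
    obtain ⟨σ, hd, hm, hs, h1⟩ := h.s _ r hb i.1 i.1.2 (by rw [hi]; exact mem_ball_self hr)
    exact ⟨σ, hd, hm, hs, by rw [hi] at h1; exact h1⟩
  choose σ hd hm hs hx0 using hsec
  set U : f ⁻¹' {x} → Set BB := fun i => Subtype.val ⁻¹' (σ i '' ball x r) with hU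
  have hUo : ∀ i, IsOpen (U i) := fun i => (sec_open (hd i) (hs i)).preimage continuous_subtype_val
  have hxi : ∀ i, i.1 ∈ U i := fun i => ⟨x, mem_ball_self hr, hx0 i⟩
  have hUs : ∀ i u, u ∈ U i → σ i (q u) = u ∧ q u ∈ ball x r := by
    rintro i u ⟨y, hy, e⟩
    rw [← e, hs i y hy]; exact ⟨rfl, hy⟩
  have hdisc : DiscreteTopology (f ⁻¹' {x}) := by
    rw [discreteTopology_iff_isOpen_singleton]
    intro i
    have : {i} = Subtype.val ⁻¹' (U i) := by
      ext j
      simp only [Set.mem_singleton_iff, Set.mem_preimage]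
      constructor
      · rintro rfl; exact hxi _
      · intro hj
        have h1 := (hUs i _ hj).1
        have hj2 : q j.1 = x := j.2
        rw [hj2, hx0] at h1
        exact (Subtype.ext (Subtype.ext h1)).symm
    rw [this]
    exact (hUo i).preimage continuous_subtype_val
  have hnn : Nonempty (ℂ → BB) := ⟨fun _ => bo⟩
  refine IsEvenlyCovered.of_trivialization (t := IsOpen.trivializationDiscrete (f := f) U (ball x r)
    isOpen_ball ?_ ?_ ?_ ?_ ?_) ?_
  · intro i W hW
    constructor
    · intro ho; exact (ho.preimage h.cont).inter (hUo i)
    · intro ho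
      have hc := (hd i).continuousOn
      obtain ⟨O, hO, hOe⟩ := isOpen_induced_iff.1 ho
      have : W = ball x r ∩ (σ i) ⁻¹' O := by
        ext y
        constructor
        · intro hy
          refine ⟨hW hy, ?_⟩
          have : (⟨σ i y, hm i y (hW hy)⟩ : BB) ∈ f ⁻¹' W ∩ U i :=
            ⟨by change q (σ i y) ∈ W; rw [hs i y (hW hy)]; exact hy, ⟨y, hW hy, rfl⟩⟩
          rw [← hOe] at this
          exact this
        · rintro ⟨hy, hyO⟩
          have : (⟨σ i y, hm i y hy⟩ : BB) ∈ f ⁻¹' W ∩ U i := by rw [← hOe]; exact hyO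
          have h2 : q (σ i y) ∈ W := this.1
          rwa [hs i y hy] at h2
      rw [this]
      exact hc.isOpen_inter_preimage isOpen_ball hO
  · intro i u hu v hv e
    have h1 := (hUs i u hu).1
    have h2 := (hUs i v hv).1
    have e' : q u = q v := e
    rw [e', h2] at h1
    exact (Subtype.ext h1).symm
  · intro i y hy
    exact ⟨⟨σ i y, hm i y hy⟩, ⟨y, hy, rfl⟩, hs i y hy⟩
  · intro i j hij
    rw [Function.onFun, Set.disjoint_left]
    intro u hu hv
    apply hij
    have h1 := hUs i u hu
    have h2 := hUs j u hv
    have := sec_unique (hd i) (hs i) (hd j) (hs j) h1.2 (h1.1.trans h2.1.symm) (mem_ball_self hr)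
    rw [hx0, hx0] at this
    exact Subtype.ext (Subtype.ext this)
  · intro u hu
    obtain ⟨τ, hd', hm', hs', h1⟩ := h.s _ r hb u u.2 hu
    refine Set.mem_iUnion.2 ⟨⟨⟨τ x, hm' x (mem_ball_self hr)⟩, hs' x (mem_ball_self hr)⟩, ?_⟩
    set i : f ⁻¹' {x} := ⟨⟨τ x, hm' x (mem_ball_self hr)⟩, hs' x (mem_ball_self hr)⟩ with hi
    refine ⟨q u, hu, ?_⟩
    have := sec_unique (hd i) (hs i) hd' hs' (mem_ball_self hr) (hx0 i) hu
    rw [this, h1]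
  · exact mem_ball_self hr

theorem lift (h : Cov V q) {A : Type*} [TopologicalSpace A] [SimplyConnectedSpace A]
    [LocallyPathConnectedSpace A] {g : A → ℂ} (hg : Continuous g) (hgV : ∀ a, g a ∈ V) {a : A}
    {e : BB} (he : q e = g a) : ∃ G : A → BB, Continuous G ∧ G a = e ∧ ∀ b, q (G b) = g b := by
  obtain ⟨F, ⟨h1, h2⟩, -⟩ := h.covering.existsUnique_continuousMap_lifts ⟨g, hg⟩ (e₀ := e) (a₀ := a) he hgV
  exact ⟨F, F.continuous, h1, fun b => congrFun h2 b⟩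

theorem liftHomeo (h : Cov V q) (g : ℂ ≃ₜ ℂ) (hg : ∀ y, g y ∈ V ↔ y ∈ V) {a e : BB}
    (he : q e = g (q a)) : ∃ G : BB ≃ₜ BB, G a = e ∧ ∀ u, q (G u) = g (q u) := by
  obtain ⟨G, hGc, hGa, hG⟩ := h.lift (g := fun u : BB => g (q u)) (g.continuous.comp h.cont)
    (fun u => (hg _).2 (h.m u)) he
  obtain ⟨K, hKc, hKe, hK⟩ := h.lift (g := fun u : BB => g.symm (q u)) (a := e) (e := a)
    (g.symm.continuous.comp h.cont)
    (fun u => by rw [← hg, g.apply_symm_apply]; exact h.m u) (by rw [he]; simp)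
  have h1 : K ∘ G = id := h.uniq (hKc.comp hGc) continuous_id (fun u => by simp [hK, hG]) (a := a)
    (by simp [hGa, hKe])
  have h2 : G ∘ K = id := h.uniq (hGc.comp hKc) continuous_id (fun u => by simp [hK, hG]) (a := e)
    (by simp [hGa, hKe])
  exact ⟨⟨⟨G, K, congrFun h1, congrFun h2⟩, hGc, hKc⟩, hGa, hG⟩

/-- The deck group. -/
def deck (q : ℂ → ℂ) : Subgroup (BB ≃ₜ BB) where
  carrier := {ν | ∀ u, q (ν u) = q u}
  mul_mem' {a b} ha hb u := by
    change q (a (b u)) = q u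
    rw [ha, hb]
  one_mem' _ := rfl
  inv_mem' {a} ha u := by
    change q (a.symm u) = q u
    rw [← ha, a.apply_symm_apply]

theorem mem_deck {ν : BB ≃ₜ BB} : ν ∈ deck q ↔ ∀ u, q (ν u) = q u := Iff.rfl

theorem deck_trans (h : Cov V q) {a e : BB} (he : q a = q e) : ∃ ν ∈ deck q, ν a = e := by
  obtain ⟨G, h1, h2⟩ := h.liftHomeo (Homeomorph.refl ℂ) (fun y => Iff.rfl) (a := a) (e := e) he.symm
  exact ⟨G, h2, h1⟩

theorem homeo_ext (h : Cov V q) {G K : BB ≃ₜ BB} (he : ∀ u, q (G u) = q (K u)) {a : BB}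
    (ha : G a = K a) : G = K :=
  Homeomorph.ext (congrFun (h.uniq G.continuous K.continuous he ha))

theorem deck_free (h : Cov V q) {ν : BB ≃ₜ BB} (hν : ν ∈ deck q) {a : BB} (ha : ν a = a) : ν = 1 :=
  h.homeo_ext (fun u => hν u) ha

theorem deck_discrete (h : Cov V q) : ∃ r > 0, ∀ ν ∈ deck q, ‖((ν bo : BB) : ℂ)‖ < r → ν = 1 := by
  obtain ⟨U, hU, hu, hi⟩ := h.locInj bo
  obtain ⟨r, hr, hb⟩ := Metric.isOpen_iff.1 hU _ hu
  refine ⟨r, hr, fun ν hν hn => h.deck_free hν (a := bo) (hi (hb ?_) hu (hν _))⟩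
  rw [mem_ball, Subtype.dist_eq, dist_eq_norm]
  simpa [bo] using hn

theorem deck_hol (h : Cov V q) {ν : BB ≃ₜ BB} (hν : ν ∈ deck q) :
    ∃ N : ℂ → ℂ, DifferentiableOn ℂ N (ball 0 1) ∧ ∀ u : BB, N u = ν u := by
  classical
  refine ⟨fun z => if hz : z ∈ ball (0:ℂ) 1 then ((ν ⟨z, hz⟩ : BB) : ℂ) else 0, ?_, fun u => dif_pos u.2⟩
  intro z hz
  apply DifferentiableAt.differentiableWithinAt
  obtain ⟨r, hr, hb⟩ := Metric.isOpen_iff.1 h.o _ (h.m ⟨z, hz⟩)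
  have hq : q (ν ⟨z, hz⟩) = q z := hν _
  obtain ⟨σ, hd, hm, hs, h1⟩ := h.s _ r hb (ν ⟨z, hz⟩) (ν ⟨z, hz⟩).2 (by rw [hq]; exact mem_ball_self hr)
  have hqd : DifferentiableAt ℂ q z := h.d.differentiableAt (isOpen_ball.mem_nhds hz)
  have hsd : DifferentiableAt ℂ σ (q z) := hd.differentiableAt (ball_mem_nhds _ hr)
  refine (hsd.comp z hqd).congr_of_eventuallyEq ?_
  have ho := (sec_open hd hs)
  have h2 : ∀ᶠ u : BB in 𝓝 ⟨z, hz⟩, ((ν u : BB) : ℂ) ∈ σ '' ball (q z) r := by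
    have : ContinuousAt (fun u : BB => ((ν u : BB) : ℂ)) ⟨z, hz⟩ := by fun_prop
    exact this (ho.mem_nhds ⟨q z, mem_ball_self hr, by rw [hq] at h1; exact h1⟩)
  rw [nhds_subtype_eq_comap, eventually_comap] at h2
  filter_upwards [h2, isOpen_ball.mem_nhds hz] with w hw hwb
  rw [dif_pos hwb]
  obtain ⟨y, hy, e⟩ := hw ⟨w, hwb⟩ rfl
  have h3 : q (ν ⟨w, hwb⟩) = q w := hν _
  rw [← e, hs y hy] at h3
  rw [← e, h3]; rfl

end Cov

theorem exists_cov {V : Set ℂ} (hVo : IsOpen V) (hVb : Bornology.IsBounded V) {x : ℂ} (hx : x ∈ V) :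
    ∃ q : ℂ → ℂ, Cov V q ∧ q bo = x := by
  obtain ⟨q, h1, h2, h3, h4⟩ := unif hVo hVb hx
  exact ⟨q, ⟨hVo, h1, fun u => h2 u u.2, h4⟩, h3⟩

open ComplexConjugate in
/-- `ν` is given by the matrix `(α β; conj β conj α)` in `SU(1,1)`. -/
def MRep (ν : BB ≃ₜ BB) (α β : ℂ) : Prop :=
  Complex.normSq α - Complex.normSq β = 1 ∧ ∀ u : BB, (ν u : ℂ) * (conj β * u + conj α) = α * u + β

namespace MRep
open ComplexConjugate
variable {ν ν₁ ν₂ : BB ≃ₜ BB} {α β α₁ β₁ α₂ β₂ : ℂ}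

theorem den_ne (h : Complex.normSq α - Complex.normSq β = 1) {z : ℂ} (hz : ‖z‖ ≤ 1) :
    conj β * z + conj α ≠ 0 := by
  intro h0
  have h1 : ‖conj β * z‖ = ‖conj α‖ := by
    rw [eq_neg_of_add_eq_zero_left h0, norm_neg]
  rw [norm_mul, Complex.norm_conj, Complex.norm_conj] at h1
  rw [← Complex.sq_norm, ← Complex.sq_norm] at h
  have h2 : ‖α‖ ≤ ‖β‖ := by
    rw [← h1]; exact mul_le_of_le_one_right (norm_nonneg _) hz
  nlinarith [norm_nonneg α, norm_nonneg β]

theorem eq_of (h₁ : MRep ν₁ α β) (h₂ : MRep ν₂ α β) : ν₁ = ν₂ := by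
  ext u
  have h := den_ne h₁.1 (z := u) u.norm_lt.le
  exact mul_right_cancel₀ h ((h₁.2 u).trans (h₂.2 u).symm)

theorem mul (h₁ : MRep ν₁ α₁ β₁) (h₂ : MRep ν₂ α₂ β₂) :
    MRep (ν₁ * ν₂) (α₁ * α₂ + β₁ * conj β₂) (α₁ * β₂ + β₁ * conj α₂) := by
  constructor
  · have := h₁.1; have h2 := h₂.1
    simp only [Complex.normSq_apply] at *
    simp
    have : (α₁.re * α₁.re + α₁.im * α₁.im - (β₁.re * β₁.re + β₁.im * β₁.im)) *
      (α₂.re * α₂.re + α₂.im * α₂.im - (β₂.re * β₂.re + β₂.im * β₂.im)) = 1 := by rw [this, h2]; ring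
    linarith
  · intro u
    have e1 := h₁.2 (ν₂ u)
    have e2 := h₂.2 u
    change ((ν₁ (ν₂ u) : BB) : ℂ) * _ = _
    set x : ℂ := ((ν₁ (ν₂ u) : BB) : ℂ)
    set y : ℂ := ((ν₂ u : BB) : ℂ)
    simp only [map_add, map_mul, Complex.conj_conj]
    linear_combination (conj β₂ * (u:ℂ) + conj α₂) * e1 + (α₁ - x * conj β₁) * e2

theorem unique (h : MRep ν α₁ β₁) (h' : MRep ν α₂ β₂) :
    (α₂ = α₁ ∧ β₂ = β₁) ∨ (α₂ = -α₁ ∧ β₂ = -β₁) := by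
  have key : ∀ u : BB, (α₁ * u + β₁) * (conj β₂ * u + conj α₂) = (α₂ * u + β₂) * (conj β₁ * u + conj α₁) := by
    intro u
    linear_combination (-(conj β₂ * (u:ℂ) + conj α₂)) * h.2 u + (conj β₁ * (u:ℂ) + conj α₁) * h'.2 u
  have k0 := key bo
  have k1 := key ⟨1/2, by rw [mem_ball_zero_iff]; norm_num⟩
  have k2 := key ⟨-1/2, by rw [mem_ball_zero_iff]; norm_num⟩
  simp only [bo] at k0 k1 k2
  -- coefficients
  have c0 : β₁ * conj α₂ = β₂ * conj α₁ := by linear_combination k0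
  have c1 : α₁ * conj α₂ + β₁ * conj β₂ = α₂ * conj α₁ + β₂ * conj β₁ := by
    linear_combination k1 - k2
  have n1 : α₁ * conj α₁ - β₁ * conj β₁ = 1 := by
    rw [Complex.mul_conj, Complex.mul_conj, ← Complex.ofReal_sub, h.1]; simp
  have n2 : α₂ * conj α₂ - β₂ * conj β₂ = 1 := by
    rw [Complex.mul_conj, Complex.mul_conj, ← Complex.ofReal_sub, h'.1]; simp
  have c0' : conj β₁ * α₂ = conj β₂ * α₁ := by
    have := congrArg conj c0; simpa using this
  have e1 : α₁ ≠ 0 := by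
    intro h0; simpa [h0] using den_ne h.1 (z := 0) (by simp)
  have hc1 : conj α₁ ≠ 0 := by simpa using e1
  -- α₂ = α₁ * t with t := (α₂ conj α₁ - β₂ conj β₁)
  have t1 : α₂ = α₁ * (α₂ * conj α₁ - β₂ * conj β₁) + (β₂ * α₁ - α₂ * β₁) * conj β₁ := by
    linear_combination (-α₂) * n1
  obtain ⟨c, hc⟩ : ∃ c, α₂ = c * α₁ := ⟨α₂ / α₁, by field_simp⟩
  have hb : β₂ = conj c * β₁ := by
    apply mul_right_cancel₀ hc1
    rw [← c0, hc]; simp; ring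
  have hcc : conj c = c := by
    subst hb; subst hc
    simp only [map_mul, Complex.conj_conj] at c1
    linear_combination c1 - (conj c - c) * n1
  have hc2 : c * c = 1 := by
    subst hb; subst hc
    simp only [map_mul, hcc] at n2
    linear_combination n2 - c*c* n1
  rcases mul_self_eq_one_iff.1 hc2 with r | r
  · left; rw [hc, hb, r]; simp
  · right; rw [hc, hb, r]; simp

theorem commute (h₁ : MRep ν₁ α₁ β₁) (h₂ : MRep ν₂ α₂ β₂) (hc : ν₁ * ν₂ = ν₂ * ν₁) :
    (β₁ * conj β₂).im = 0 ∧ (α₁.im : ℂ) * β₂ = α₂.im * β₁ := by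
  have h := (h₁.mul h₂).unique (hc ▸ h₂.mul h₁)
  have hI : ∀ z : ℂ, z - conj z = 2 * z.im * Complex.I := fun z => by rw [Complex.sub_conj]; push_cast; ring
  rcases h with ⟨e1, e2⟩ | ⟨e1, e2⟩
  · constructor
    · have : β₁ * conj β₂ = conj (β₁ * conj β₂) := by simp; linear_combination -e1
      exact Complex.conj_eq_iff_im.1 this.symm
    · have a1 := hI α₁
      have a2 := hI α₂
      have : 2 * Complex.I ≠ 0 := by simp
      apply mul_left_cancel₀ this
      linear_combination (-e2) - a1 * β₂ + a2 * β₁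
  · exfalso
    have h3 : α₁ * α₂ = -((β₁ * conj β₂).re : ℂ) := by
      have := Complex.add_conj (β₁ * conj β₂)
      simp only [map_mul, Complex.conj_conj] at this
      push_cast at this
      linear_combination (1/2) * e1 - (1/2) * this
    have h4 : ‖α₁‖ * ‖α₂‖ ≤ ‖β₁‖ * ‖β₂‖ := by
      rw [← norm_mul, h3, norm_neg, Complex.norm_real]
      refine (Complex.abs_re_le_norm _).trans ?_
      rw [norm_mul, Complex.norm_conj]
    have i1 := h₁.1
    have i2 := h₂.1
    rw [← Complex.sq_norm, ← Complex.sq_norm] at i1 i2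
    have l1 : ‖β₁‖ < ‖α₁‖ := by nlinarith [norm_nonneg α₁, norm_nonneg β₁]
    have l2 : ‖β₂‖ < ‖α₂‖ := by nlinarith [norm_nonneg α₂, norm_nonneg β₂]
    nlinarith [norm_nonneg α₁, norm_nonneg β₁, norm_nonneg α₂, norm_nonneg β₂]

/-- if `ν₁` commutes with `ν₂`, `ν₁` not fixing the origin, then `ν₂` is parallel to `ν₁`. -/
theorem par (h₁ : MRep ν₁ α₁ β₁) (h₂ : MRep ν₂ α₂ β₂) (hc : ν₁ * ν₂ = ν₂ * ν₁) (hb : β₁ ≠ 0) :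
    ∃ k : ℝ, β₂ = k * β₁ ∧ α₂.im = k * α₁.im := by
  obtain ⟨e1, e2⟩ := h₁.commute h₂ hc
  have hn : Complex.normSq β₁ ≠ 0 := by simpa using hb
  have hk : β₂ = ((β₁ * conj β₂).re / Complex.normSq β₁ : ℝ) * β₁ := by
    have : ((β₁ * conj β₂).re : ℂ) = conj β₁ * β₂ := by
      have h5 : ((β₁ * conj β₂).re : ℂ) = conj (β₁ * conj β₂) := by
        apply Complex.ext <;> simp at e1 ⊢
        linarith
      rw [h5]; simp
    have hn' : (Complex.normSq β₁ : ℂ) ≠ 0 := by exact_mod_cast hn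
    push_cast
    rw [this, div_mul_eq_mul_div, eq_div_iff hn', ← Complex.mul_conj]; ring
  refine ⟨_, hk, ?_⟩
  set k : ℝ := (β₁ * conj β₂).re / Complex.normSq β₁
  rw [hk, ← mul_assoc] at e2
  have := mul_right_cancel₀ hb e2
  have h6 : α₁.im * k = α₂.im := by exact_mod_cast this
  linarith

theorem commute_of_par {k₁ k₂ : ℝ} (h₁ : MRep ν₁ α₁ β₁) (h₂ : MRep ν₂ α₂ β₂)
    (e1 : β₁ = k₁ * β) (e2 : β₂ = k₂ * β) (i1 : α₁.im = k₁ * α.im) (i2 : α₂.im = k₂ * α.im) :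
    ν₁ * ν₂ = ν₂ * ν₁ := by
  refine (h₁.mul h₂).eq_of ?_
  convert h₂.mul h₁ using 1
  · rw [e1, e2]; simp; ring
  · have a1 : α₁ - conj α₁ = 2 * (k₁ * α.im) * Complex.I := by rw [Complex.sub_conj, i1]; push_cast; ring
    have a2 : α₂ - conj α₂ = 2 * (k₂ * α.im) * Complex.I := by rw [Complex.sub_conj, i2]; push_cast; ring
    rw [e1, e2]
    linear_combination (k₂ * β) * a1 - (k₁*β) * a2
end MRep

namespace Cov
open ComplexConjugate
variable {V : Set ℂ} {q : ℂ → ℂ}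

theorem exists_rep (h : Cov V q) {ν : BB ≃ₜ BB} (hν : ν ∈ deck q) : ∃ α β, MRep ν α β := by
  obtain ⟨N, hN, hNe⟩ := h.deck_hol hν
  obtain ⟨N', hN', hNe'⟩ := h.deck_hol ((deck q).inv_mem hν)
  set b : ℂ := ((ν bo : BB) : ℂ) with hb
  have hb1 : ‖b‖ < 1 := (ν bo).norm_lt
  have mN : ∀ z, ‖z‖ < 1 → ‖N z‖ < 1 := fun z hz => by
    have := hNe ⟨z, mem_ball_zero_iff.2 hz⟩
    simp only at this
    rw [this]; exact BB.norm_lt _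
  have mN' : ∀ z, ‖z‖ < 1 → ‖N' z‖ < 1 := fun z hz => by
    have := hNe' ⟨z, mem_ball_zero_iff.2 hz⟩
    simp only at this
    rw [this]; exact BB.norm_lt _
  have NN' : ∀ z, ‖z‖ < 1 → N' (N z) = z := fun z hz => by
    have h1 := hNe ⟨z, mem_ball_zero_iff.2 hz⟩
    simp only at h1
    rw [h1, hNe']
    change ((ν.symm (ν _) : BB) : ℂ) = z
    simp
  have N0 : N 0 = b := hNe bo
  set F : ℂ → ℂ := fun z => mob b (N z) with hF
  have hFd : DifferentiableOn ℂ F (ball 0 1) := (mob_diff hb1).comp hN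
    (fun z hz => mem_ball_zero_iff.2 (mN z (mem_ball_zero_iff.1 hz)))
  have hF0 : F 0 = 0 := by simp [hF, N0]
  set F' : ℂ → ℂ := fun z => N' (mob b z) with hF'
  have hFd' : DifferentiableOn ℂ F' (ball 0 1) := hN'.comp (mob_diff hb1)
    (fun z hz => mem_ball_zero_iff.2 (mob_norm hb1 (mem_ball_zero_iff.1 hz)))
  have hF0' : F' 0 = 0 := by
    simp only [hF', mob_zero, ← N0]; exact NN' 0 (by simp)
  have hFF : ∀ z, ‖z‖ < 1 → F' (F z) = z := fun z hz => by
    simp only [hF, hF', mob_mob hb1 (mN z hz), NN' z hz]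
  have mF : ∀ z, ‖z‖ < 1 → ‖F z‖ < 1 := fun z hz => mob_norm hb1 (mN z hz)
  have mF' : ∀ z, ‖z‖ < 1 → ‖F' z‖ < 1 := fun z hz => mN' _ (mob_norm hb1 hz)
  have hle : ∀ z, ‖z‖ < 1 → ‖F z‖ ≤ ‖z‖ := fun z hz =>
    Complex.norm_le_norm_of_mapsTo_ball hFd
      (fun w hw => mem_closedBall_zero_iff.2 (mF w (mem_ball_zero_iff.1 hw)).le) hF0 hz
  have hge : ∀ z, ‖z‖ < 1 → ‖z‖ ≤ ‖F z‖ := fun z hz => by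
    have := Complex.norm_le_norm_of_mapsTo_ball (z := F z) hFd'
      (fun w hw => mem_closedBall_zero_iff.2 (mF' w (mem_ball_zero_iff.1 hw)).le) hF0' (mF z hz)
    rwa [hFF z hz] at this
  obtain ⟨c, hc, hceq⟩ := Complex.affine_of_mapsTo_ball_of_exists_norm_dslope_eq_div' (f := F) (c := 0)
    (R₁ := 1) (R₂ := 1) hFd (fun w hw => by
      rw [hF0]; exact mem_closedBall_zero_iff.2 (mF w (mem_ball_zero_iff.1 hw)).le)
    ⟨1/2, by rw [mem_ball_zero_iff]; norm_num, by
      rw [dslope_of_ne _ (by norm_num), slope_def_field, hF0, norm_div]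
      have : ‖F (1/2)‖ = ‖(1/2:ℂ)‖ := le_antisymm (hle _ (by norm_num)) (hge _ (by norm_num))
      rw [sub_zero, sub_zero, this]; norm_num⟩
  have hc1 : ‖c‖ = 1 := by simpa using hc
  have hNz : ∀ u : BB, (ν u : ℂ) = mob b (c * u) := fun u => by
    have h1 := hceq u.2
    simp only [hF0, sub_zero, zero_add, smul_eq_mul] at h1
    rw [mul_comm c, ← h1, ← hNe]
    simp only [hF]
    rw [mob_mob hb1 (mN _ u.norm_lt)]
  obtain ⟨d, hd⟩ : ∃ d : ℂ, d ^ 2 = -c := IsAlgClosed.exists_pow_nat_eq _ (by norm_num)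
  have hd1 : ‖d‖ = 1 := by
    have : ‖d‖ ^ 2 = 1 := by rw [← norm_pow, hd, norm_neg, hc1]
    nlinarith [norm_nonneg d]
  have hdd : d * conj d = 1 := by rw [Complex.mul_conj, ← Complex.sq_norm, hd1]; simp
  have hbp : 0 < 1 - ‖b‖ ^ 2 := by nlinarith [norm_nonneg b]
  set s : ℝ := Real.sqrt (1 - ‖b‖ ^ 2) with hs
  have hsp : 0 < s := Real.sqrt_pos.2 hbp
  have hss : s ^ 2 = 1 - ‖b‖ ^ 2 := Real.sq_sqrt hbp.le
  have hsc : (s:ℂ) ≠ 0 := by exact_mod_cast hsp.ne'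
  refine ⟨d / s, b * conj d / s, ?_, fun u => ?_⟩
  · rw [← Complex.sq_norm, ← Complex.sq_norm]
    simp only [norm_div, norm_mul, Complex.norm_conj, hd1, Complex.norm_real, Real.norm_eq_abs, abs_of_pos hsp]
    field_simp
    rw [hss]; 
  · have hden := mob_den hb1 (z := c * u) (by rw [norm_mul, hc1, one_mul]; exact u.norm_lt)
    have h1 : (ν u : ℂ) * (1 - conj b * (c * u)) = b - c * u := by
      rw [hNz, mob, div_mul_cancel₀ _ hden]
    simp only [map_div₀, map_mul, Complex.conj_conj, Complex.conj_ofReal]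
    field_simp
    have hc' : c = -(d*d) := by linear_combination hd
    rw [hc'] at h1
    linear_combination (conj d) * h1 + (d * (u:ℂ) - (ν u : ℂ) * conj b * d * u) * hdd

theorem rep_ne (h : Cov V q) {ν : BB ≃ₜ BB} (hν : ν ∈ deck q) (hne : ν ≠ 1) {α β : ℂ} (hr : MRep ν α β) :
    β ≠ 0 := by
  rintro rfl
  apply hne
  apply h.deck_free hν (a := bo)
  have h1 := hr.2 bo
  have h2 := MRep.den_ne hr.1 (z := 0) (by simp)
  simp only [bo] at h1
  apply Subtype.ext
  simp at h1 h2
  have := h1.resolve_right h2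
  exact congrArg Subtype.val this

theorem commute_trans (h : Cov V q) {l ν₁ ν₂ : BB ≃ₜ BB} (hl : l ∈ deck q) (h1 : ν₁ ∈ deck q)
    (h2 : ν₂ ∈ deck q) (hne : l ≠ 1) (c1 : l * ν₁ = ν₁ * l) (c2 : l * ν₂ = ν₂ * l) : ν₁ * ν₂ = ν₂ * ν₁ := by
  obtain ⟨α, β, hr⟩ := h.exists_rep hl
  obtain ⟨α₁, β₁, hr1⟩ := h.exists_rep h1
  obtain ⟨α₂, β₂, hr2⟩ := h.exists_rep h2
  have hb := h.rep_ne hl hne hr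
  obtain ⟨k₁, e1, i1⟩ := hr.par hr1 c1 hb
  obtain ⟨k₂, e2, i2⟩ := hr.par hr2 c2 hb
  exact hr1.commute_of_par hr2 e1 e2 i1 i2
end Cov

/-- Uniformizing coordinate in which a cyclic deck group acts by translations. -/
structure Coord (E R : ℂ → ℂ) (S : Set ℝ) : Prop where
  o : IsOpen S
  c : S.OrdConnected
  ne : S.Nonempty
  d : DifferentiableOn ℂ E (ball 0 1)
  r : DifferentiableOn ℂ R {w | w.im ∈ S}
  mE : ∀ z, ‖z‖ < 1 → (E z).im ∈ S
  mR : ∀ w, w.im ∈ S → ‖R w‖ < 1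
  ER : ∀ w, w.im ∈ S → E (R w) = w
  RE : ∀ z, ‖z‖ < 1 → R (E z) = z

namespace Coord
open ComplexConjugate

theorem half {ξ : ℂ} (hξ : ‖ξ‖ = 1) :
    Coord (fun z => Complex.I * (ξ + z) / (ξ - z)) (fun w => ξ * (w - Complex.I) / (w + Complex.I))
      (Set.Ioi 0) := by
  have hξ0 : ξ ≠ 0 := by rintro rfl; simp at hξ
  have hne : ∀ z : ℂ, ‖z‖ < 1 → ξ - z ≠ 0 := fun z hz h => by
    rw [← sub_eq_zero.1 h] at hz; linarith
  have hne' : ∀ w : ℂ, 0 < w.im → w + Complex.I ≠ 0 := fun w hw h => by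
    have := congrArg Complex.im h
    simp at this; linarith
  have hn : Complex.normSq ξ = 1 := by rw [← Complex.sq_norm, hξ]; norm_num
  have hn2 : ξ.re * ξ.re + ξ.im * ξ.im = 1 := by rw [← hn, Complex.normSq_apply]
  refine ⟨isOpen_Ioi, Set.ordConnected_Ioi, Set.nonempty_Ioi, ?_, ?_, ?_, ?_, ?_, ?_⟩
  · intro z hz
    have := hne z (mem_ball_zero_iff.1 hz)
    apply DifferentiableAt.differentiableWithinAt
    fun_prop (disch := assumption)
  · intro w hw
    have := hne' w hw
    apply DifferentiableAt.differentiableWithinAt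
    fun_prop (disch := assumption)
  · intro z hz
    have h1 := hne z hz
    have h2 : Complex.normSq z < 1 := by
      rw [← Complex.sq_norm]; nlinarith [norm_nonneg z]
    have h3 : 0 < Complex.normSq (ξ - z) := Complex.normSq_pos.2 h1
    have h4 : ((Complex.I * (ξ + z) / (ξ - z))).im = (1 - Complex.normSq z) / Complex.normSq (ξ - z) := by
      rw [Complex.div_im, ← sub_div]
      congr 1
      rw [Complex.normSq_apply]
      simp
      linear_combination hn2
    rw [Set.mem_Ioi, h4]
    apply div_pos (by linarith) h3
  · intro w hw
    rw [norm_div, norm_mul, hξ, one_mul, div_lt_one (norm_pos_iff.2 (hne' w hw))]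
    have h : Complex.normSq (w - Complex.I) < Complex.normSq (w + Complex.I) := by
      rw [Complex.normSq_apply, Complex.normSq_apply]
      have : 0 < w.im := hw
      simp; nlinarith
    rw [← Complex.sq_norm, ← Complex.sq_norm] at h
    exact lt_of_pow_lt_pow_left₀ 2 (norm_nonneg _) h
  · intro w hw
    have h1 := hne' w hw
    have e1 : ξ + ξ * (w - Complex.I) / (w + Complex.I) = 2 * ξ * w / (w + Complex.I) := by
      field_simp; ring
    have e2 : ξ - ξ * (w - Complex.I) / (w + Complex.I) = 2 * ξ * Complex.I / (w + Complex.I) := by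
      field_simp; ring
    simp only [e1, e2]
    have := Complex.I_ne_zero
    field_simp
  · intro z hz
    have h1 := hne z hz
    have e1 : Complex.I * (ξ + z) / (ξ - z) - Complex.I = 2 * Complex.I * z / (ξ - z) := by
      field_simp; ring
    have e2 : Complex.I * (ξ + z) / (ξ - z) + Complex.I = 2 * Complex.I * ξ / (ξ - z) := by
      field_simp; ring
    simp only [e1, e2]
    have := Complex.I_ne_zero
    field_simp

theorem logc {E R : ℂ → ℂ} (h : Coord E R (Set.Ioi 0)) (c : ℝ) :
    Coord (fun z => Complex.log (E z + c)) (fun w => R (Complex.exp w - c)) (Set.Ioo 0 Real.pi) := by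
  have him : ∀ w : ℂ, w.im ∈ Set.Ioo 0 Real.pi → (Complex.exp w - c).im ∈ Set.Ioi (0:ℝ) := by
    intro w hw
    simp only [Complex.sub_im, Complex.exp_im, Complex.ofReal_im, sub_zero, Set.mem_Ioi]
    exact mul_pos (Real.exp_pos _) (Real.sin_pos_of_mem_Ioo hw)
  have hpos : ∀ z, ‖z‖ < 1 → 0 < (E z + c).im := fun z hz => by
    have := h.mE z hz
    simpa using this
  refine ⟨isOpen_Ioo, Set.ordConnected_Ioo, Set.nonempty_Ioo.2 Real.pi_pos, ?_, ?_, ?_, ?_, ?_, ?_⟩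
  · refine DifferentiableOn.clog (h.d.add_const _) fun z hz => ?_
    right; exact (hpos z (mem_ball_zero_iff.1 hz)).ne'
  · refine h.r.comp (by fun_prop) fun w hw => him w hw
  · intro z hz
    rw [Complex.log_im]
    have h1 := hpos z hz
    constructor
    · rcases (Complex.arg_nonneg_iff.2 h1.le).lt_or_eq with h2 | h2
      · exact h2
      · have := (Complex.arg_eq_zero_iff.1 h2.symm).2
        linarith
    · exact Complex.arg_lt_pi_iff.2 (Or.inr h1.ne')
  · intro w hw; exact h.mR _ (him w hw)
  · intro w hw
    simp only [h.ER _ (him w hw), sub_add_cancel]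
    exact Complex.log_exp (by linarith [hw.1, Real.pi_pos]) hw.2.le
  · intro z hz
    have : E z + c ≠ 0 := fun h0 => by have := hpos z hz; rw [h0] at this; simp at this
    simp only [Complex.exp_log this, add_sub_cancel_right, h.RE z hz]

theorem scale {E R : ℂ → ℂ} {S : Set ℝ} (h : Coord E R S) {b : ℝ} (hb : b ≠ 0) :
    Coord (fun z => E z / b) (fun w => R (b * w)) {y | b * y ∈ S} := by
  have hbc : (b:ℂ) ≠ 0 := by exact_mod_cast hb
  have him : ∀ w : ℂ, (b * w : ℂ).im = b * w.im := fun w => by simp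
  have e1 : ∀ w : ℂ, b * (w / b) = w := fun w => by field_simp
  refine ⟨h.o.preimage (continuous_const_mul b), ⟨?_⟩, ?_, h.d.div_const _, ?_, ?_, ?_, ?_, ?_⟩
  · intro x hx y hy z hz
    have hx' : b * x ∈ S := hx
    have hy' : b * y ∈ S := hy
    change b * z ∈ S
    rcases lt_or_gt_of_ne hb with h0 | h0
    · exact h.c.out hy' hx' ⟨by nlinarith [hz.2], by nlinarith [hz.1]⟩
    · exact h.c.out hx' hy' ⟨by nlinarith [hz.1], by nlinarith [hz.2]⟩
  · obtain ⟨s, hs⟩ := h.ne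
    exact ⟨s / b, by change b * (s / b) ∈ S; rwa [mul_div_cancel₀ _ hb]⟩
  · refine h.r.comp (by fun_prop) fun w hw => ?_
    change (b * w : ℂ).im ∈ S
    rw [him]; exact hw
  · intro z hz
    change b * (E z / b).im ∈ S
    rw [← him, e1]; exact h.mE z hz
  · intro w hw
    exact h.mR _ (by rw [him]; exact hw)
  · intro w hw
    rw [h.ER _ (by rw [him]; exact hw), mul_div_cancel_left₀ _ hbc]
  · intro z hz
    simp only [e1, h.RE z hz]
end Coord

namespace Cov
open ComplexConjugate
variable {V : Set ℂ} {q : ℂ → ℂ}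

theorem abel_coord (h : Cov V q) {l : BB ≃ₜ BB}
    (hl : l ∈ deck q) (hne : l ≠ 1) : ∃ E R S, Coord E R S ∧
      ∀ ν ∈ deck q, l * ν = ν * l → ∃ τ : ℝ, ∀ u : BB, E (ν u) = E u + τ := by
  obtain ⟨α, β, hr⟩ := h.exists_rep hl
  have hb := h.rep_ne hl hne hr
  have hcb : conj β ≠ 0 := by simpa using hb
  have root_norm : ∀ ξ : ℂ, conj β * ξ ^ 2 + (conj α - α) * ξ - β = 0 → 1 ≤ ‖ξ‖ := by
    intro ξ h0
    by_contra hlt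
    push Not at hlt
    set u : BB := ⟨ξ, mem_ball_zero_iff.2 hlt⟩
    apply hne
    apply h.deck_free hl (a := u)
    apply Subtype.ext
    have h1 := hr.2 u
    apply mul_right_cancel₀ (MRep.den_ne hr.1 (z := u) u.norm_lt.le)
    rw [h1]
    change α * ξ + β = ξ * (conj β * ξ + conj α)
    linear_combination -h0
  obtain ⟨d, hd⟩ : ∃ d : ℂ, d ^ 2 = (conj α - α) ^ 2 + 4 * conj β * β :=
    IsAlgClosed.exists_pow_nat_eq _ (by norm_num)
  obtain ⟨ξ, hξ⟩ : ∃ ξ : ℂ, ξ = (-(conj α - α) + d) / (2 * conj β) := ⟨_, rfl⟩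
  have h0 : conj β * ξ ^ 2 + (conj α - α) * ξ - β = 0 := by
    rw [hξ]; field_simp; linear_combination hd
  have hξ1 : 1 ≤ ‖ξ‖ := root_norm ξ h0
  have hξ0 : ξ ≠ 0 := by rintro rfl; simp at hξ1; linarith
  have hξ2 : ‖ξ‖ = 1 := by
    have := root_norm (-β / (conj β * ξ)) (by field_simp; linear_combination (-β) * h0)
    rw [norm_div, norm_neg, norm_mul, Complex.norm_conj] at this
    have hbn : ‖β‖ ≠ 0 := by simpa using hb
    have e : ‖β‖ / (‖β‖ * ‖ξ‖) = ‖ξ‖⁻¹ := by field_simp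
    rw [e] at this
    have : ‖ξ‖ ≤ 1 := (one_le_inv₀ (by linarith)).1 this
    linarith
  have hξξ : ξ * conj ξ = 1 := by rw [Complex.mul_conj, ← Complex.sq_norm, hξ2]; simp
  have hC := Coord.half hξ2
  set ψ : ℂ → ℂ := fun z => Complex.I * (ξ + z) / (ξ - z) with hψ
  set s : ℝ := α.im with hs
  have has : α - conj α = 2 * s * Complex.I := by rw [Complex.sub_conj]; push_cast; ring
  -- the real number ρ
  set ρ : ℝ := (conj β * ξ).re with hρ
  have hρ1 : conj β * ξ - β * conj ξ = 2 * s * Complex.I := by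
    linear_combination (conj ξ) * h0 + has + (β * 0 - conj β * ξ  + (α - conj α)) * hξξ
  have hρi : (conj β * ξ).im = s := by
    have := congrArg Complex.im hρ1
    simp at this ⊢
    linarith
  have hρe : conj β * ξ = ρ + s * Complex.I := by
    rw [← hρi, hρ]; exact (Complex.re_add_im _).symm
  have hρe' : β * conj ξ = ρ - s * Complex.I := by linear_combination hρe - hρ1
  have hβs : Complex.normSq β = ρ ^ 2 + s ^ 2 := by
    have : Complex.normSq (conj β * ξ) = ρ ^ 2 + s ^ 2 := by
      rw [Complex.normSq_apply, hρi, hρ]; ring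
    rw [← this, Complex.normSq_mul, Complex.normSq_conj, ← Complex.sq_norm ξ, hξ2]; ring
  -- action on ψ
  have act : ∀ ν ∈ deck q, l * ν = ν * l → ∃ k m : ℝ, m ≠ 0 ∧ m * (m + 2 * k * ρ) = 1 ∧ 
      ∀ u : BB, ψ (ν u) = (1 / m ^ 2 : ℝ) * ψ u + (2 * (k * s) / m : ℝ) := by
    intro ν hν hc
    obtain ⟨α', β', hr'⟩ := h.exists_rep hν
    obtain ⟨k, e1, i1⟩ := hr.par hr' hc hb
    set m : ℝ := α'.re - k * ρ with hm
    have hα' : α' = m + k * ρ + k * s * Complex.I := by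
      rw [← Complex.re_add_im α', i1, hm]; push_cast; ring
    have hα'c : conj α' = m + k * ρ - k * s * Complex.I := by rw [hα']; simp; ring
    have hmm : m * (m + 2 * k * ρ) = 1 := by
      have h2 := hr'.1
      rw [e1, Complex.normSq_mul, Complex.normSq_ofReal, hβs, Complex.normSq_apply, i1] at h2
      rw [hm]; linear_combination h2
    have hm0 : m ≠ 0 := by rintro h; rw [h] at hmm; simp at hmm
    refine ⟨k, m, hm0, hmm, fun u => ?_⟩
    have hden := MRep.den_ne hr'.1 (z := u) u.norm_lt.le
    have hν' := hr'.2 u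
    have hmc : (m:ℂ) ≠ 0 := by exact_mod_cast hm0
    have hmmc : (m:ℂ) * (m + 2 * k * ρ) = 1 := by exact_mod_cast hmm
    have n1 : ∀ z : ℂ, ‖z‖ < 1 → ξ - z ≠ 0 := fun z hz h => by
      rw [← sub_eq_zero.1 h] at hz; linarith
    have hu := n1 u u.norm_lt
    have hnu := n1 (ν u) (ν u).norm_lt
    set w : ℂ := ((ν u : BB) : ℂ)
    set z : ℂ := (u : ℂ)
    set D := conj β' * z + conj α' with hD
    have hbξ : β' = k * ξ * (ρ - s * Complex.I) := by
      rw [e1]; linear_combination (k * ξ) * hρe' - k * β * hξξ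
    have hbc : conj β' * ξ = k * (ρ + s * Complex.I) := by
      rw [e1, map_mul, Complex.conj_ofReal]; linear_combination k * hρe
    have f1 : (ξ - w) * D = (ξ - z) * m := by
      rw [sub_mul, hν', hD, hα'c, hα']; linear_combination z * hbc - hbξ
    have f2 : (ξ + w) * D = (ξ + z) * (m + 2 * k * ρ) - 2 * k * s * Complex.I * (ξ - z) := by
      rw [add_mul, hν', hD, hα'c, hα']; linear_combination z * hbc + hbξ
    have f3 : ψ w = Complex.I * ((ξ + w) * D) / ((ξ - w) * D) := by
      simp only [hψ]; field_simp
    rw [f3, f1, f2]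
    simp only [hψ]
    push_cast
    have hI := Complex.I_sq
    field_simp
    linear_combination (Complex.I * (ξ + z)) * hmmc - 2 * k * s * m * (ξ - z) * hI
  by_cases hρ0 : ρ = 0
  · refine ⟨_, _, _, hC, fun ν hν hc => ?_⟩
    obtain ⟨k, m, hm, hmm, hact⟩ := act ν hν hc
    refine ⟨2 * (k * s) / m, fun u => ?_⟩
    rw [hact u]
    have : m ^ 2 = 1 := by rw [hρ0] at hmm; linarith
    rw [this]; simp
  · refine ⟨_, _, _, hC.logc (s / ρ), fun ν hν hc => ?_⟩
    obtain ⟨k, m, hm, hmm, hact⟩ := act ν hν hc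
    refine ⟨Real.log (1 / m ^ 2), fun u => ?_⟩
    have hmp : 0 < 1 / m ^ 2 := by positivity
    have e : ψ (ν u) + ((s / ρ : ℝ):ℂ) = ((1 / m ^ 2 : ℝ):ℂ) * (ψ u + ((s / ρ : ℝ) : ℂ)) := by
      rw [hact u, mul_add, add_assoc]
      congr 1
      rw [← Complex.ofReal_mul, ← Complex.ofReal_add]
      congr 1
      field_simp
      linear_combination s * hmm
    have hx : ψ u + ((s / ρ : ℝ) : ℂ) ≠ 0 := by
      intro h0
      have h1 : 0 < (ψ u).im := hC.mE u u.norm_lt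
      have := congrArg Complex.im h0
      rw [Complex.add_im, Complex.ofReal_im] at this
      simp at this; linarith
    change Complex.log (ψ (ν u) + _) = Complex.log (ψ u + _) + _
    rw [e, Complex.log_ofReal_mul hmp hx, add_comm]

theorem abel_gen (h : Cov V q) {l : BB ≃ₜ BB}
    (hl : l ∈ deck q) (hne : l ≠ 1) : ∃ E R S, Coord E R S ∧ ∃ g ∈ deck q,
      (∀ u : BB, E (g u) = E u + 1) ∧ ∀ ν ∈ deck q, l * ν = ν * l → ∃ n : ℤ, ν = g ^ n := by
  obtain ⟨E, R, S, hC, hτ⟩ := h.abel_coord hl hne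
  have hinj : ∀ u v : BB, E u = E v → u = v := fun u v e => by
    apply Subtype.ext
    rw [← hC.RE u u.norm_lt, e, hC.RE v v.norm_lt]
  let T : AddSubgroup ℝ :=
    { carrier := {τ | ∃ ν ∈ deck q, ∀ u : BB, E (ν u) = E u + τ}
      zero_mem' := ⟨1, one_mem _, fun u => by simp⟩
      add_mem' := by
        rintro a b ⟨ν, hν, h1⟩ ⟨ν', hν', h2⟩
        refine ⟨ν * ν', mul_mem hν hν', fun u => ?_⟩
        change E (ν (ν' u)) = _
        rw [h1, h2]; push_cast; ring
      neg_mem' := by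
        rintro a ⟨ν, hν, h1⟩
        refine ⟨ν⁻¹, inv_mem hν, fun u => ?_⟩
        have := h1 (ν.symm u)
        rw [ν.apply_symm_apply] at this
        change E (ν.symm u) = _
        rw [this]; push_cast; ring }
  obtain ⟨r, hr, hdis⟩ := h.deck_discrete
  have hE0 : (E 0).im ∈ S := hC.mE 0 (by simp)
  have hopen : IsOpen {w : ℂ | w.im ∈ S} := hC.o.preimage Complex.continuous_im
  have hcont : ContinuousAt (fun t : ℝ => ‖R (E 0 + t)‖) 0 := by
    have h1 : ContinuousAt R (E 0 + ((0:ℝ):ℂ)) := by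
      simpa using hC.r.continuousOn.continuousAt (hopen.mem_nhds hE0)
    have h2 : ContinuousAt (fun t : ℝ => E 0 + (t:ℂ)) 0 := by fun_prop
    exact (ContinuousAt.comp (f := fun t : ℝ => E 0 + (t:ℂ)) h1 h2).norm
  have hR0 : ‖R (E 0 + ((0:ℝ):ℂ))‖ < r := by simpa [hC.RE 0 (by simp)] using hr
  obtain ⟨ε, hε, hεr⟩ := Metric.eventually_nhds_iff.1 (hcont.eventually (gt_mem_nhds hR0))
  have hisol : ∃ b, T = AddSubgroup.closure {b} := by
    apply AddSubgroup.cyclic_of_isolated_zero hε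
    rw [Set.disjoint_left]
    rintro τ ⟨ν, hν, h1⟩ ⟨h2, h3⟩
    have h4 := hεr (y := τ) (by rw [Real.dist_eq, sub_zero, abs_of_pos h2]; exact h3)
    have h5 := h1 bo
    have h6 : R (E (ν bo)) = ν bo := hC.RE _ (ν bo).norm_lt
    rw [h5] at h6
    have h7 := hdis ν hν (by rw [← h6]; exact h4)
    rw [h7] at h5
    have : (τ:ℂ) = 0 := by
      have h8 : E bo = E bo + (τ:ℂ) := h5
      linear_combination -h8
    have : τ = 0 := by exact_mod_cast this
    linarith
  obtain ⟨b, hT⟩ := hisol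
  have hbT : b ∈ T := by rw [hT]; exact AddSubgroup.subset_closure rfl
  obtain ⟨g, hg, hgE⟩ := hbT
  have hb0 : b ≠ 0 := by
    rintro rfl
    obtain ⟨τ, h1⟩ := hτ l hl rfl
    have h2 : τ ∈ T := ⟨l, hl, h1⟩
    rw [hT, AddSubgroup.mem_closure_singleton] at h2
    obtain ⟨_, h2⟩ := h2
    rw [smul_zero] at h2
    apply hne
    apply h.deck_free hl (a := bo)
    apply hinj
    rw [h1, ← h2]; simp
  have hbc : (b:ℂ) ≠ 0 := by exact_mod_cast hb0
  refine ⟨_, _, _, hC.scale hb0, g, hg, fun u => ?_, fun ν hν hc => ?_⟩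
  · rw [hgE]; field_simp
  · obtain ⟨τ, h1⟩ := hτ ν hν hc
    have h2 : τ ∈ T := ⟨ν, hν, h1⟩
    rw [hT, AddSubgroup.mem_closure_singleton] at h2
    obtain ⟨n, hn⟩ := h2
    refine ⟨n, h.homeo_ext (a := bo) (fun u => ?_) ?_⟩
    · rw [hν u, zpow_mem hg n u]
    · apply hinj
      have key : ∀ n : ℤ, ∀ u : BB, E ((g ^ n) u) = E u + n * b := by
        intro n
        induction n using Int.induction_on with
        | zero => intro u; simp
        | succ i hi => 
          intro u
          rw [zpow_add_one]
          change E ((g ^ (i:ℤ)) (g u)) = _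
          rw [hi, hgE]; push_cast; ring
        | pred i hi =>
          intro u
          rw [zpow_sub_one]
          change E ((g ^ (-(i:ℤ))) (g.symm u)) = _
          have := hgE (g.symm u)
          rw [g.apply_symm_apply] at this
          rw [hi, this]; push_cast; ring
      rw [key, h1, ← hn]; simp
end Cov

theorem isW_of_mono {h : ℂ → ℂ} (hc : Continuous h)
    (hm : ∀ x y, x ≠ y → 0 < ((h y - h x) / (y - x)).re) :
    IsW h (fun p => Complex.log ((h p.2 - h p.1) / (p.2 - p.1))) := by
  constructor
  · intro p hp
    have hne : p.2 - p.1 ≠ 0 := sub_ne_zero.2 (Ne.symm hp)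
    apply ContinuousAt.continuousWithinAt
    refine ContinuousAt.clog ?_ (Or.inl (hm _ _ hp))
    exact ContinuousAt.div (by fun_prop) (by fun_prop) hne
  · intro x y hxy
    have hne : y - x ≠ 0 := sub_ne_zero.2 (Ne.symm hxy)
    have h0 : (h y - h x) / (y - x) ≠ 0 := fun h0 => by
      have := hm x y hxy
      rw [h0] at this; simp at this
    simp only
    rw [Complex.exp_log h0, div_mul_cancel₀ _ hne]

/-- homeomorphism of the plane onto the upper half plane -/
noncomputable def hh (w : ℂ) : ℂ := w.re + Real.exp w.im * Complex.I
noncomputable def hl (w : ℂ) : ℂ := w.re + Real.log w.im * Complex.I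

theorem hh_im (w : ℂ) : (hh w).im = Real.exp w.im := by simp [hh, Complex.exp_ofReal_re]
theorem hh_re (w : ℂ) : (hh w).re = w.re := by simp [hh, Complex.exp_ofReal_im]
theorem hl_im (w : ℂ) : (hl w).im = Real.log w.im := by simp [hl]
theorem hl_re (w : ℂ) : (hl w).re = w.re := by simp [hl]
theorem hh_hl {w : ℂ} (hw : 0 < w.im) : hh (hl w) = w := by
  apply Complex.ext
  · rw [hh_re, hl_re]
  · rw [hh_im, hl_im, Real.exp_log hw]
theorem hl_hh (w : ℂ) : hl (hh w) = w := by
  apply Complex.ext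
  · rw [hl_re, hh_re]
  · rw [hl_im, hh_im, Real.log_exp]
theorem hh_pos (w : ℂ) : 0 < (hh w).im := by rw [hh_im]; exact Real.exp_pos _
theorem hh_cont : Continuous hh := by unfold hh; fun_prop
theorem hl_cont : ContinuousOn hl {w | 0 < w.im} := by
  intro w hw
  apply ContinuousAt.continuousWithinAt
  have : ContinuousAt (fun w : ℂ => Real.log w.im) w :=
    ContinuousAt.log (by fun_prop) (ne_of_gt hw)
  unfold hl
  fun_prop

theorem exists_W_H {G : ℂ → ℂ} (hc : ContinuousOn G {w | 0 < w.im}) (hm : ∀ w, 0 < w.im → 0 < (G w).im)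
    (hi : ∀ w w', 0 < w.im → 0 < w'.im → G w = G w' → w = w') {x₀ : ℂ} (hx : 0 < x₀.im)
    (hx0 : ∀ᶠ y in 𝓝 x₀, G y = y) :
    ∃ W : ℂ × ℂ → ℂ, ContinuousOn W {p | p.1 ≠ p.2 ∧ 0 < p.1.im ∧ 0 < p.2.im} ∧
      (∀ x y, x ≠ y → 0 < x.im → 0 < y.im → Complex.exp (W (x, y)) * (y - x) = G y - G x) ∧
      ∀ x y, x ≠ y → 0 < x.im → 0 < y.im → W (x, y) = W (y, x) := by
  have hmono : IsW hh (fun p => Complex.log ((hh p.2 - hh p.1) / (p.2 - p.1))) := by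
    apply isW_of_mono hh_cont
    intro x y hxy
    have hne : 0 < Complex.normSq (y - x) := Complex.normSq_pos.2 (sub_ne_zero.2 (Ne.symm hxy))
    rw [Complex.div_re, ← add_div]
    apply div_pos _ hne
    simp only [Complex.sub_re, Complex.sub_im, hh_re, hh_im]
    rw [Complex.normSq_apply, Complex.sub_re, Complex.sub_im] at hne
    rcases lt_trichotomy x.im y.im with h | h | h
    · have := Real.exp_lt_exp.2 h
      nlinarith [mul_pos (sub_pos.2 this) (sub_pos.2 h), mul_self_nonneg (y.re - x.re)]
    · rw [h] at hne ⊢; nlinarith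
    · have := Real.exp_lt_exp.2 h
      nlinarith [mul_pos (sub_pos.2 this) (sub_pos.2 h), mul_self_nonneg (y.re - x.re)]
  have hΦc : Continuous (fun w => hl (G (hh w))) := by
    rw [← continuousOn_univ]
    exact hl_cont.comp (hc.comp hh_cont.continuousOn fun w _ => hh_pos w) fun w _ => hm _ (hh_pos w)
  obtain ⟨W, hW⟩ := exists_isW_of_local_id (fun w => hl (G (hh w))) hΦc (by
      intro a b hab
      have h1 := congrArg hh hab
      simp only at h1
      rw [hh_hl (hm _ (hh_pos _)), hh_hl (hm _ (hh_pos _))] at h1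
      have h2 := congrArg hl (hi _ _ (hh_pos _) (hh_pos _) h1)
      rwa [hl_hh, hl_hh] at h2) (x₀ := hl x₀) (by
      have : ContinuousAt hh (hl x₀) := hh_cont.continuousAt
      rw [ContinuousAt, hh_hl hx] at this
      filter_upwards [this.eventually hx0] with y hy
      rw [hy, hl_hh])
  have hG := hmono.comp hW hΦc
  set V := (fun p : ℂ × ℂ => Complex.log ((hh p.2 - hh p.1) / (p.2 - p.1))) with hV
  have hne : ∀ x y : ℂ, x ≠ y → 0 < x.im → 0 < y.im → hl x ≠ hl y := fun x y h h1 h2 h3 => h (by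
    rw [← hh_hl h1, h3, hh_hl h2])
  set W₁ : ℂ × ℂ → ℂ := fun p => V (hl (G (hh p.1)), hl (G (hh p.2))) + W p with hW₁
  refine ⟨fun p => W₁ (hl p.1, hl p.2) - V (hl p.1, hl p.2), ?_, ?_, ?_⟩
  · have hcl : ContinuousOn (fun p : ℂ × ℂ => (hl p.1, hl p.2)) {p | p.1 ≠ p.2 ∧ 0 < p.1.im ∧ 0 < p.2.im} :=
      (hl_cont.comp continuousOn_fst fun p hp => hp.2.1).prodMk
        (hl_cont.comp continuousOn_snd fun p hp => hp.2.2)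
    exact (hG.1.comp hcl fun p hp => hne _ _ hp.1 hp.2.1 hp.2.2).sub
      (hmono.1.comp hcl fun p hp => hne _ _ hp.1 hp.2.1 hp.2.2)
  · intro x y hxy h1 h2
    have e1 := hG.2 _ _ (hne x y hxy h1 h2)
    have e2 := hmono.2 _ _ (hne x y hxy h1 h2)
    rw [hh_hl h1, hh_hl h2] at e2
    simp only [Function.comp_apply] at e1
    rw [hh_hl h1, hh_hl h2, hh_hl (hm _ h1), hh_hl (hm _ h2)] at e1
    rw [Complex.exp_sub, ← e2, ← e1]
    field_simp
  · intro x y hxy h1 h2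
    have e1 := hG.symm (hne x y hxy h1 h2)
    have e2 := hmono.symm (hne x y hxy h1 h2)
    change W₁ (hl x, hl y) = W₁ (hl y, hl x) at e1
    simp only
    rw [e1]
    congr 1

theorem clog_div_H {a b : ℂ} (ha : 0 < a.im) (hb : 0 < b.im) :
    Complex.log (a / b) = Complex.log a - Complex.log b := by
  have ha0 : a ≠ 0 := by rintro rfl; simp at ha
  have hb0 : b ≠ 0 := by rintro rfl; simp at hb
  have h1 : 0 < a.arg ∧ a.arg < Real.pi := ⟨by
    rcases (Complex.arg_nonneg_iff.2 ha.le).lt_or_eq with h | h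
    · exact h
    · have := (Complex.arg_eq_zero_iff.1 h.symm).2; linarith, Complex.arg_lt_pi_iff.2 (Or.inr ha.ne')⟩
  have h2 : 0 < b.arg ∧ b.arg < Real.pi := ⟨by
    rcases (Complex.arg_nonneg_iff.2 hb.le).lt_or_eq with h | h
    · exact h
    · have := (Complex.arg_eq_zero_iff.1 h.symm).2; linarith, Complex.arg_lt_pi_iff.2 (Or.inr hb.ne')⟩
  have : Complex.exp (Complex.log a - Complex.log b) = a / b := by
    rw [Complex.exp_sub, Complex.exp_log ha0, Complex.exp_log hb0]
  rw [← this, Complex.log_exp]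
  · rw [Complex.sub_im, Complex.log_im, Complex.log_im]; linarith
  · rw [Complex.sub_im, Complex.log_im, Complex.log_im]; linarith

theorem order_H {G : ℂ → ℂ} (hc : ContinuousOn G {w | 0 < w.im}) (hm : ∀ w, 0 < w.im → 0 < (G w).im)
    (hi : ∀ w w', 0 < w.im → 0 < w'.im → G w = G w' → w = w') {x₀ : ℂ} (hx : 0 < x₀.im)
    (hx0 : ∀ᶠ y in 𝓝 x₀, G y = y) (hfix : ∀ B : ℝ, ∃ p, 0 < p.im ∧ G p = p ∧ B ≤ ‖p‖)
    {y z : ℝ → ℂ} (hyc : Continuous y) (hzc : Continuous z) (hy : ∀ t, 0 < (y t).im)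
    (hz : ∀ t, 0 < (z t).im) {η ω η' ω' : ℝ} (ly : Tendsto y atTop (𝓝 η)) (lz : Tendsto z atTop (𝓝 ω))
    (ly' : Tendsto (fun t => G (y t)) atTop (𝓝 η')) (lz' : Tendsto (fun t => G (z t)) atTop (𝓝 ω'))
    (hlt : η < ω) : ¬ ω' < η' := by
  intro hlt'
  obtain ⟨W, hWc, hWe, hWs⟩ := exists_W_H hc hm hi hx hx0
  have hre : ∀ {g : ℝ → ℂ} {a : ℝ}, Tendsto g atTop (𝓝 (a:ℂ)) → Tendsto (fun t => (g t).re) atTop (𝓝 a) :=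
    fun {g a} h => by
    have := (Complex.continuous_re.tendsto _).comp h
    rwa [Complex.ofReal_re] at this
  have him : ∀ {g : ℝ → ℂ} {a : ℝ}, Tendsto g atTop (𝓝 (a:ℂ)) → Tendsto (fun t => (g t).im) atTop (𝓝 0) :=
    fun {g a} h => by
    have := (Complex.continuous_im.tendsto _).comp h
    rwa [Complex.ofReal_im] at this
  have e1 : ∀ᶠ t in atTop, (y t).re < (η + ω) / 2 := (hre ly).eventually (gt_mem_nhds (by linarith))
  have e2 : ∀ᶠ t in atTop, (η + ω) / 2 < (z t).re := (hre lz).eventually (lt_mem_nhds (by linarith))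
  have e3 : ∀ᶠ t in atTop, (η' + ω') / 2 < (G (y t)).re := (hre ly').eventually (lt_mem_nhds (by linarith))
  have e4 : ∀ᶠ t in atTop, (G (z t)).re < (η' + ω') / 2 := (hre lz').eventually (gt_mem_nhds (by linarith))
  have bd : ∀ {g : ℝ → ℂ} {a : ℂ}, Tendsto g atTop (𝓝 a) → ∀ᶠ t in atTop, ‖g t‖ ≤ ‖a‖ + 1 := fun {g a} h =>
    (h.norm.eventually (gt_mem_nhds (lt_add_one ‖a‖))).mono fun t ht => ht.le
  have e5 := bd ly
  have e6 := bd lz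
  have e7 := bd ly'
  have e8 := bd lz'
  obtain ⟨T, hT⟩ := eventually_atTop.1 (e1.and (e2.and (e3.and (e4.and (e5.and (e6.and (e7.and e8)))))))
  -- the connected set
  have hHc : Convex ℝ {w : ℂ | 0 < w.im} := convex_halfSpace_im_gt 0
  set J := segment ℝ (y T) (z T) with hJ
  have hJH : J ⊆ {w | 0 < w.im} := hHc.segment_subset (hy T) (hz T)
  have hJk : IsCompact J := by
    rw [hJ, segment_eq_image]; exact isCompact_Icc.image (by fun_prop)
  set K := y '' Set.Ici T ∪ J ∪ z '' Set.Ici T with hK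
  have hKH : ∀ u ∈ K, 0 < u.im := by
    rintro u ((⟨t, -, rfl⟩ | h) | ⟨t, -, rfl⟩)
    exacts [hy t, hJH h, hz t]
  have hKc : IsPreconnected K := by
    have a1 : IsPreconnected (y '' Set.Ici T) := isPreconnected_Ici.image _ hyc.continuousOn
    have a2 : IsPreconnected (z '' Set.Ici T) := isPreconnected_Ici.image _ hzc.continuousOn
    have a3 : IsPreconnected J := (convex_segment _ _).isPreconnected
    have m1 : y T ∈ y '' Set.Ici T := ⟨T, Set.self_mem_Ici, rfl⟩
    have m2 : z T ∈ z '' Set.Ici T := ⟨T, Set.self_mem_Ici, rfl⟩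
    have a4 := a1.union (y T) m1 (left_mem_segment ℝ _ _) a3
    exact a4.union (z T) (Or.inr (right_mem_segment ℝ _ _)) m2 a2
  obtain ⟨B, hB0, hB⟩ : ∃ B : ℝ, 0 < B ∧ ∀ u ∈ K, ‖u‖ ≤ B ∧ ‖G u‖ ≤ B := by
    obtain ⟨B1, hB1⟩ := hJk.isBounded.exists_norm_le
    obtain ⟨B2, hB2⟩ := (hJk.image_of_continuousOn (hc.mono hJH)).isBounded.exists_norm_le
    refine ⟨|B1| + |B2| + (‖(η:ℂ)‖ + 1) + (‖(ω:ℂ)‖ + 1) + (‖(η':ℂ)‖ + 1) + (‖(ω':ℂ)‖ + 1), by positivity, ?_⟩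
    have := le_abs_self B1
    have := le_abs_self B2
    have := abs_nonneg B1
    have := abs_nonneg B2
    have := norm_nonneg (η:ℂ)
    have := norm_nonneg (ω:ℂ)
    have := norm_nonneg (η':ℂ)
    have := norm_nonneg (ω':ℂ)
    rintro u ((⟨t, ht, rfl⟩ | h) | ⟨t, ht, rfl⟩)
    · obtain ⟨-, -, -, -, h5, -, h7, -⟩ := hT t ht
      constructor <;> linarith
    · have h1 := hB1 u h
      have h2 := hB2 _ ⟨u, h, rfl⟩
      constructor <;> linarith
    · obtain ⟨-, -, -, -, -, h5, -, h7⟩ := hT t ht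
      constructor <;> linarith
  obtain ⟨p, hp, hGp, hpB⟩ := hfix (4 * B)
  have hpu : ∀ u ∈ K, 3 * B ≤ ‖p - u‖ := fun u hu => by
    have := norm_sub_norm_le p u
    have := (hB u hu).1
    linarith
  have hpu0 : ∀ u ∈ K, p - u ≠ 0 := fun u hu h0 => by
    have := hpu u hu
    rw [h0, norm_zero] at this; linarith
  have hpne : ∀ u ∈ K, u ≠ p := fun u hu h0 => hpu0 u hu (by rw [h0, sub_self])
  have hrat : ∀ u ∈ K, 0 < ((p - G u) / (p - u)).re := by
    intro u hu
    have h0 := hpu0 u hu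
    have h1 : (p - G u) / (p - u) = 1 - (G u - u) / (p - u) := by field_simp; ring
    have h2 : ‖(G u - u) / (p - u)‖ ≤ 2 / 3 := by
      rw [norm_div, div_le_iff₀ (norm_pos_iff.2 h0)]
      have := norm_sub_le (G u) u
      have := hB u hu
      have := hpu u hu
      linarith
    have h3 := (Complex.abs_re_le_norm _).trans h2
    rw [h1, Complex.sub_re, Complex.one_re]
    linarith [(abs_le.1 h3).2]
  have hratc : ContinuousOn (fun u => Complex.log ((p - G u) / (p - u))) K := by
    refine ContinuousOn.clog ?_ fun u hu => Or.inl (hrat u hu)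
    exact (continuousOn_const.sub (hc.mono hKH)).div (by fun_prop) hpu0
  obtain ⟨k, hk⟩ : ∃ k : ℂ, ∀ u ∈ K, W (u, p) = Complex.log ((p - G u) / (p - u)) + k := by
    have hyK : y T ∈ K := Or.inl (Or.inl ⟨T, Set.self_mem_Ici, rfl⟩)
    refine ⟨W (y T, p) - Complex.log ((p - G (y T)) / (p - y T)), fun u hu => ?_⟩
    have := clog_diff hKc (L₁ := fun u => W (u, p)) (hWc.comp (by fun_prop)
      fun u hu => ⟨hpne u hu, hKH u hu, hp⟩) hratc (fun u hu => by
        have h0 : (p - G u) / (p - u) ≠ 0 := fun h0 => by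
          have := hrat u hu
          rw [h0] at this; simp at this
        rw [Complex.exp_log h0, eq_div_iff (hpu0 u hu), hWe _ _ (hpne u hu) (hKH u hu) hp, hGp]) hyK hu
    linear_combination this
  have hek : Complex.exp k = 1 := by
    have hu : y T ∈ K := Or.inl (Or.inl ⟨T, Set.self_mem_Ici, rfl⟩)
    have h0 : (p - G (y T)) / (p - y T) ≠ 0 := fun h0 => by
          have := hrat _ hu
          rw [h0] at this; simp at this
    have h1 := hWe _ _ (hpne _ hu) (hKH _ hu) hp
    rw [hk _ hu, Complex.exp_add, Complex.exp_log h0, hGp] at h1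
    have h2 := hpu0 _ hu
    have h3 : p - G (y T) ≠ 0 := fun h => h0 (by rw [h, zero_div])
    field_simp at h1
    exact h1
  -- boundary formula
  have bdy : ∀ {g : ℝ → ℂ} {a a' : ℝ}, Tendsto g atTop (𝓝 (a:ℂ)) → Tendsto (fun t => G (g t)) atTop (𝓝 (a':ℂ)) →
      (∀ t, T ≤ t → g t ∈ K) → ∀ v, 0 < v.im → ∀ᶠ t in atTop, T ≤ t ∧ (g t).im < v.im ∧ (G (g t)).im < (G v).im ∧
        W (g t, v) = Complex.log (G v - G (g t)) - Complex.log (v - g t) + k := by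
    intro g a a' lg lg' hgK v hv
    set I := segment ℝ p v with hI
    have hIH : I ⊆ {w | 0 < w.im} := hHc.segment_subset hp hv
    have hIk : IsCompact I := by
      rw [hI, segment_eq_image]; exact isCompact_Icc.image (by fun_prop)
    have hIn : I.Nonempty := ⟨p, left_mem_segment ℝ _ _⟩
    obtain ⟨u1, hu1, hm1⟩ := hIk.exists_isMinOn hIn (f := fun u => u.im) (by fun_prop)
    obtain ⟨u2, hu2, hm2⟩ := hIk.exists_isMinOn hIn (f := fun u => (G u).im)
      (Complex.continuous_im.comp_continuousOn (hc.mono hIH))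
    filter_upwards [eventually_ge_atTop T, (him lg).eventually (gt_mem_nhds (hIH hu1)),
      (him lg').eventually (gt_mem_nhds (hm _ (hIH hu2)))] with t ht h1 h2
    have f1 : ∀ u ∈ I, (g t).im < u.im := fun u hu => h1.trans_le (hm1 hu)
    have f2 : ∀ u ∈ I, (G (g t)).im < (G u).im := fun u hu => h2.trans_le (hm2 hu)
    have hvI : v ∈ I := right_mem_segment ℝ _ _
    have hpI : p ∈ I := left_mem_segment ℝ _ _
    have hg := hgK t ht
    refine ⟨ht, f1 v hvI, f2 v hvI, ?_⟩
    have g1 : ∀ u ∈ I, 0 < (u - g t).im := fun u hu => by rw [Complex.sub_im]; linarith [f1 u hu]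
    have g2 : ∀ u ∈ I, 0 < (G u - G (g t)).im := fun u hu => by rw [Complex.sub_im]; linarith [f2 u hu]
    have ne0 : ∀ {u : ℂ}, 0 < u.im → u ≠ 0 := fun {u} hu h => by rw [h] at hu; simp at hu
    have := clog_diff (convex_segment p v).isPreconnected (L₁ := fun u => W (g t, u))
      (L₂ := fun u => Complex.log (G u - G (g t)) - Complex.log (u - g t))
      (hWc.comp (by fun_prop) fun u hu => ⟨fun h : g t = u => by
        have := g1 u hu; rw [← h] at this; simp at this, hKH _ hg, hIH hu⟩)
      ((((hc.mono hIH).sub continuousOn_const).clog fun u hu => Or.inr (g2 u hu).ne').sub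
        (ContinuousOn.clog (by fun_prop) fun u hu => Or.inr (g1 u hu).ne')) (fun u hu => by
          rw [Complex.exp_sub, Complex.exp_log (ne0 (g2 u hu)), Complex.exp_log (ne0 (g1 u hu)),
            eq_div_iff (ne0 (g1 u hu)), hWe _ _ (fun h => by
              have := g1 u hu; rw [← h] at this; simp at this) (hKH _ hg) (hIH hu)]) hpI hvI
    have h3 := hk _ hg
    have g2p := g2 p hpI
    rw [hGp] at this g2p
    rw [clog_div_H g2p (g1 p hpI)] at h3
    linear_combination this + h3
  have yK : ∀ t, T ≤ t → y t ∈ K := fun t ht => Or.inl (Or.inl ⟨t, ht, rfl⟩)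
  have zK : ∀ t, T ≤ t → z t ∈ K := fun t ht => Or.inr ⟨t, ht, rfl⟩
  obtain ⟨t₁, ht₁, i1, i2, E1⟩ := (bdy ly ly' yK (z T) (hz T)).exists
  obtain ⟨t₂, ht₂, j1, j2, E2⟩ := (bdy lz lz' zK (y T) (hy T)).exists
  have yz : ∀ t s, T ≤ t → T ≤ s → y t ≠ z s := fun t s ht hs h => by
    have := (hT t ht).1
    have := (hT s hs).2.1
    rw [h] at *; linarith
  set Q : ℝ × ℝ → ℝ := fun r => (W (y r.1, z r.2) - k).im with hQ
  have hQc : ContinuousOn Q (Set.Ici T ×ˢ Set.Ici T) := by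
    apply Complex.continuous_im.comp_continuousOn
    exact (hWc.comp (by fun_prop) fun r hr => ⟨yz _ _ hr.1 hr.2, hy _, hz _⟩).sub continuousOn_const
  have hQ0 : ∀ r ∈ Set.Ici T ×ˢ Set.Ici T, Q r ≠ 0 := by
    rintro ⟨t, s⟩ ⟨ht, hs⟩ h0
    simp only at ht hs
    have h1 := hWe _ _ (yz t s ht hs) (hy t) (hz s)
    have h2 : Complex.exp (W (y t, z s)) = Complex.exp (W (y t, z s) - k) := by
      rw [Complex.exp_sub, hek, div_one]
    rw [h2] at h1
    have h3 := congrArg Complex.re h1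
    have h4 : W (y t, z s) - k = ((W (y t, z s) - k).re : ℂ) := Complex.ext (by simp) (by
      rw [Complex.ofReal_im]; exact h0)
    rw [h4, ← Complex.ofReal_exp, Complex.re_ofReal_mul, Complex.sub_re, Complex.sub_re] at h3
    have := (hT t ht).1
    have := (hT s hs).2.1
    have := (hT t ht).2.2.1
    have := (hT s hs).2.2.2.1
    have h5 := mul_pos (Real.exp_pos (W (y t, z s) - k).re) (show 0 < (z s).re - (y t).re by linarith)
    simp only [Complex.sub_re] at h3 h5
    linarith
  have P1 : 0 < Q (t₁, T) := by
    simp only [hQ]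
    rw [E1, add_sub_cancel_right, Complex.sub_im, Complex.log_im, Complex.log_im]
    have a1 : Real.pi / 2 < (G (z T) - G (y t₁)).arg := by
      rw [← not_le]
      intro h
      have := Complex.arg_le_pi_div_two_iff.1 h
      rw [Complex.sub_re, Complex.sub_im] at this
      have := (hT t₁ ht₁).2.2.1
      have := (hT T le_rfl).2.2.2.1
      rcases ‹_ ∨ _› with h | h <;> linarith
    have a2 : (z T - y t₁).arg ≤ Real.pi / 2 := by
      apply Complex.arg_le_pi_div_two_iff.2 (Or.inl _)
      rw [Complex.sub_re]
      have := (hT t₁ ht₁).1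
      have := (hT T le_rfl).2.1
      linarith
    linarith
  have P2 : Q (T, t₂) < 0 := by
    simp only [hQ]
    rw [hWs _ _ (yz T t₂ le_rfl ht₂) (hy _) (hz _), E2, add_sub_cancel_right, Complex.sub_im, Complex.log_im, Complex.log_im]
    have a1 : Real.pi / 2 < (y T - z t₂).arg := by
      rw [← not_le]
      intro h
      have := Complex.arg_le_pi_div_two_iff.1 h
      rw [Complex.sub_re, Complex.sub_im] at this
      have := (hT T le_rfl).1
      have := (hT t₂ ht₂).2.1
      rcases ‹_ ∨ _› with h | h <;> linarith
    have a2 : (G (y T) - G (z t₂)).arg ≤ Real.pi / 2 := by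
      apply Complex.arg_le_pi_div_two_iff.2 (Or.inl _)
      rw [Complex.sub_re]
      have := (hT T le_rfl).2.2.1
      have := (hT t₂ ht₂).2.2.2.1
      linarith
    linarith
  have hpc : IsPreconnected (Set.Ici T ×ˢ Set.Ici T) := isPreconnected_Ici.prod isPreconnected_Ici
  have hmem1 : (t₁, T) ∈ Set.Ici T ×ˢ Set.Ici T := ⟨ht₁, le_refl T⟩
  have hmem2 : (T, t₂) ∈ Set.Ici T ×ˢ Set.Ici T := ⟨le_refl T, ht₂⟩
  obtain ⟨r, hr, hr0⟩ := hpc.intermediate_value hmem2 hmem1 hQc (show (0:ℝ) ∈ Set.Icc _ _ from ⟨P2.le, P1.le⟩)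
  exact hQ0 r hr hr0

noncomputable def psi (ξ z : ℂ) : ℂ := Complex.I * (ξ + z) / (ξ - z)
noncomputable def psiR (ξ w : ℂ) : ℂ := ξ * (w - Complex.I) / (w + Complex.I)

theorem psi_coord {ξ : ℂ} (hξ : ‖ξ‖ = 1) : Coord (psi ξ) (psiR ξ) (Set.Ioi 0) := Coord.half hξ

def Aff (ξ : ℂ) (ν : BB ≃ₜ BB) (a b : ℝ) : Prop := 0 < a ∧ ∀ u : BB, psi ξ (ν u) = a * psi ξ u + b

theorem psi_inj {ξ : ℂ} (hξ : ‖ξ‖ = 1) {u v : BB} (e : psi ξ u = psi ξ v) : u = v := by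
  apply Subtype.ext
  rw [← (psi_coord hξ).RE u u.norm_lt, e, (psi_coord hξ).RE v v.norm_lt]

theorem psi_pos {ξ : ℂ} (hξ : ‖ξ‖ = 1) (u : BB) : 0 < (psi ξ u).im := (psi_coord hξ).mE u u.norm_lt

theorem psi_continuous {ξ : ℂ} (hξ : ‖ξ‖ = 1) : Continuous (fun u : BB => psi ξ u) :=
  continuousOn_iff_continuous_domRestrict.1 (psi_coord hξ).d.continuousOn

namespace Aff
variable {ξ : ℂ} {ν κ : BB ≃ₜ BB} {a b c d : ℝ}

theorem inv (h : Aff ξ ν a b) : Aff ξ ν⁻¹ (a⁻¹) (-b / a) := by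
  refine ⟨inv_pos.2 h.1, fun u => ?_⟩
  have h1 := h.2 (ν.symm u)
  rw [ν.apply_symm_apply] at h1
  have : (a:ℂ) ≠ 0 := by exact_mod_cast h.1.ne'
  change psi ξ (ν.symm u) = _
  rw [h1]; push_cast; field_simp; ring

theorem mul (h : Aff ξ ν a b) (h' : Aff ξ κ c d) : Aff ξ (ν * κ) (a * c) (a * d + b) := by
  refine ⟨mul_pos h.1 h'.1, fun u => ?_⟩
  change psi ξ (ν (κ u)) = _
  rw [h.2, h'.2]; push_cast; ring

theorem eq (hξ : ‖ξ‖ = 1) (h : Aff ξ ν a b) (h' : Aff ξ κ a b) : ν = κ :=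
  Homeomorph.ext fun u => psi_inj hξ ((h.2 u).trans (h'.2 u).symm)

theorem one : Aff ξ 1 1 0 := ⟨one_pos, fun u => by simp⟩
end Aff

open ComplexConjugate in
theorem MRep.aff {ν : BB ≃ₜ BB} {α β ξ : ℂ} (hr : MRep ν α β) (hξ : ‖ξ‖ = 1)
    (h0 : ξ * (conj β * ξ + conj α) = α * ξ + β) : ∃ a b, Aff ξ ν a b := by
  have hξξ : ξ * conj ξ = 1 := by rw [Complex.mul_conj, ← Complex.sq_norm, hξ]; simp
  have hξ0 : ξ ≠ 0 := by rintro rfl; simp at hξ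
  set m : ℝ := (α - ξ * conj β).re with hm
  have hmc : α - ξ * conj β = m := by
    have : conj (α - ξ * conj β) = α - ξ * conj β := by
      simp only [map_sub, map_mul, Complex.conj_conj]
      linear_combination conj ξ * h0 + (- conj α - conj β * ξ  + α) * hξξ
    exact (Complex.conj_eq_iff_re.1 this).symm
  set A : ℝ := α.re + (ξ * conj β).re with hA
  set B : ℝ := α.im + (ξ * conj β).im with hB
  have hAc : ξ * conj β + α + conj α + β * conj ξ = 2 * A := by
    have h1 : conj (ξ * conj β) = β * conj ξ := by simp [mul_comm]
    have h2 := Complex.add_conj α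
    have h3 := Complex.add_conj (ξ * conj β)
    rw [h1] at h3
    rw [hA]; push_cast at h2 h3 ⊢; linear_combination h2 + h3
  have hBc : conj α + β * conj ξ - ξ * conj β - α = - 2 * B * Complex.I := by
    have h1 : conj (ξ * conj β) = β * conj ξ := by simp [mul_comm]
    have h2 := Complex.sub_conj α
    have h3 := Complex.sub_conj (ξ * conj β)
    rw [h1] at h3
    rw [hB]; push_cast at h2 h3 ⊢; linear_combination -h2 - h3
  have n1 : ∀ z : ℂ, ‖z‖ < 1 → ξ - z ≠ 0 := fun z hz h => by
    rw [← sub_eq_zero.1 h] at hz; linarith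
  have f1 : ∀ u : BB, (ξ - ν u) * (conj β * u + conj α) = (ξ - u) * m := fun u => by
    rw [sub_mul, hr.2, ← hmc]; linear_combination h0
  have hm0 : (m:ℂ) ≠ 0 := by
    intro h
    have := f1 bo
    rw [h, mul_zero] at this
    exact mul_ne_zero (n1 _ (ν bo).norm_lt) (MRep.den_ne hr.1 bo.norm_lt.le) this
  have key : ∀ u : BB, psi ξ (ν u) = (A / m : ℝ) * psi ξ u + (B / m : ℝ) := by
    intro u
    have hu := n1 _ u.norm_lt
    have hnu := n1 _ (ν u).norm_lt
    have hD := MRep.den_ne hr.1 u.norm_lt.le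
    have f2 : (ξ + ν u) * (conj β * u + conj α) = (ξ + u) * A - (ξ - u) * (B * Complex.I) := by
      rw [add_mul, hr.2]
      linear_combination (ξ + u) / 2 * hAc + (ξ - u) / 2 * hBc - β * hξξ
    have f3 : psi ξ (ν u) = Complex.I * ((ξ + ν u) * (conj β * u + conj α)) / ((ξ - ν u) * (conj β * u + conj α)) := by
      unfold psi; field_simp
    rw [f3, f1, f2]
    unfold psi
    push_cast
    have hI := Complex.I_sq
    field_simp
    linear_combination (- (ξ - u) * B) * hI
  refine ⟨_, _, ?_, key⟩
  have h1 := congrArg Complex.im (key bo)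
  rw [Complex.add_im, Complex.ofReal_im, Complex.im_ofReal_mul, add_zero] at h1
  have h2 := psi_pos hξ bo
  have h3 := psi_pos hξ (ν bo)
  rw [h1] at h3
  exact pos_of_mul_pos_left h3 h2.le |> fun h => h

namespace Cov
variable {V : Set ℂ} {q : ℂ → ℂ} {ξ : ℂ}

theorem trans_discrete (h : Cov V q) (hξ : ‖ξ‖ = 1) : ∃ ε > 0, ∀ ν ∈ deck q, ∀ τ : ℝ, |τ| < ε →
    Aff ξ ν 1 τ → ν = 1 := by
  have hC := psi_coord hξ
  obtain ⟨r, hr, hdis⟩ := h.deck_discrete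
  have hE0 : (psi ξ 0).im ∈ Set.Ioi (0:ℝ) := hC.mE 0 (by simp)
  have hopen : IsOpen {w : ℂ | w.im ∈ Set.Ioi (0:ℝ)} := hC.o.preimage Complex.continuous_im
  have hcont : ContinuousAt (fun t : ℝ => ‖psiR ξ (psi ξ 0 + t)‖) 0 := by
    have h1 : ContinuousAt (psiR ξ) (psi ξ 0 + ((0:ℝ):ℂ)) := by
      simpa using hC.r.continuousOn.continuousAt (hopen.mem_nhds hE0)
    have h2 : ContinuousAt (fun t : ℝ => psi ξ 0 + (t:ℂ)) 0 := by fun_prop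
    exact (ContinuousAt.comp (f := fun t : ℝ => psi ξ 0 + (t:ℂ)) h1 h2).norm
  have hR0 : ‖psiR ξ (psi ξ 0 + ((0:ℝ):ℂ))‖ < r := by simpa [hC.RE 0 (by simp)] using hr
  obtain ⟨ε, hε, hεr⟩ := Metric.eventually_nhds_iff.1 (hcont.eventually (gt_mem_nhds hR0))
  refine ⟨ε, hε, fun ν hν τ hτ ha => hdis ν hν ?_⟩
  have h4 := hεr (y := τ) (by rw [Real.dist_eq, sub_zero]; exact hτ)
  have h6 := hC.RE _ (ν bo).norm_lt
  rw [ha.2, Complex.ofReal_one, one_mul] at h6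
  rw [← h6]; exact h4

theorem trans_triv (h : Cov V q) (hξ : ‖ξ‖ = 1) {κ ν : BB ≃ₜ BB} (hκ : κ ∈ deck q) (hν : ν ∈ deck q)
    {a b τ : ℝ} (ha : 1 < a) (hA : Aff ξ κ a b) (hT : Aff ξ ν 1 τ) : ν = 1 := by
  obtain ⟨ε, hε, hd⟩ := h.trans_discrete hξ
  have key : ∀ n : ℕ, ∀ ν ∈ deck q, ∀ τ : ℝ, |τ| < ε * a ^ n → Aff ξ ν 1 τ → ν = 1 := by
    intro n
    induction n with
    | zero => intro ν hν τ h1; rw [pow_zero, mul_one] at h1; exact hd ν hν τ h1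
    | succ n ih =>
      intro ν hν τ h1 hT
      have h2 : κ⁻¹ * ν * κ = 1 := by
        refine ih _ (mul_mem (mul_mem (inv_mem hκ) hν) hκ) (τ / a) ?_ ?_
        · rw [abs_div, abs_of_pos (show (0:ℝ) < a by linarith), div_lt_iff₀ (by linarith), mul_assoc, ← pow_succ]; exact h1
        · have := (hA.inv.mul hT).mul hA
          have ha0 : a ≠ 0 := by linarith
          convert this using 1
          · field_simp
          · field_simp; ring
      calc ν = κ * (κ⁻¹ * ν * κ) * κ⁻¹ := by group
        _ = 1 := by rw [h2]; group
  obtain ⟨n, hn⟩ := pow_unbounded_of_one_lt (|τ| / ε) ha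
  refine key n ν hν τ ?_ hT
  rw [div_lt_iff₀ hε] at hn; linarith

theorem aff_commute (h : Cov V q) (hξ : ‖ξ‖ = 1) {κ ν : BB ≃ₜ BB} (hκ : κ ∈ deck q) (hν : ν ∈ deck q)
    (hne : κ ≠ 1) {a b c d : ℝ} (hA : Aff ξ κ a b) (hA' : Aff ξ ν c d) : κ * ν = ν * κ := by
  have hC : Aff ξ (κ * ν * (ν * κ)⁻¹) 1 ((a * d + b) - (c * b + d)) := by
    have := (hA.mul hA').mul (hA'.mul hA).inv
    have h1 := hA.1.ne'
    have h2 := hA'.1.ne'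
    convert this using 1
    · field_simp
    · field_simp; ring
  have hCd : κ * ν * (ν * κ)⁻¹ ∈ deck q := mul_mem (mul_mem hκ hν) (inv_mem (mul_mem hν hκ))
  have fin : κ * ν * (ν * κ)⁻¹ = 1 → κ * ν = ν * κ := fun h => by
    rwa [mul_inv_eq_one] at h
  rcases lt_trichotomy a 1 with h1 | h1 | h1
  · exact fin (h.trans_triv hξ (inv_mem hκ) hCd ((one_lt_inv₀ hA.1).2 h1) hA.inv hC)
  · subst h1
    rcases lt_trichotomy c 1 with h2 | h2 | h2
    · exact absurd (h.trans_triv hξ (inv_mem hν) hκ ((one_lt_inv₀ hA'.1).2 h2) hA'.inv hA) hne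
    · subst h2
      refine (hA.mul hA').eq hξ ?_
      convert hA'.mul hA using 1
      ring
    · exact absurd (h.trans_triv hξ hν hκ h2 hA' hA) hne
  · exact fin (h.trans_triv hξ hκ hCd h1 hA hC)

theorem attr_aux (h : Cov V q) (hξ : ‖ξ‖ = 1) {κ : BB ≃ₜ BB} (hne : κ ≠ 1)
    {a b : ℝ} (hA : Aff ξ κ a b) (ha : 1 ≤ a) {x : ℝ → BB} (hx : Continuous x) (hκx : ∀ s, κ (x s) = x (s + 1)) :
    Tendsto (fun s => (x s : ℂ)) atTop (𝓝 ξ) ∧ Tendsto (fun s => ‖psi ξ (x s)‖) atTop atTop := by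
  have hP : Continuous (fun s => psi ξ (x s)) := (psi_continuous hξ).comp hx
  have hstep : ∀ s, psi ξ (x (s + 1)) = a * psi ξ (x s) + b := fun s => by rw [← hκx, hA.2]
  have hinf : Tendsto (fun s => ‖psi ξ (x s)‖) atTop atTop := by
    have hfl : ∀ s : ℝ, 0 ≤ s → ∃ r ∈ Set.Icc (0:ℝ) 1, s = r + (⌊s⌋₊:ℝ) := fun s hs =>
      ⟨s - ⌊s⌋₊, ⟨by linarith [Nat.floor_le hs], by linarith [Nat.lt_floor_add_one s]⟩, by ring⟩
    have hT : Tendsto (fun s : ℝ => (⌊s⌋₊ : ℝ)) atTop atTop :=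
      tendsto_natCast_atTop_atTop.comp tendsto_nat_floor_atTop
    rcases ha.lt_or_eq with ha | ha
    · obtain ⟨r0, hr0, hmin⟩ := isCompact_Icc.exists_isMinOn (Set.nonempty_Icc.2 (zero_le_one (α := ℝ)))
        (f := fun s => (psi ξ (x s)).im) (Complex.continuous_im.comp hP).continuousOn
      have hit : ∀ (n : ℕ) (s : ℝ), (psi ξ (x (s + n))).im = a ^ n * (psi ξ (x s)).im := by
        intro n s
        induction n with
        | zero => simp
        | succ n ih =>
          push_cast
          rw [← add_assoc, hstep, Complex.add_im, Complex.im_ofReal_mul, ih, Complex.ofReal_im]; ring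
      have hc := psi_pos hξ (x r0)
      have h1 : Tendsto (fun s : ℝ => a ^ ⌊s⌋₊ * (psi ξ (x r0)).im) atTop atTop :=
        ((tendsto_pow_atTop_atTop_of_one_lt ha).comp tendsto_nat_floor_atTop).atTop_mul_const hc
      refine tendsto_atTop_mono' _ ?_ h1
      filter_upwards [eventually_ge_atTop 0] with s hs
      obtain ⟨r, hr, e⟩ := hfl s hs
      have h2 := hit ⌊s⌋₊ r
      rw [← e] at h2
      refine le_trans ?_ ((le_abs_self _).trans (Complex.abs_im_le_norm _))
      rw [h2]
      exact mul_le_mul_of_nonneg_left (hmin hr) (by positivity)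
    · have hb : b ≠ 0 := by
        rintro rfl
        exact hne (hA.eq hξ (ha ▸ Aff.one))
      obtain ⟨C, hC⟩ := (isCompact_Icc.image hP : IsCompact ((fun s => psi ξ (x s)) '' Set.Icc 0 1)).isBounded.exists_norm_le
      have hit : ∀ (n : ℕ) (s : ℝ), psi ξ (x (s + n)) = psi ξ (x s) + n * b := by
        intro n s
        induction n with
        | zero => simp
        | succ n ih =>
          push_cast
          rw [← add_assoc, hstep, ih, ← ha]; push_cast; ring
      have h1 : Tendsto (fun s : ℝ => (⌊s⌋₊:ℝ) * |b| + (-C)) atTop atTop :=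
        tendsto_atTop_add_const_right _ _ (hT.atTop_mul_const (abs_pos.2 hb))
      refine tendsto_atTop_mono' _ ?_ h1
      filter_upwards [eventually_ge_atTop 0] with s hs
      obtain ⟨r, hr, e⟩ := hfl s hs
      have h2 := hit ⌊s⌋₊ r
      rw [← e] at h2
      rw [h2]
      have h3 := hC _ ⟨r, hr, rfl⟩
      have h4 := norm_sub_le (psi ξ (x r) + (⌊s⌋₊:ℂ) * b) (psi ξ (x r))
      rw [add_sub_cancel_left, norm_mul, Complex.norm_natCast, Complex.norm_real, Real.norm_eq_abs] at h4
      simp only at h3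
      linarith
  refine ⟨?_, hinf⟩
  have h1 : ∀ s, (x s : ℂ) = ξ - 2 * Complex.I * ξ / (psi ξ (x s) + Complex.I) := by
    intro s
    have hp := psi_pos hξ (x s)
    have hne : psi ξ (x s) + Complex.I ≠ 0 := fun h => by
      have := congrArg Complex.im h
      simp at this; linarith
    have := (psi_coord hξ).RE _ (x s).norm_lt
    rw [psiR] at this
    rw [div_eq_iff hne] at this
    rw [eq_sub_iff_add_eq, ← eq_sub_iff_add_eq', div_eq_iff hne]
    linear_combination -this
  have h2 : Tendsto (fun s => 2 * Complex.I * ξ / (psi ξ (x s) + Complex.I)) atTop (𝓝 0) := by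
    have h3 : Tendsto (fun s => ‖psi ξ (x s) + Complex.I‖) atTop atTop := by
      refine tendsto_atTop_mono (fun s => ?_) (tendsto_atTop_add_const_right _ (-1) hinf)
      have := norm_sub_le (psi ξ (x s) + Complex.I) Complex.I
      rw [add_sub_cancel_right, Complex.norm_I] at this
      linarith
    refine tendsto_zero_iff_norm_tendsto_zero.2 ?_
    simp only [norm_div]
    exact Tendsto.const_div_atTop h3 _
  have h3 := (tendsto_const_nhds (x := ξ)).sub h2
  rw [sub_zero] at h3
  exact h3.congr fun s => (h1 s).symm

open ComplexConjugate in
theorem exists_root (h : Cov V q) {l : BB ≃ₜ BB} (hl : l ∈ deck q) (hne : l ≠ 1) :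
    ∃ ξ : ℂ, ‖ξ‖ = 1 ∧ ∃ a b, Aff ξ l a b := by
  obtain ⟨α, β, hr⟩ := h.exists_rep hl
  have hb := h.rep_ne hl hne hr
  have hcb : conj β ≠ 0 := by simpa using hb
  have root_norm : ∀ ξ : ℂ, conj β * ξ ^ 2 + (conj α - α) * ξ - β = 0 → 1 ≤ ‖ξ‖ := by
    intro ξ h0
    by_contra hlt
    push Not at hlt
    set u : BB := ⟨ξ, mem_ball_zero_iff.2 hlt⟩
    apply hne
    apply h.deck_free hl (a := u)
    apply Subtype.ext
    have h1 := hr.2 u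
    apply mul_right_cancel₀ (MRep.den_ne hr.1 (z := u) u.norm_lt.le)
    rw [h1]
    change α * ξ + β = ξ * (conj β * ξ + conj α)
    linear_combination -h0
  obtain ⟨d, hd⟩ : ∃ d : ℂ, d ^ 2 = (conj α - α) ^ 2 + 4 * conj β * β :=
    IsAlgClosed.exists_pow_nat_eq _ (by norm_num)
  obtain ⟨ξ, hξ⟩ : ∃ ξ : ℂ, ξ = (-(conj α - α) + d) / (2 * conj β) := ⟨_, rfl⟩
  have h0 : conj β * ξ ^ 2 + (conj α - α) * ξ - β = 0 := by
    rw [hξ]; field_simp; linear_combination hd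
  have hξ1 : 1 ≤ ‖ξ‖ := root_norm ξ h0
  have hξ0 : ξ ≠ 0 := by rintro rfl; simp at hξ1; linarith
  have hξ2 : ‖ξ‖ = 1 := by
    have := root_norm (-β / (conj β * ξ)) (by field_simp; linear_combination (-β) * h0)
    rw [norm_div, norm_neg, norm_mul, Complex.norm_conj] at this
    have hbn : ‖β‖ ≠ 0 := by simpa using hb
    have e : ‖β‖ / (‖β‖ * ‖ξ‖) = ‖ξ‖⁻¹ := by field_simp
    rw [e] at this
    have : ‖ξ‖ ≤ 1 := (one_le_inv₀ (by linarith)).1 this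
    linarith
  exact ⟨ξ, hξ2, hr.aff hξ2 (by linear_combination h0)⟩
end Cov

open ComplexConjugate in
theorem MRep.bdry {ν : BB ≃ₜ BB} {α β ξ : ℂ} (hr : MRep ν α β) (hξ : ‖ξ‖ = 1) {y : ℝ → BB}
    (hy : Tendsto (fun s => (y s : ℂ)) atTop (𝓝 ξ)) :
    ∃ ζ : ℂ, ‖ζ‖ = 1 ∧ ζ * (conj β * ξ + conj α) = α * ξ + β ∧
      Tendsto (fun s => (ν (y s) : ℂ)) atTop (𝓝 ζ) := by
  have hD := MRep.den_ne hr.1 hξ.le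
  refine ⟨(α * ξ + β) / (conj β * ξ + conj α), ?_, div_mul_cancel₀ _ hD, ?_⟩
  · have hξξ : ξ * conj ξ = 1 := by rw [Complex.mul_conj, ← Complex.sq_norm, hξ]; simp
    have e : α * ξ + β = ξ * conj (conj β * ξ + conj α) := by
      simp only [map_add, map_mul, Complex.conj_conj]; linear_combination (-β) * hξξ
    rw [norm_div, e, norm_mul, Complex.norm_conj, hξ, one_mul]
    exact div_self (norm_ne_zero_iff.2 hD)
  · have h1 : ∀ s, (ν (y s) : ℂ) = (α * y s + β) / (conj β * y s + conj α) := fun s => by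
      rw [eq_div_iff (MRep.den_ne hr.1 (y s).norm_lt.le), hr.2]
    simp only [h1]
    exact ((hy.const_mul α).add_const β).div ((hy.const_mul (conj β)).add_const (conj α)) hD

open ComplexConjugate in
theorem psi_real {ξ ζ : ℂ} (hξ : ‖ξ‖ = 1) (hζ : ‖ζ‖ = 1) : ∃ e : ℝ, psi ξ ζ = e := by
  have hξξ : ξ * conj ξ = 1 := by rw [Complex.mul_conj, ← Complex.sq_norm, hξ]; simp
  have hζζ : ζ * conj ζ = 1 := by rw [Complex.mul_conj, ← Complex.sq_norm, hζ]; simp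
  by_cases hne : ξ - ζ = 0
  · exact ⟨0, by simp [psi, hne]⟩
  refine ⟨(psi ξ ζ).re, (Complex.conj_eq_iff_re.1 ?_).symm⟩
  have hne' : conj ξ - conj ζ ≠ 0 := by
    rw [← map_sub]; exact (map_ne_zero _).2 hne
  simp only [psi, map_div₀, map_mul, map_add, map_sub, Complex.conj_I]
  rw [div_eq_div_iff hne' hne]
  linear_combination (-2 * Complex.I) * hξξ + 2 * Complex.I * hζζ

namespace Cov
variable {V : Set ℂ} {q : ℂ → ℂ} {ξ : ℂ}

theorem bd_comm (h : Cov V q) (hξ : ‖ξ‖ = 1) {κ ν : BB ≃ₜ BB} (hκ : κ ∈ deck q) (hν : ν ∈ deck q)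
    (hne : κ ≠ 1) {a b : ℝ} (hA : Aff ξ κ a b) {x : ℝ → BB} (hx : Tendsto (fun s => (x s : ℂ)) atTop (𝓝 ξ))
    (hνx : Tendsto (fun s => (ν (x s) : ℂ)) atTop (𝓝 ξ)) : κ * ν = ν * κ := by
  obtain ⟨α, β, hr⟩ := h.exists_rep hν
  obtain ⟨ζ, hζ, h1, h2⟩ := hr.bdry hξ hx
  obtain rfl := tendsto_nhds_unique hνx h2
  obtain ⟨c, d, hA'⟩ := hr.aff hξ h1
  exact h.aff_commute hξ hκ hν hne hA hA'

theorem bd_eq (h : Cov V q) (hξ : ‖ξ‖ = 1) {κ ν ν' : BB ≃ₜ BB} (hκ : κ ∈ deck q) (hν : ν ∈ deck q)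
    (hν' : ν' ∈ deck q)
    (hne : κ ≠ 1) {a b : ℝ} (hA : Aff ξ κ a b) {x : ℝ → BB} (hx : Tendsto (fun s => (x s : ℂ)) atTop (𝓝 ξ))
    {ζ : ℂ} (hζ : ‖ζ‖ = 1) (hνx : Tendsto (fun s => (ν (x s) : ℂ)) atTop (𝓝 ζ))
    (hνx' : Tendsto (fun s => (ν' (x s) : ℂ)) atTop (𝓝 ζ)) : κ * (ν⁻¹ * ν') = (ν⁻¹ * ν') * κ := by
  obtain ⟨α, β, hr⟩ := h.exists_rep (inv_mem hν)
  obtain ⟨ζ1, _, h1, h2⟩ := hr.bdry hζ hνx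
  obtain ⟨ζ2, _, h3, h4⟩ := hr.bdry hζ hνx'
  have e : ζ1 = ζ2 := mul_right_cancel₀ (MRep.den_ne hr.1 hζ.le) (h1.trans h3.symm)
  have e1 : ζ1 = ξ := by
    refine tendsto_nhds_unique h2 (hx.congr fun s => ?_)
    change _ = ((ν.symm (ν (x s)) : BB) : ℂ)
    rw [ν.symm_apply_apply]
  exact h.bd_comm hξ hκ (mul_mem (inv_mem hν) hν') hne hA hx (by rw [← e1, e]; exact h4)

theorem conj_aux (h : Cov V q) (hξ : ‖ξ‖ = 1) {κ F : BB ≃ₜ BB} (hκ : κ ∈ deck q) (hne : κ ≠ 1)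
    {a b : ℝ} (hA : Aff ξ κ a b) (ha : 1 ≤ a) {x : ℝ → BB} (hx : Continuous x) (hκx : ∀ s, κ (x s) = x (s + 1))
    (hF : ∀ ν ∈ deck q, F * ν * F⁻¹ ∈ deck q) (hFx : ∀ s, F (x s) = x s) (hFκ : F * κ * F⁻¹ = κ)
    {u₀ : BB} (hu₀ : ∀ᶠ u in 𝓝 u₀, F u = u)
    (hfin : ∀ ν ∈ deck q, ∃ n : ℕ, 1 ≤ n ∧ F ^ n * ν * (F ^ n)⁻¹ = ν) {ν : BB ≃ₜ BB} (hν : ν ∈ deck q) :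
    κ * (ν⁻¹ * (F * ν * F⁻¹)) = (ν⁻¹ * (F * ν * F⁻¹)) * κ := by
  obtain ⟨hxξ, hxinf⟩ := h.attr_aux hξ hne hA ha hx hκx
  have hFinv : ∀ s, F⁻¹ (x s) = x s := fun s => by
    have := F.symm_apply_apply (x s); rw [hFx] at this; exact this
  -- the commuting case
  by_cases hc : κ * ν = ν * κ
  · have h1 : κ * (F * ν * F⁻¹) = (F * ν * F⁻¹) * κ := by
      calc κ * (F * ν * F⁻¹) = (F * κ * F⁻¹) * (F * ν * F⁻¹) := by rw [hFκ]
        _ = F * (κ * ν) * F⁻¹ := by group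
        _ = F * (ν * κ) * F⁻¹ := by rw [hc]
        _ = (F * ν * F⁻¹) * (F * κ * F⁻¹) := by group
        _ = _ := by rw [hFκ]
    exact ((show Commute κ ν from hc).inv_right.mul_right (show Commute κ _ from h1))
  set N : ℕ → (BB ≃ₜ BB) := fun i => F ^ i * ν * (F ^ i)⁻¹ with hN
  have N0 : N 0 = ν := by simp [hN]
  have Ns : ∀ i, N (i + 1) = F * N i * F⁻¹ := fun i => by simp only [hN, pow_succ']; group
  have Nd : ∀ i, N i ∈ deck q := by
    intro i
    induction i with
    | zero => rw [N0]; exact hν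
    | succ i ih => rw [Ns]; exact hF _ ih
  have Nc : ∀ i, κ * N i ≠ N i * κ := by
    intro i
    induction i with
    | zero => rw [N0]; exact hc
    | succ i ih =>
      rw [Ns]; intro h1; apply ih
      calc κ * N i = F⁻¹ * ((F * κ * F⁻¹) * (F * N i * F⁻¹)) * F := by group
        _ = F⁻¹ * ((F * N i * F⁻¹) * (F * κ * F⁻¹)) * F := by rw [hFκ, h1]
        _ = _ := by group
  -- boundary values
  have hbv : ∀ i, ∃ e : ℝ, ∃ ζ : ℂ, ‖ζ‖ = 1 ∧ psi ξ ζ = e ∧ ζ = psiR ξ e ∧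
      Tendsto (fun s => (N i (x s) : ℂ)) atTop (𝓝 ζ) ∧ Tendsto (fun s => psi ξ (N i (x s))) atTop (𝓝 e) := by
    intro i
    obtain ⟨α, β, hr⟩ := h.exists_rep (Nd i)
    obtain ⟨ζ, hζ, h1, h2⟩ := hr.bdry hξ hxξ
    obtain ⟨e, he⟩ := psi_real hξ hζ
    have hζξ : ξ - ζ ≠ 0 := fun h0 => by
      obtain rfl := sub_eq_zero.1 h0
      exact Nc i (h.bd_comm hξ hκ (Nd i) hne hA hxξ h2)
    have hξ0 : ξ ≠ 0 := by rintro rfl; simp at hξ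
    refine ⟨e, ζ, hζ, he, ?_, h2, ?_⟩
    · rw [← he, psi, psiR]
      have : Complex.I * (ξ + ζ) / (ξ - ζ) + Complex.I = 2 * Complex.I * ξ / (ξ - ζ) := by field_simp; ring
      rw [this]
      field_simp
      ring
    · rw [← he]
      exact (tendsto_const_nhds.mul (tendsto_const_nhds.add h2)).div (tendsto_const_nhds.sub h2) hζξ
  choose e ζ hζ1 hζe hζe' hNζ hNe using hbv
  -- e determines commutation
  have heq : ∀ i j, e i = e j → κ * ((N i)⁻¹ * N j) = ((N i)⁻¹ * N j) * κ := by
    intro i j hij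
    refine h.bd_eq hξ hκ (Nd i) (Nd j) hne hA hxξ (hζ1 i) (hNζ i) ?_
    rw [hζe' i, hij, ← hζe' j]; exact hNζ j
  have heq' : ∀ i j, κ * ((N i)⁻¹ * N j) = ((N i)⁻¹ * N j) * κ → e i = e j := by
    intro i j hij
    obtain ⟨α, β, hr⟩ := h.exists_rep (Nd i)
    obtain ⟨h1, _⟩ := h.attr_aux (x := fun s => ((N i)⁻¹ * N j) (x s)) hξ hne hA ha
      (((N i)⁻¹ * N j).continuous.comp hx) (fun s => by
        have := congrArg (fun g : BB ≃ₜ BB => g (x s)) hij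
        rw [← hκx]; exact this)
    obtain ⟨ζ1, _, h3, h4⟩ := hr.bdry hξ hxξ
    obtain ⟨ζ2, _, h5, h6⟩ := hr.bdry hξ h1
    have e12 : ζ1 = ζ2 := mul_right_cancel₀ (MRep.den_ne hr.1 hξ.le) (h3.trans h5.symm)
    have e1 : ζ1 = ζ i := tendsto_nhds_unique h4 (hNζ i)
    have e2 : ζ2 = ζ j := by
      refine tendsto_nhds_unique h6 ((hNζ j).congr fun s => ?_)
      change _ = ((N i ((N i).symm (N j (x s))) : BB) : ℂ)
      rw [(N i).apply_symm_apply]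
    have : (e i : ℂ) = e j := by rw [← hζe, ← hζe, ← e1, ← e2, e12]
    exact_mod_cast this
  have heqs : ∀ i, e i = e (i + 1) → e (i + 1) = e (i + 1 + 1) := by
    intro i hi
    apply heq'
    have h1 := heq _ _ hi
    calc κ * ((N (i+1))⁻¹ * N (i+1+1)) = (F * κ * F⁻¹) * ((F * N i * F⁻¹)⁻¹ * (F * N (i+1) * F⁻¹)) := by
          rw [hFκ, Ns (i+1), ← Ns i]
      _ = F * (κ * ((N i)⁻¹ * N (i+1))) * F⁻¹ := by group
      _ = F * (((N i)⁻¹ * N (i+1)) * κ) * F⁻¹ := by rw [h1]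
      _ = ((F * N i * F⁻¹)⁻¹ * (F * N (i+1) * F⁻¹)) * (F * κ * F⁻¹) := by group
      _ = _ := by rw [hFκ, Ns (i+1), ← Ns i]
  -- order
  have hord : ∀ i j, e i < e j → ¬ e (j + 1) < e (i + 1) := by
    intro i j hij
    classical
    have hC := psi_coord hξ
    have hopen : IsOpen {w : ℂ | 0 < w.im} := isOpen_lt continuous_const Complex.continuous_im
    set P : {w : ℂ | 0 < w.im} → BB := fun w => ⟨psiR ξ w, mem_ball_zero_iff.2 (hC.mR _ w.2)⟩ with hP
    have hPc : Continuous P := Continuous.subtype_mk (continuousOn_iff_continuous_domRestrict.1 hC.r.continuousOn) _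
    have hPpsi : ∀ w : {w : ℂ | 0 < w.im}, psi ξ (P w) = w := fun w => hC.ER _ w.2
    have hpsiP : ∀ u : BB, P ⟨psi ξ u, psi_pos hξ u⟩ = u := fun u => psi_inj hξ (hPpsi _)
    set G : ℂ → ℂ := fun w => if hw : 0 < w.im then psi ξ (F (P ⟨w, hw⟩)) else 0 with hG
    have hG1 : ∀ u : BB, G (psi ξ u) = psi ξ (F u) := fun u => by
      rw [hG]; simp only; rw [dif_pos (psi_pos hξ u), hpsiP]
    have hG2 : ∀ w : {w : ℂ | 0 < w.im}, G w = psi ξ (F (P w)) := fun w => by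
      have := hG1 (P w); rwa [hPpsi] at this
    have hG3 : ∀ i s, G (psi ξ (N i (x s))) = psi ξ (N (i + 1) (x s)) := fun i s => by
      rw [hG1, Ns]
      change _ = psi ξ (F (N i (F⁻¹ (x s))))
      rw [hFinv]
    refine order_H (G := G) ?_ ?_ ?_ (x₀ := psi ξ u₀) (psi_pos hξ u₀) ?_ ?_ (y := fun s => psi ξ (N i (x s)))
      (z := fun s => psi ξ (N j (x s)))
      ((psi_continuous hξ).comp ((N i).continuous.comp hx)) ((psi_continuous hξ).comp ((N j).continuous.comp hx))
      (fun s => psi_pos hξ _) (fun s => psi_pos hξ _) (hNe i) (hNe j) ?_ ?_ hij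
    · rw [continuousOn_iff_continuous_domRestrict]
      refine ((psi_continuous hξ).comp (F.continuous.comp hPc)).congr fun w => ?_
      exact (hG2 w).symm
    · intro w hw
      rw [hG2 ⟨w, hw⟩]; exact psi_pos hξ _
    · intro w w' hw hw' hww
      rw [hG2 ⟨w, hw⟩, hG2 ⟨w', hw'⟩] at hww
      have h1 := F.injective (psi_inj hξ hww)
      have h2 := hPpsi ⟨w, hw⟩
      rw [h1, hPpsi] at h2
      exact h2.symm
    · have h1 : ContinuousAt P ⟨psi ξ u₀, psi_pos hξ u₀⟩ := hPc.continuousAt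
      have h2 : ∀ᶠ w in 𝓝 (⟨psi ξ u₀, psi_pos hξ u₀⟩ : {w : ℂ | 0 < w.im}), F (P w) = P w :=
        h1.eventually (by rw [hpsiP]; exact hu₀)
      rw [nhds_subtype_eq_comap, eventually_comap] at h2
      filter_upwards [h2, hopen.mem_nhds (psi_pos hξ u₀)] with w hw hw0
      rw [hG2 ⟨w, hw0⟩, hw ⟨w, hw0⟩ rfl, hPpsi]
    · intro B
      obtain ⟨s, hs⟩ := (hxinf.eventually_ge_atTop B).exists
      exact ⟨_, psi_pos hξ (x s), by rw [hG1, hFx], hs⟩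
    · simp only [hG3]; exact hNe (i + 1)
    · simp only [hG3]; exact hNe (j + 1)
  obtain ⟨n, hn1, hn⟩ := hfin ν hν
  have hen : e n = e 0 := by
    apply heq'
    have : N n = N 0 := by rw [N0]; exact hn
    rw [this]; group
  have h01 : e 0 = e 1 := by
    obtain ⟨m, rfl⟩ : ∃ m, n = m + 1 := ⟨n - 1, by omega⟩
    rcases lt_trichotomy (e 0) (e 1) with hlt | hlt | hlt
    · exfalso
      have hmono : ∀ i, e i ≤ e (i + 1) := by
        intro i
        induction i with
        | zero => exact hlt.le
        | succ i ih =>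
          rcases ih.lt_or_eq with ih | ih
          · exact not_lt.1 (hord _ _ ih)
          · exact (heqs i ih).le
      have := monotone_nat_of_le_succ hmono (show 1 ≤ m + 1 by omega)
      linarith
    · exact hlt
    · exfalso
      have hmono : ∀ i, e (i + 1) ≤ e i := by
        intro i
        induction i with
        | zero => exact hlt.le
        | succ i ih =>
          rcases ih.lt_or_eq with ih | ih
          · exact not_lt.1 (hord _ _ ih)
          · exact (heqs i ih.symm).ge
      have := antitone_nat_of_succ_le hmono (show 1 ≤ m + 1 by omega)
      linarith
  have := heq 0 1 h01
  rw [N0, show (1:ℕ) = 0 + 1 from rfl, Ns, N0] at this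
  exact this

theorem conj_comm (h : Cov V q) {κ F : BB ≃ₜ BB} (hκ : κ ∈ deck q) (hne : κ ≠ 1)
    {x : ℝ → BB} (hx : Continuous x) (hκx : ∀ s, κ (x s) = x (s + 1))
    (hF : ∀ ν ∈ deck q, F * ν * F⁻¹ ∈ deck q) (hFx : ∀ s, F (x s) = x s) (hFκ : F * κ * F⁻¹ = κ)
    {u₀ : BB} (hu₀ : ∀ᶠ u in 𝓝 u₀, F u = u)
    (hfin : ∀ ν ∈ deck q, ∃ n : ℕ, 1 ≤ n ∧ F ^ n * ν * (F ^ n)⁻¹ = ν) {ν : BB ≃ₜ BB} (hν : ν ∈ deck q) :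
    κ * (ν⁻¹ * (F * ν * F⁻¹)) = (ν⁻¹ * (F * ν * F⁻¹)) * κ := by
  obtain ⟨ξ, hξ, a, b, hA⟩ := h.exists_root hκ hne
  rcases le_or_gt 1 a with ha | ha
  · exact h.conj_aux hξ hκ hne hA ha hx hκx hF hFx hFκ hu₀ hfin hν
  · have := h.conj_aux (x := fun s => x (-s)) hξ (inv_mem hκ) (inv_ne_one.2 hne) hA.inv
      ((one_lt_inv₀ hA.1).2 ha).le (hx.comp continuous_neg) (fun s => by
        change κ.symm _ = _
        rw [Homeomorph.symm_apply_eq, hκx]; congr 1; ring) hF (fun s => hFx _)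
      (by nth_rewrite 2 [← hFκ]; group) hu₀ hfin hν
    have h1 : Commute κ⁻¹ (ν⁻¹ * (F * ν * F⁻¹)) := this
    exact Commute.inv_left_iff.1 h1
end Cov

namespace Cov
variable {V : Set ℂ} {q : ℂ → ℂ}

theorem tendsto_aux (h : Cov V q) {Ψ : ℕ → BB → BB} {g : ℕ → ℂ → ℂ} (hΨ : ∀ᶠ k in atTop, Continuous (Ψ k))
    (hg : ∀ k, Continuous (g k)) (hid : ∀ ε > 0, ∀ᶠ k in atTop, ∀ y, dist (g k y) y < ε)
    (hq : ∀ᶠ k in atTop, ∀ u, q (Ψ k u) = g k (q u)) (a : BB) :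
    ∃ U : Set BB, IsOpen U ∧ a ∈ U ∧ ∀ c ∈ U, Tendsto (fun k => Ψ k c) atTop (𝓝 c) →
      ∀ d ∈ U, Tendsto (fun k => Ψ k d) atTop (𝓝 d) := by
  obtain ⟨r, hr, hb⟩ := Metric.isOpen_iff.1 h.o _ (h.m a)
  obtain ⟨σ, hd, hm, hs, h1⟩ := h.s _ r hb a a.2 (mem_ball_self hr)
  have hsub : ball (q a) (r / 2) ⊆ ball (q a) r := ball_subset_ball (by linarith)
  set T : ball (q a) (r/2) → BB := fun y => ⟨σ y, hm _ (hsub y.2)⟩ with hT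
  have hTc : Continuous T := Continuous.subtype_mk
    (continuousOn_iff_continuous_domRestrict.1 (hd.continuousOn.mono hsub)) _
  refine ⟨Subtype.val ⁻¹' (σ '' ball (q a) (r / 2)), (sec_open (hd.mono hsub)
    (fun y hy => hs y (hsub hy))).preimage continuous_subtype_val, ⟨_, mem_ball_self (by linarith), h1⟩, ?_⟩
  rintro c ⟨y, hy, ec⟩ hct d ⟨z, hz, ed⟩
  have hc1 : ∀ᶠ k in atTop, (Ψ k c : ℂ) ∈ σ '' ball (q a) r := by
    have h2 := (continuous_subtype_val.tendsto c).comp hct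
    exact h2.eventually ((sec_open hd hs).mem_nhds ⟨y, hsub hy, ec⟩)
  have key : ∀ᶠ k in atTop, (Ψ k d : ℂ) = σ (g k z) := by
    filter_upwards [hc1, hid (r/2) (by linarith), hΨ, hq] with k hk hk2 hΨk hqk
    have hgb : ∀ w ∈ ball (q a) (r/2), g k w ∈ ball (q a) r := fun w hw => by
      rw [mem_ball] at hw ⊢
      have := dist_triangle (g k w) w (q a)
      have := hk2 w
      linarith
    have hpre : PreconnectedSpace (ball (q a) (r/2)) :=
      isPreconnected_iff_preconnectedSpace.1 (convex_ball (q a) (r/2)).isPreconnected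
    have hu := h.uniq (A := ball (q a) (r/2)) (G := fun w => Ψ k (T w))
      (G' := fun w => ⟨σ (g k w), hm _ (hgb w w.2)⟩) (hΨk.comp hTc)
      (Continuous.subtype_mk (hd.continuousOn.comp_continuous (f := fun w : ball (q a) (r/2) => g k w) ((hg k).comp continuous_subtype_val)
        (fun w => hgb w w.2)) _)
      (fun w => by
        rw [hqk, hT]; simp only
        rw [hs _ (hsub w.2), hs _ (hgb w w.2)]) (a := ⟨y, hy⟩) (by
        have e : T ⟨y, hy⟩ = c := Subtype.ext ec
        apply Subtype.ext
        simp only [e]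
        obtain ⟨w, hw, ew⟩ := hk
        have h3 := hqk c
        rw [← ew, hs w hw, ← ec, hs y (hsub hy)] at h3
        rw [← ew, h3])
    have h4 := congrFun hu ⟨z, hz⟩
    have e : T ⟨z, hz⟩ = d := Subtype.ext ed
    simp only [e] at h4
    exact congrArg Subtype.val h4
  rw [tendsto_subtype_rng]
  have hgz : Tendsto (fun k => g k z) atTop (𝓝 z) := by
    rw [Metric.tendsto_atTop]
    intro ε hε
    exact eventually_atTop.1 ((hid ε hε).mono fun k hk => hk z)
  have h5 := (hd.continuousOn.continuousAt (isOpen_ball.mem_nhds (hsub hz))).tendsto.comp hgz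
  rw [ed] at h5
  exact h5.congr' (key.mono fun k hk => hk.symm)

theorem lift_tendsto (h : Cov V q) {Ψ : ℕ → BB → BB} {g : ℕ → ℂ → ℂ} (hΨ : ∀ᶠ k in atTop, Continuous (Ψ k))
    (hg : ∀ k, Continuous (g k)) (hid : ∀ ε > 0, ∀ᶠ k in atTop, ∀ y, dist (g k y) y < ε)
    (hq : ∀ᶠ k in atTop, ∀ u, q (Ψ k u) = g k (q u)) (h0 : Tendsto (fun k => Ψ k bo) atTop (𝓝 bo)) (a : BB) :
    Tendsto (fun k => Ψ k a) atTop (𝓝 a) := by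
  have hcl : IsClopen {a | Tendsto (fun k => Ψ k a) atTop (𝓝 a)} := by
    constructor
    · rw [← isOpen_compl_iff, isOpen_iff_mem_nhds]
      intro a ha
      obtain ⟨U, hU, haU, hH⟩ := h.tendsto_aux hΨ hg hid hq a
      filter_upwards [hU.mem_nhds haU] with c hc hct
      exact ha (hH c hc hct a haU)
    · rw [isOpen_iff_mem_nhds]
      intro a ha
      obtain ⟨U, hU, haU, hH⟩ := h.tendsto_aux hΨ hg hid hq a
      filter_upwards [hU.mem_nhds haU] with c hc
      exact hH a haU ha c hc
  have : a ∈ {a | Tendsto (fun k => Ψ k a) atTop (𝓝 a)} := by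
    rw [hcl.eq_univ ⟨bo, h0⟩]; trivial
  exact this

theorem conj_mem {f : ℂ ≃ₜ ℂ} {F : BB ≃ₜ BB} (hF : ∀ u, q (F u) = f (q u))
    {ν : BB ≃ₜ BB} (hν : ν ∈ deck q) : F * ν * F⁻¹ ∈ deck q := by
  intro u
  change q (F (ν (F.symm u))) = q u
  rw [hF, hν, ← hF, F.apply_symm_apply]

/-- Deck transformations close at `bo` are equal. -/
theorem deck_eq_of_tendsto (h : Cov V q) {ν : ℕ → (BB ≃ₜ BB)} {μ : BB ≃ₜ BB} (hμ : μ ∈ deck q)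
    (hν : ∀ᶠ k in atTop, ν k ∈ deck q) {a : BB} (ht : Tendsto (fun k => ν k a) atTop (𝓝 (μ a))) :
    ∀ᶠ k in atTop, ν k = μ := by
  obtain ⟨U, hU, hu, hi⟩ := h.locInj (μ a)
  filter_upwards [hν, ht.eventually (hU.mem_nhds hu)] with k hk hk2
  exact h.homeo_ext (fun u => by rw [hk u, hμ u]) (hi hk2 hu (by simp only; rw [hk, hμ]))

theorem wind (_h : Cov V q) {p : ℂ} {L : BB → ℂ} (hL : Continuous L) (he : ∀ u, Complex.exp (L u) = q u - p)
    {ν : BB ≃ₜ BB} (hν : ν ∈ deck q) (u v : BB) : L (ν u) - L u = L (ν v) - L v := by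
  have := clog_diff (A := BB) isPreconnected_univ (L₁ := fun u => L (ν u)) (L₂ := L)
    (hL.comp ν.continuous).continuousOn hL.continuousOn (fun a _ => by rw [he, he, hν]) (a := v) (b := u)
    trivial trivial
  linear_combination this

theorem exists_L (h : Cov V q) {p : ℂ} (hp : p ∉ V) : ∃ L : BB → ℂ, Continuous L ∧ ∀ u, Complex.exp (L u) = q u - p :=
  exists_clog (h.cont.sub continuous_const) (fun u e => hp (by rw [← sub_eq_zero.1 e]; exact h.m u))

/-- From commutation to triviality of the conjugation action. -/
theorem conj_triv (h : Cov V q) {κ F : BB ≃ₜ BB} (hκ : κ ∈ deck q) (hne : κ ≠ 1)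
    (hF : ∀ ν ∈ deck q, F * ν * F⁻¹ ∈ deck q) (hFκ : F * κ * F⁻¹ = κ)
    (hfin : ∀ ν ∈ deck q, ∃ n : ℕ, 1 ≤ n ∧ F ^ n * ν * (F ^ n)⁻¹ = ν)
    (hc : ∀ ν ∈ deck q, κ * (ν⁻¹ * (F * ν * F⁻¹)) = (ν⁻¹ * (F * ν * F⁻¹)) * κ)
    {ν : BB ≃ₜ BB} (hν : ν ∈ deck q) : F * ν * F⁻¹ = ν := by
  obtain ⟨E, R, S, hC, g, hg, hgE, hgen⟩ := h.abel_gen hκ hne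
  have hgi : ∀ n : ℤ, g ^ n = 1 → n = 0 := by
    have h1 : ∀ n : ℕ, ∀ u : BB, E ((g ^ n) u) = E u + n := by
      intro n
      induction n with
      | zero => intro u; simp
      | succ n ih =>
        intro u
        rw [pow_succ']
        change E (g ((g ^ n) u)) = _
        rw [hgE, ih]; push_cast; ring
    have h2 : ∀ n : ℕ, g ^ n = 1 → n = 0 := by
      intro n hn
      have := h1 n bo
      rw [hn] at this
      have h3 : (n:ℂ) = 0 := by simpa using this
      exact_mod_cast h3
    intro n hn
    rcases Int.natAbs_eq n with e | e
    · rw [e, zpow_natCast] at hn; rw [e, h2 _ hn]; rfl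
    · rw [e, zpow_neg, inv_eq_one, zpow_natCast] at hn; rw [e, h2 _ hn]; rfl
  have hginj : ∀ m n : ℤ, g ^ m = g ^ n → m = n := fun m n e => by
    have : g ^ (m - n) = 1 := by rw [zpow_sub, e, mul_inv_cancel]
    linarith [hgi _ this]
  obtain ⟨n, hn⟩ := hgen κ hκ rfl
  have hn0 : n ≠ 0 := by rintro rfl; exact hne (by simpa using hn)
  have hFg : F * g * F⁻¹ = g := by
    obtain ⟨m, hm⟩ := hgen (F * g * F⁻¹) (hF g hg) (by
      rw [← hFκ, hn]; group)
    have h1 : g ^ (m * n) = g ^ n := by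
      rw [zpow_mul, ← hm, conj_zpow, ← hn, hFκ]
    have h2 := hginj _ _ h1
    have h3 : m = 1 := by
      have : (m - 1) * n = 0 := by linarith
      rcases mul_eq_zero.1 this with h | h
      · linarith
      · exact absurd h hn0
    rw [hm, h3, zpow_one]
  obtain ⟨j, hj⟩ := hgen (ν⁻¹ * (F * ν * F⁻¹)) (mul_mem (inv_mem hν) (hF ν hν)) (hc ν hν)
  have hFν : F * ν * F⁻¹ = ν * g ^ j := by rw [← hj]; group
  have hpow : ∀ i : ℕ, F ^ i * ν * (F ^ i)⁻¹ = ν * g ^ (j * i) := by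
    intro i
    induction i with
    | zero => simp
    | succ i ih =>
      calc F ^ (i+1) * ν * (F ^ (i+1))⁻¹ = F * (F ^ i * ν * (F ^ i)⁻¹) * F⁻¹ := by rw [pow_succ']; group
        _ = (F * ν * F⁻¹) * (F * g ^ (j * i) * F⁻¹) := by rw [ih]; group
        _ = ν * g ^ j * g ^ (j * i) := by rw [hFν, ← conj_zpow, hFg]
        _ = ν * g ^ (j * (i + 1 : ℕ)) := by
          rw [mul_assoc, ← zpow_add]; congr 2; push_cast; ring
  obtain ⟨i, hi1, hi⟩ := hfin ν hν
  rw [hpow, mul_eq_left] at hi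
  have h1 := hgi _ hi
  have hj0 : j = 0 := by
    rcases mul_eq_zero.1 h1 with h | h
    · exact h
    · exfalso; have : i = 0 := by exact_mod_cast h
      omega
  rw [hFν, hj0]; simp

/-- Lift of a closed loop: a deck transformation translating it. -/
theorem loop_deck (h : Cov V q) {γ : ℝ → ℂ} (hγ : Continuous γ) (hγV : ∀ s, γ s ∈ V)
    (hper : ∀ s, γ (s + 1) = γ s) {e : BB} (he : q e = γ 0) :
    ∃ (x : ℝ → BB) (ν : BB ≃ₜ BB), Continuous x ∧ x 0 = e ∧ (∀ s, q (x s) = γ s) ∧ ν ∈ deck q ∧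
      ∀ s, ν (x s) = x (s + 1) := by
  obtain ⟨x, hx, hx0, hxq⟩ := h.lift hγ hγV he
  obtain ⟨ν, hν, hν1⟩ := h.deck_trans (a := x 0) (e := x 1) (by
    have := hper 0
    rw [hxq, hxq, ← this]; simp)
  refine ⟨x, ν, hx, hx0, hxq, hν, fun s => ?_⟩
  refine congrFun (h.uniq (G := fun s => ν (x s)) (G' := fun s => x (s + 1)) (ν.continuous.comp hx)
    (hx.comp (by fun_prop)) (fun s => by rw [hν, hxq, hxq, hper]) (a := 0) ?_) s
  simp only [hν1, zero_add]

/-- Winding of the deck transformation of a loop, computed from an explicit logarithm. -/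
theorem wind_loop (_h : Cov V q) {γ : ℝ → ℂ} {x : ℝ → BB} {ν : BB ≃ₜ BB} (hx : Continuous x)
    (hxq : ∀ s, q (x s) = γ s) (hνx : ∀ s, ν (x s) = x (s + 1))
    {p : ℂ} {L : BB → ℂ} (hL : Continuous L) (he : ∀ u, Complex.exp (L u) = q u - p)
    {l : ℝ → ℂ} (hl : Continuous l) (hle : ∀ s, Complex.exp (l s) = γ s - p) :
    L (ν (x 0)) - L (x 0) = l 1 - l 0 := by
  have := clog_diff (A := ℝ) isPreconnected_univ (L₁ := fun s => L (x s)) (L₂ := l)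
    (hL.comp hx).continuousOn hl.continuousOn (fun a _ => by rw [he, hxq, hle]) (a := 0) (b := 1)
    trivial trivial
  rw [hνx, zero_add]; exact this
end Cov

theorem exp_circle_continuous : Continuous (fun s : ℝ => Complex.exp (2 * Real.pi * s * Complex.I)) := by fun_prop

theorem exp_circle_norm (s : ℝ) : ‖Complex.exp (2 * Real.pi * s * Complex.I)‖ = 1 := by
  have := Complex.norm_exp_ofReal_mul_I (2 * Real.pi * s)
  push_cast at this; exact this

theorem exp_circle_per (s : ℝ) : Complex.exp (2 * Real.pi * (s + 1 : ℝ) * Complex.I) = Complex.exp (2 * Real.pi * s * Complex.I) := by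
  have := Complex.exp_periodic (2 * Real.pi * s * Complex.I)
  rw [← this]; congr 1; push_cast; ring

theorem one_add_slit {z : ℂ} (hz : ‖z‖ < 1) : 1 + z ∈ Complex.slitPlane := by
  left
  have := (abs_lt.1 ((Complex.abs_re_le_norm z).trans_lt hz)).1
  simp; linarith

theorem iter_lift {q : ℂ → ℂ} {f : ℂ → ℂ} {F : BB ≃ₜ BB} (hF : ∀ u, q (F u) = f (q u)) (n : ℕ) (u : BB) :
    q ((F ^ n) u) = f^[n] (q u) := by
  induction n with
  | zero => rfl
  | succ n ih =>
    rw [pow_succ', Function.iterate_succ_apply']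
    change q (F ((F ^ n) u)) = _
    rw [hF, ih]

theorem fix_pow {F : BB ≃ₜ BB} {u : BB} (hF : F u = u) (n : ℕ) : (F ^ n) u = u := by
  induction n with
  | zero => rfl
  | succ n ih =>
    rw [pow_succ']
    change F ((F ^ n) u) = _
    rw [ih, hF]

theorem per_fixed (f : ℂ ≃ₜ ℂ) (hf1 : ∀ y, 1 ≤ ‖y‖ → f y = y) {n : ℕ → ℕ} (hn : Tendsto n atTop atTop)
    (hrec : ∀ ε > 0, ∀ᶠ k in atTop, ∀ y, dist (f^[n k] y) y < ε) {p : ℂ} {m : ℕ} (hm : 1 ≤ m)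
    (hp : f^[m] p = p) : f p = p := by
  by_contra hfp
  set O : Set ℂ := (fun i : ℕ => f^[i] p) '' (Set.Iio m) with hO
  have hOfin : O.Finite := (Set.finite_Iio m).image _
  have hOf : ∀ y ∈ O, f y ∈ O := by
    rintro _ ⟨i, hi, rfl⟩
    simp only
    rw [← Function.iterate_succ_apply' f]
    rcases (show i + 1 ≤ m from hi).lt_or_eq with h | h
    · exact ⟨i + 1, h, rfl⟩
    · exact ⟨0, hm, by rw [Nat.succ_eq_add_one, h, hp]; rfl⟩
  have hOf' : ∀ y, f y ∈ O → y ∈ O := by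
    rintro y ⟨i, hi, e⟩
    simp only at e
    rcases i with _ | i
    · refine ⟨m - 1, (show m - 1 < m by omega), f.injective ?_⟩
      simp only
      rw [← e, ← Function.iterate_succ_apply' f, show (m - 1).succ = m by omega, hp]; rfl
    · exact ⟨i, (show i < m by have : i + 1 < m := hi; omega), f.injective (by rw [← e, ← Function.iterate_succ_apply' f])⟩
  have hpO : p ∈ O := ⟨0, hm, rfl⟩
  have hOne : ∀ y ∈ O, f y ≠ y := by
    rintro _ ⟨i, hi, rfl⟩ h
    simp only at h
    rw [← Function.iterate_succ_apply' f, Function.iterate_succ_apply] at h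
    exact hfp (f.injective.iterate i h)
  have hO1 : ∀ y ∈ O, ‖y‖ < 1 := fun y hy => not_le.1 fun h => hOne y hy (hf1 y h)
  have hball : ∀ y, ‖y‖ < 2 → ‖f y‖ < 2 := by
    intro y hy
    by_contra hcon
    push Not at hcon
    have := f.injective (hf1 (f y) (by linarith))
    rw [this] at hcon; linarith
  set V : Set ℂ := ball 0 2 \ O with hV
  have hVo : IsOpen V := isOpen_ball.sdiff hOfin.isClosed
  have hVb : Bornology.IsBounded V := isBounded_ball.subset Set.sdiff_subset
  have hVf : ∀ y, f y ∈ V ↔ y ∈ V := by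
    intro y
    simp only [hV, Set.mem_sdiff, mem_ball_zero_iff]
    refine and_congr ⟨fun h => ?_, hball y⟩ (not_congr ⟨hOf' y, hOf y⟩)
    by_contra hcon
    push Not at hcon
    rw [hf1 y (by linarith)] at h; linarith
  have hcV : ∀ y : ℂ, ‖y‖ = 3/2 → y ∈ V := fun y hy =>
    ⟨mem_ball_zero_iff.2 (by rw [hy]; norm_num), fun h => by have := hO1 y h; rw [hy] at this; norm_num at this⟩
  obtain ⟨q, h, hq0⟩ := exists_cov hVo hVb (hcV ((3/2 : ℝ) : ℂ) (by rw [Complex.norm_real]; norm_num))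
  have hb0 : f (q bo) = q bo := hf1 _ (by rw [hq0, Complex.norm_real]; norm_num)
  obtain ⟨F, hF0, hF⟩ := h.liftHomeo f hVf (a := bo) (e := bo) hb0.symm
  -- the outer loop
  obtain ⟨x, κ, hx, hx0, hxq, hκ, hκx⟩ := h.loop_deck (γ := fun s => (3/2 : ℝ) * Complex.exp (2 * Real.pi * s * Complex.I))
    (continuous_const.mul exp_circle_continuous) (fun s => hcV _ (by
      rw [norm_mul, exp_circle_norm, Complex.norm_real]; norm_num)) (fun s => by rw [exp_circle_per])
    (e := bo) (by rw [hq0]; simp)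
  have hFx : ∀ s, F (x s) = x s := by
    intro s
    refine congrFun (h.uniq (G := fun s => F (x s)) (G' := x) (F.continuous.comp hx) hx (fun s => ?_) (a := 0) (by
      simp only [hx0, hF0])) s
    rw [hF, hxq]
    exact hf1 _ (by rw [norm_mul, exp_circle_norm, Complex.norm_real]; norm_num)
  have hFm : ∀ ν ∈ Cov.deck q, F * ν * F⁻¹ ∈ Cov.deck q := fun ν hν => Cov.conj_mem hF hν
  have hFib : F⁻¹ bo = bo := by
    have := F.symm_apply_apply bo; rw [hF0] at this; exact this
  have hFκ : F * κ * F⁻¹ = κ := by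
    refine h.homeo_ext (fun u => by rw [hFm κ hκ u, hκ u]) (a := bo) ?_
    change F (κ (F⁻¹ bo)) = κ bo
    rw [hFib, ← hx0, hκx, hFx]
  have hu₀ : ∀ᶠ u in 𝓝 bo, F u = u := by
    obtain ⟨U, hU, hu, hi⟩ := h.locInj bo
    have h1 : ∀ᶠ u in 𝓝 bo, F u ∈ U := F.continuous.continuousAt.eventually (by
      rw [hF0]; exact hU.mem_nhds hu)
    have h2 : ∀ᶠ u : BB in 𝓝 bo, 1 < ‖q u‖ := (h.cont.norm.continuousAt (x := bo)).eventually (lt_mem_nhds (by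
      simp only; rw [hq0, Complex.norm_real]; norm_num))
    filter_upwards [h1, h2, hU.mem_nhds hu] with u h1 h2 h3
    exact hi h1 h3 (by simp only; rw [hF, hf1 _ h2.le])
  -- finite orbits
  have hfin : ∀ ν ∈ Cov.deck q, ∃ n : ℕ, 1 ≤ n ∧ F ^ n * ν * (F ^ n)⁻¹ = ν := by
    intro ν hν
    have h1 := h.lift_tendsto (Ψ := fun k => (F ^ (n k) : BB ≃ₜ BB)) (g := fun k => f^[n k])
      (Eventually.of_forall fun k => (F ^ (n k) : BB ≃ₜ BB).continuous) (fun k => f.continuous.iterate _) hrec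
      (Eventually.of_forall fun k u => iter_lift hF _ u) (by
        simp only [fix_pow hF0]; exact tendsto_const_nhds) (ν bo)
    have h2 := h.deck_eq_of_tendsto (ν := fun k => F ^ n k * ν * (F ^ n k)⁻¹) hν (Eventually.of_forall fun k => by
        intro u
        change q ((F ^ n k) (ν ((F ^ n k).symm u))) = q u
        rw [iter_lift hF, hν, ← iter_lift hF, Homeomorph.apply_symm_apply]) (a := bo) (by
        refine h1.congr fun k => ?_
        change _ = (F ^ n k) (ν ((F ^ n k).symm bo))
        have : (F ^ n k).symm bo = bo := by rw [Homeomorph.symm_apply_eq, fix_pow hF0]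
        rw [this])
    obtain ⟨k, hk1, hk2⟩ := (h2.and (hn.eventually_ge_atTop 1)).exists
    exact ⟨n k, hk2, hk1⟩
  have hwind : ∀ p ∈ O, ∀ L : BB → ℂ, Continuous L → (∀ u, Complex.exp (L u) = q u - p) →
      L (κ (x 0)) - L (x 0) = 2 * Real.pi * Complex.I := by
    intro p hp L hL he
    have hz : ∀ s : ℝ, ‖- p * Complex.exp (2 * Real.pi * (-s : ℝ) * Complex.I) / (3/2 : ℝ)‖ < 1 := fun s => by
      rw [norm_div, norm_mul, exp_circle_norm, norm_neg, Complex.norm_real]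
      have := hO1 p hp
      norm_num; linarith
    have := h.wind_loop (l := fun s => Real.log (3/2) + 2 * Real.pi * s * Complex.I +
      Complex.log (1 + (- p * Complex.exp (2 * Real.pi * (-s : ℝ) * Complex.I) / (3/2 : ℝ)))) hx hxq hκx hL he
      (by
        refine Continuous.add (by fun_prop) (Continuous.clog (by fun_prop) fun s => one_add_slit (hz s)))
      (fun s => by
        rw [Complex.exp_add, Complex.exp_log (Complex.slitPlane_ne_zero (one_add_slit (hz s))), Complex.exp_add,
          ← Complex.ofReal_exp, Real.exp_log (by norm_num), mul_add, mul_one]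
        have : Complex.exp (2 * Real.pi * s * Complex.I) * Complex.exp (2 * Real.pi * (-s : ℝ) * Complex.I) = 1 := by
          rw [← Complex.exp_add, ← Complex.exp_zero]; congr 1; push_cast; ring
        push_cast at this ⊢
        linear_combination (-p) * this)
    rw [this]
    have e : Complex.exp (2 * Real.pi * ((-1 : ℝ)) * Complex.I) = Complex.exp (2 * Real.pi * ((-0 : ℝ)) * Complex.I) := by
      rw [← exp_circle_per]; norm_num
    simp only [e]
    push_cast; ring
  have hpi : (2 * Real.pi * Complex.I : ℂ) ≠ 0 := Complex.two_pi_I_ne_zero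
  have hne : κ ≠ 1 := by
    rintro rfl
    obtain ⟨L, hL, he⟩ := h.exists_L (p := p) (fun hp => hp.2 hpO)
    have := hwind p hpO L hL he
    apply hpi; rw [← this]; simp
  have hφ : ∀ ν ∈ Cov.deck q, F * ν * F⁻¹ = ν := fun ν hν =>
    h.conj_triv hκ hne hFm hFκ hfin (fun ν hν => h.conj_comm hκ hne hx hκx hFm hFx hFκ hu₀ hfin hν) hν
  -- the small loop around p
  have hfpO : f p ∈ O := hOf p hpO
  obtain ⟨ρ, hρ, hρV⟩ : ∃ ρ > 0, ∀ y, dist y p ≤ ρ → y ≠ p → y ∈ V := by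
    have h1 : IsOpen (ball (0:ℂ) 2 \ (O \ {p})) := isOpen_ball.sdiff (hOfin.subset Set.sdiff_subset).isClosed
    obtain ⟨ρ, hρ, hb⟩ := Metric.isOpen_iff.1 h1 p ⟨mem_ball_zero_iff.2 (by linarith [hO1 p hpO]), fun h => h.2 rfl⟩
    refine ⟨ρ / 2, by linarith, fun y hy hyp => ?_⟩
    have := hb (mem_ball.2 (by linarith : dist y p < ρ))
    exact ⟨this.1, fun h => this.2 ⟨h, hyp⟩⟩
  have hρp : ρ < ‖f p - p‖ := by
    by_contra hcon
    push Not at hcon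
    exact (hρV (f p) (by rw [dist_eq_norm]; exact hcon) hfp).2 hfpO
  set γ : ℝ → ℂ := fun s => p + ρ * Complex.exp (2 * Real.pi * s * Complex.I) with hγ
  have hγV : ∀ s, γ s ∈ V := fun s => hρV _ (by
    rw [hγ, dist_eq_norm]; simp only
    rw [add_sub_cancel_left, norm_mul, exp_circle_norm, Complex.norm_real, Real.norm_eq_abs, abs_of_pos hρ, mul_one]) (by
    rw [hγ]; simp [hρ.ne'])
  -- reach the loop
  obtain ⟨e, he⟩ : ∃ e : BB, q e = γ 0 := by
    have hpc : IsPathConnected Oᶜ := hOfin.countable.isPathConnected_compl_of_one_lt_rank (by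
      rw [Complex.rank_real_complex]; exact_mod_cast (by norm_num : (1:ℕ) < 2))
    obtain ⟨σ, hσ⟩ := hpc.joinedIn (q bo) (h.m bo).2 (γ 0) (hγV 0).2
    set rr : ℂ → ℂ := fun z => z * ((min 1 (3/2 / max ‖z‖ (3/2)) : ℝ) : ℂ) with hrr
    have hrc : Continuous rr := by
      refine continuous_id.mul (Complex.continuous_ofReal.comp (continuous_const.min (continuous_const.div
        (continuous_norm.max continuous_const) fun z => ?_)))
      have := le_max_right ‖z‖ (3/2); linarith
    have hr1 : ∀ z, ‖z‖ ≤ 3/2 → rr z = z := fun z hz => by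
      simp only [hrr]; rw [max_eq_right hz]; norm_num
    have hr2 : ∀ z, 3/2 ≤ ‖z‖ → ‖rr z‖ = 3/2 := fun z hz => by
      simp only [hrr]; rw [max_eq_left hz, min_eq_right (by rw [div_le_one (by linarith)]; exact hz), norm_mul,
        Complex.norm_real, Real.norm_eq_abs, abs_of_pos (by apply div_pos <;> linarith)]
      field_simp
    have hrO : ∀ z ∈ Oᶜ, rr z ∈ V := by
      intro z hz
      rcases le_total ‖z‖ (3/2) with h1 | h1
      · rw [hr1 z h1]; exact ⟨mem_ball_zero_iff.2 (by linarith), hz⟩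
      · exact hcV _ (hr2 z h1)
    have hγ1 : ‖γ 0‖ ≤ 3/2 ∨ 3/2 < ‖γ 0‖ := le_or_gt _ _
    obtain ⟨y, hyc, hy0, hyq⟩ := h.lift (g := fun s : ℝ => rr (σ.extend s)) (hrc.comp σ.continuous_extend)
      (fun s => hrO _ (hσ _)) (a := 0) (e := bo) (by
        rw [σ.extend_zero, hr1 _ (by rw [hq0, Complex.norm_real]; norm_num)])
    have h1 := hyq 1
    simp only [σ.extend_one] at h1
    rcases hγ1 with h2 | h2
    · exact ⟨y 1, by rw [h1, hr1 _ h2]⟩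
    · -- radial segment
      have hseg : ∀ s : ℝ, (1 - (min (max s 0) 1 : ℝ) : ℂ) * rr (γ 0) + (min (max s 0) 1 : ℝ) * γ 0 ∈ V := by
        intro s
        set t : ℝ := min (max s 0) 1
        have ht0 : 0 ≤ t := le_min (le_max_right _ _) zero_le_one
        have ht1 : t ≤ 1 := min_le_right _ _
        have h3 := h2.le
        have e1 : (1 - (t:ℂ)) * rr (γ 0) + t * γ 0 = (((1 - t) * (3/2 / ‖γ 0‖) + t : ℝ) : ℂ) * γ 0 := by
          simp only [hrr]; rw [max_eq_left h3, min_eq_right (by rw [div_le_one (by linarith)]; exact h3)]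
          push_cast; ring
        have hg2 : ‖γ 0‖ < 2 := mem_ball_zero_iff.1 (hγV 0).1
        have e2 : ‖(1 - (t:ℂ)) * rr (γ 0) + t * γ 0‖ = (1 - t) * (3/2) + t * ‖γ 0‖ := by
          have : 0 ≤ (1 - t) * (3/2 / ‖γ 0‖) + t := by
            have : 0 ≤ 1 - t := by linarith
            positivity
          rw [e1, norm_mul, Complex.norm_real, Real.norm_eq_abs, abs_of_nonneg this]
          field_simp
        refine ⟨mem_ball_zero_iff.2 ?_, fun hcon => ?_⟩
        · rw [e2]; nlinarith
        · have := hO1 _ hcon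
          rw [e2] at this; nlinarith
      obtain ⟨w, hwc, hw0, hwq⟩ := h.lift (g := fun s : ℝ => (1 - (min (max s 0) 1 : ℝ) : ℂ) * rr (γ 0) + (min (max s 0) 1 : ℝ) * γ 0)
        (by fun_prop) hseg (a := 0) (e := y 1) (by rw [h1]; simp)
      exact ⟨w 1, by rw [hwq]; simp⟩
  obtain ⟨y, μ, hy, hy0, hyq, hμ, hμy⟩ := h.loop_deck (γ := γ) (by rw [hγ]; fun_prop) hγV (fun s => by
    simp only [hγ]; rw [exp_circle_per]) he
  obtain ⟨L, hL, hLe⟩ := h.exists_L (p := p) (fun hp => hp.2 hpO)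
  obtain ⟨L', hL', hLe'⟩ := h.exists_L (p := f p) (fun hp => hp.2 hfpO)
  have w1 : L (μ (y 0)) - L (y 0) = 2 * Real.pi * Complex.I := by
    rw [h.wind_loop (l := fun s => Real.log ρ + 2 * Real.pi * s * Complex.I) hy hyq hμy hL hLe (by fun_prop) (fun s => by
      rw [Complex.exp_add, ← Complex.ofReal_exp, Real.exp_log hρ, hγ]; ring)]
    push_cast; ring
  have w2 : L' (μ (y 0)) - L' (y 0) = 0 := by
    have hpp : p - f p ≠ 0 := fun h => hfp (sub_eq_zero.1 h).symm
    have hz : ∀ s : ℝ, ‖ρ * Complex.exp (2 * Real.pi * s * Complex.I) / (p - f p)‖ < 1 := fun s => by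
      rw [norm_div, norm_mul, exp_circle_norm, Complex.norm_real, Real.norm_eq_abs, abs_of_pos hρ, mul_one,
        div_lt_one (norm_pos_iff.2 hpp), norm_sub_rev]
      exact hρp
    rw [h.wind_loop (l := fun s => Complex.log (p - f p) + Complex.log (1 + ρ * Complex.exp (2 * Real.pi * s * Complex.I) / (p - f p)))
      hy hyq hμy hL' hLe' (continuous_const.add (Continuous.clog (by fun_prop) fun s => one_add_slit (hz s))) (fun s => by
      rw [Complex.exp_add, Complex.exp_log hpp, Complex.exp_log (Complex.slitPlane_ne_zero (one_add_slit (hz s))), hγ]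
      field_simp; ring)]
    have := exp_circle_per 0
    rw [zero_add] at this
    rw [this]; ring
  obtain ⟨W, hW⟩ := exists_isW_of_local_id f f.continuous f.injective (x₀ := 2) (by
    have : ∀ᶠ y : ℂ in 𝓝 2, 1 < ‖y‖ := continuous_norm.continuousAt.eventually (lt_mem_nhds (by norm_num))
    exact this.mono fun y hy => hf1 y hy.le)
  have hpq : ∀ u : BB, p ≠ q u := fun u e => (h.m u).2 (e ▸ hpO)
  have hS : ∀ u v : BB, L' (F u) - L u - W (p, q u) = L' (F v) - L v - W (p, q v) := by
    intro u v
    have := clog_diff (A := BB) isPreconnected_univ (L₁ := fun u => L' (F u)) (L₂ := fun u => L u + W (p, q u))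
      (hL'.comp F.continuous).continuousOn
      (hL.add (hW.1.comp_continuous (continuous_const.prodMk h.cont) (fun u => hpq u))).continuousOn
      (fun u _ => by
        rw [hLe', hF, Complex.exp_add, hLe, mul_comm, hW.2 _ _ (hpq u)]) (a := v) (b := u) trivial trivial
    linear_combination this
  have h1 := hS (μ (y 0)) (y 0)
  rw [hμ] at h1
  have h2 : F (μ (y 0)) = μ (F (y 0)) := by
    have := congrArg (fun g : BB ≃ₜ BB => g (F (y 0))) (hφ μ hμ)
    rw [← this]
    change _ = F (μ (F.symm (F (y 0))))
    rw [F.symm_apply_apply]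
  rw [h2] at h1
  have h3 := h.wind hL' hLe' hμ (F (y 0)) (y 0)
  apply hpi
  linear_combination w2 - w1 - h1 + h3

/-- `c` is the change of the logarithm of `γ - z` over one period. -/
def Wd (γ : ℝ → ℂ) (z c : ℂ) : Prop :=
  ∃ l : ℝ → ℂ, Continuous l ∧ (∀ s, Complex.exp (l s) = γ s - z) ∧ l 1 - l 0 = c

theorem Wd.uniq {γ : ℝ → ℂ} {z c c' : ℂ} (h : Wd γ z c) (h' : Wd γ z c') : c = c' := by
  obtain ⟨l, hl, he, rfl⟩ := h
  obtain ⟨l', hl', he', rfl⟩ := h'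
  exact clog_diff (A := ℝ) isPreconnected_univ hl.continuousOn hl'.continuousOn
    (fun a _ => by rw [he, he']) trivial trivial

theorem Wd.near {γ : ℝ → ℂ} (hper : ∀ s, γ (s + 1) = γ s) (hγ : Continuous γ) {z z' c : ℂ} (h : Wd γ z c) (hz : ∀ s, ‖z' - z‖ < ‖γ s - z‖) :
    Wd γ z' c := by
  obtain ⟨l, hl, he, rfl⟩ := h
  have h0 : ∀ s, γ s - z ≠ 0 := fun s h0 => by
    have := hz s; rw [h0, norm_zero] at this; linarith [norm_nonneg (z' - z)]
  have h1 : ∀ s, ‖-((z' - z) / (γ s - z))‖ < 1 := fun s => by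
    rw [norm_neg, norm_div, div_lt_one (norm_pos_iff.2 (h0 s))]; exact hz s
  refine ⟨fun s => l s + Complex.log (1 + -((z' - z) / (γ s - z))), ?_, ?_, ?_⟩
  · refine hl.add ?_
    refine Continuous.clog ?_ fun s => one_add_slit (h1 s)
    exact continuous_const.add (continuous_const.div (hγ.sub continuous_const) h0).neg
  · intro s
    rw [Complex.exp_add, he, Complex.exp_log (Complex.slitPlane_ne_zero (one_add_slit (h1 s)))]
    have := h0 s
    field_simp; ring
  · have := hper 0
    rw [zero_add] at this
    simp only [this]; ring

theorem strip_convex {S : Set ℝ} (hc : S.OrdConnected) : Convex ℝ {w : ℂ | w.im ∈ S} :=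
  (convex_iff_ordConnected.2 hc).is_linear_preimage Complex.imLm.isLinear

theorem strip_open {S : Set ℝ} (ho : IsOpen S) : IsOpen {w : ℂ | w.im ∈ S} :=
  ho.preimage Complex.continuous_im

/-- A periodic univalent function on a strip. -/
structure PStrip (p : ℂ → ℂ) (S : Set ℝ) : Prop where
  o : IsOpen S
  c : S.OrdConnected
  ne : S.Nonempty
  d : DifferentiableOn ℂ p {w | w.im ∈ S}
  d0 : ∀ w : ℂ, w.im ∈ S → deriv p w ≠ 0
  per : ∀ w : ℂ, w.im ∈ S → p (w + 1) = p w
  inj : ∀ w w' : ℂ, w.im ∈ S → w'.im ∈ S → p w = p w' → ∃ n : ℤ, w' = w + n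

noncomputable def ee (w : ℂ) : ℂ := Complex.exp (2 * Real.pi * Complex.I * w)

theorem ee_diff : Differentiable ℂ ee := by unfold ee; fun_prop
theorem ee_ne (w : ℂ) : ee w ≠ 0 := Complex.exp_ne_zero _
theorem ee_deriv (w : ℂ) : deriv ee w ≠ 0 := by
  have : HasDerivAt ee (Complex.exp (2 * Real.pi * Complex.I * w) * (2 * Real.pi * Complex.I)) w := by
    have := ((hasDerivAt_id w).const_mul (2 * Real.pi * Complex.I)).cexp
    rw [mul_one] at this
    exact this
  rw [this.deriv]
  exact mul_ne_zero (Complex.exp_ne_zero _) Complex.two_pi_I_ne_zero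
theorem ee_eq {w w' : ℂ} : ee w = ee w' ↔ ∃ n : ℤ, w = w' + n := by
  unfold ee
  rw [Complex.exp_eq_exp_iff_exists_int]
  have := Complex.two_pi_I_ne_zero
  refine exists_congr fun n => ⟨fun h => ?_, fun h => ?_⟩
  · apply mul_left_cancel₀ this; linear_combination h
  · rw [h]; ring
theorem ee_per (w : ℂ) : ee (w + 1) = ee w := ee_eq.2 ⟨1, by simp⟩
theorem ee_norm (w : ℂ) : ‖ee w‖ = Real.exp (-(2 * Real.pi * w.im)) := by
  unfold ee
  rw [Complex.norm_exp]; congr 1; simp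

namespace PStrip
variable {p : ℂ → ℂ} {S : Set ℝ}

theorem per_int (h : PStrip p S) {w : ℂ} (hw : w.im ∈ S) (n : ℤ) : p (w + n) = p w := by
  have h1 : ∀ n : ℕ, ∀ w : ℂ, w.im ∈ S → p (w + n) = p w := by
    intro n
    induction n with
    | zero => intro w _; simp
    | succ n ih =>
      intro w hw
      have := h.per (w + n) (by simpa using hw)
      rw [ih w hw] at this
      rw [← this]; push_cast; ring_nf
  obtain ⟨m, rfl | rfl⟩ := n.eq_nat_or_neg
  · simpa using h1 m w hw
  · have := h1 m (w + (-m : ℤ)) (by simpa using hw)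
    rw [← this]; congr 1; push_cast; ring

theorem exists_log (h : PStrip p S) {w₀ : ℂ} (hw₀ : w₀.im ∈ S) : ∃ M : ℂ → ℂ, ∃ C : ℂ,
    ContinuousOn M {w | w.im ∈ S} ∧ (∀ w : ℂ, w.im ∈ S → Complex.exp (M w) * (ee w - ee w₀) = p w - p w₀) ∧
    ∀ w : ℂ, w.im ∈ S → M (w + 1) - M w = C := by
  classical
  set F : ℂ → ℂ := fun w => if ee w = ee w₀ then deriv p w / deriv ee w else (p w - p w₀) / (ee w - ee w₀) with hF
  have hSo := strip_open h.o
  have hpat : ∀ w : ℂ, w.im ∈ S → DifferentiableAt ℂ p w := fun w hw => h.d.differentiableAt (hSo.mem_nhds hw)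
  have hFc : ContinuousOn F {w | w.im ∈ S} := by
    intro w hw
    apply ContinuousAt.continuousWithinAt
    by_cases he : ee w = ee w₀
    · obtain ⟨n, hn⟩ := ee_eq.1 he
      have hpw : p w = p w₀ := by rw [hn]; exact h.per_int hw₀ n
      have h1 : ContinuousAt (fun y => dslope p w y / dslope ee w y) w := by
        refine ContinuousAt.div (continuousAt_dslope_same.2 (hpat w hw)) (continuousAt_dslope_same.2 (ee_diff w)) ?_
        rw [dslope_same]; exact ee_deriv w
      refine h1.congr ?_
      filter_upwards [ball_mem_nhds w one_pos] with y hy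
      rw [hF]; simp only
      by_cases hyw : y = w
      · rw [hyw, if_pos he, dslope_same, dslope_same]
      · rw [if_neg, dslope_of_ne _ hyw, dslope_of_ne _ hyw, slope_def_field, slope_def_field, hpw, he]
        · have : y - w ≠ 0 := sub_ne_zero.2 hyw
          rw [div_div_div_cancel_right₀ this]
        · intro h2
          rw [← he, ee_eq] at h2
          obtain ⟨m, hm⟩ := h2
          rw [hm] at hy
          have h3 : ‖(m:ℂ)‖ < 1 := by simpa [dist_eq_norm] using hy
          rw [Complex.norm_intCast] at h3
          have h4 : |m| < 1 := by exact_mod_cast h3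
          rw [Int.abs_lt_one_iff] at h4
          apply hyw; rw [hm, h4]; simp
    · have h1 : ContinuousAt (fun w => (p w - p w₀) / (ee w - ee w₀)) w :=
        ((hpat w hw).continuousAt.sub continuousAt_const).div
          ((ee_diff w).continuousAt.sub continuousAt_const) (sub_ne_zero.2 he)
      refine h1.congr ?_
      filter_upwards [(ee_diff w).continuousAt.eventually_ne he] with y hy
      rw [hF]; simp only; rw [if_neg hy]
  have hF0 : ∀ w ∈ {w : ℂ | w.im ∈ S}, F w ≠ 0 := by
    intro w hw
    rw [hF]; simp only
    split_ifs with he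
    · exact div_ne_zero (h.d0 w hw) (ee_deriv w)
    · refine div_ne_zero (fun e => he ?_) (sub_ne_zero.2 he)
      obtain ⟨n, hn⟩ := h.inj _ _ hw₀ hw (sub_eq_zero.1 e).symm
      exact ee_eq.2 ⟨n, hn⟩
  obtain ⟨M, hM, hMe⟩ := exists_clog_on (strip_convex h.c) hSo hFc hF0
  have hFp : ∀ w : ℂ, w.im ∈ S → F (w + 1) = F w := by
    intro w hw
    have e1 : ∀ g : ℂ → ℂ, (∀ᶠ y in 𝓝 w, g (y + 1) = g y) → deriv g (w + 1) = deriv g w := by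
      intro g hg
      rw [← deriv_comp_add_const]
      exact EventuallyEq.deriv_eq hg
    rw [hF]; simp only
    rw [ee_per, h.per w hw, e1 p, e1 ee]
    · exact Eventually.of_forall ee_per
    · filter_upwards [hSo.mem_nhds hw] with y hy using h.per y hy
  refine ⟨M, M (w₀ + 1) - M w₀, hM, ?_, ?_⟩
  · intro w hw
    rw [hMe w hw, hF]; simp only
    split_ifs with he
    · obtain ⟨n, hn⟩ := ee_eq.1 he
      rw [he, hn, h.per_int hw₀]; simp
    · exact div_mul_cancel₀ _ (sub_ne_zero.2 he)
  · intro w hw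
    have h1 : ∀ w : ℂ, w ∈ {w : ℂ | w.im ∈ S} → w + 1 ∈ {w : ℂ | w.im ∈ S} := fun w hw => by simpa using hw
    have := clog_diff (strip_convex h.c).isPreconnected (L₁ := fun w => M (w + 1)) (L₂ := M)
      (hM.comp (by fun_prop) h1) hM (fun a ha => by rw [hMe _ (h1 a ha), hMe a ha, hFp a ha]) (a := w₀) (b := w) hw₀ hw
    linear_combination this

theorem loop_mem {w : ℂ} (hw : w.im ∈ S) (s : ℝ) : (w + s).im ∈ S := by simpa using hw

theorem loop_cont (h : PStrip p S) {w : ℂ} (hw : w.im ∈ S) : Continuous (fun s : ℝ => p (w + s)) :=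
  h.d.continuousOn.comp_continuous (f := fun s : ℝ => w + s) (by fun_prop) (fun s => loop_mem hw s)

theorem two_winds (h : PStrip p S) {w₀ : ℂ} (hw₀ : w₀.im ∈ S) : ∃ C : ℂ,
    (∀ w : ℂ, w.im ∈ S → w.im < w₀.im → Wd (fun s => p (w + s)) (p w₀) (C + 2 * Real.pi * Complex.I)) ∧
    (∀ w : ℂ, w.im ∈ S → w₀.im < w.im → Wd (fun s => p (w + s)) (p w₀) C) := by
  obtain ⟨M, C, hM, hMe, hMC⟩ := h.exists_log hw₀
  have hMl : ∀ w : ℂ, w.im ∈ S → Continuous (fun s : ℝ => M (w + s)) := fun w hw =>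
    hM.comp_continuous (f := fun s : ℝ => w + s) (by fun_prop) (fun s => loop_mem hw s)
  refine ⟨C, fun w hw hlt => ?_, fun w hw hlt => ?_⟩
  · have h1 : ∀ s : ℝ, ‖-ee (w₀ - (w + s))‖ < 1 := fun s => by
      rw [norm_neg, ee_norm, Real.exp_lt_one_iff]
      have := mul_pos Real.two_pi_pos (sub_pos.2 hlt)
      simpa using this
    refine ⟨fun s => M (w + s) + 2 * Real.pi * Complex.I * (w + s) + Complex.log (1 + -ee (w₀ - (w + s))), ?_, ?_, ?_⟩
    · refine ((hMl w hw).add (by fun_prop)).add (Continuous.clog ?_ fun s => one_add_slit (h1 s))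
      have := ee_diff.continuous
      fun_prop
    · intro s
      rw [Complex.exp_add, Complex.exp_log (Complex.slitPlane_ne_zero (one_add_slit (h1 s))), ← hMe _ (loop_mem hw s),
        Complex.exp_add, mul_assoc]
      congr 1
      change ee (w + s) * _ = _
      have : ee w₀ = ee (w + s) * ee (w₀ - (w + s)) := by
        unfold ee; rw [← Complex.exp_add]; congr 1; ring
      rw [this]; ring
    · have e1 := hMC w hw
      have e2 : ee (w₀ - (w + 1)) = ee (w₀ - w) := by
        rw [← ee_per]; congr 1; ring
      simp only [Complex.ofReal_one, Complex.ofReal_zero, add_zero, e2]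
      linear_combination e1
  · have h1 : ∀ s : ℝ, ‖-ee (w + s - w₀)‖ < 1 := fun s => by
      rw [norm_neg, ee_norm, Real.exp_lt_one_iff]
      have := mul_pos Real.two_pi_pos (sub_pos.2 hlt)
      simpa using this
    refine ⟨fun s => M (w + s) + (Real.pi * Complex.I + 2 * Real.pi * Complex.I * w₀) + Complex.log (1 + -ee (w + s - w₀)), ?_, ?_, ?_⟩
    · refine ((hMl w hw).add (by fun_prop)).add (Continuous.clog ?_ fun s => one_add_slit (h1 s))
      have := ee_diff.continuous
      fun_prop
    · intro s
      rw [Complex.exp_add, Complex.exp_log (Complex.slitPlane_ne_zero (one_add_slit (h1 s))), ← hMe _ (loop_mem hw s),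
        Complex.exp_add, mul_assoc, Complex.exp_add, Complex.exp_pi_mul_I]
      congr 1
      change -1 * ee w₀ * _ = _
      have : ee (w + s) = ee w₀ * ee (w + s - w₀) := by
        unfold ee; rw [← Complex.exp_add]; congr 1; ring
      rw [this]; ring
    · have e1 := hMC w hw
      have e2 : ee (w + 1 - w₀) = ee (w - w₀) := by
        rw [← ee_per (w - w₀)]; congr 1; ring
      simp only [Complex.ofReal_one, Complex.ofReal_zero, add_zero, e2]
      linear_combination e1

theorem wind_const (h : PStrip p S) {w₁ w w' c : ℂ} (hw₁ : w₁.im ∈ S) {T : Set ℝ} (hTo : IsOpen T)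
    (hTc : T.OrdConnected) (hTS : T ⊆ S) (h1 : w₁.im ∉ T) (hw : w.im ∈ T) (hw' : w'.im ∈ T)
    (hW : Wd (fun s => p (w₁ + s)) (p w) c) : Wd (fun s => p (w₁ + s)) (p w') c := by
  set K : Set (ℝ × ℂ) := Set.univ ×ˢ {w : ℂ | w.im ∈ T} with hK
  have hKc : Convex ℝ K := convex_univ.prod (strip_convex hTc)
  have hg : ContinuousOn (fun x : ℝ × ℂ => p (w₁ + x.1) - p x.2) K := by
    refine ContinuousOn.sub ?_ ?_
    · exact ((h.loop_cont hw₁).comp continuous_fst).continuousOn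
    · exact h.d.continuousOn.comp continuousOn_snd fun x hx => hTS hx.2
  obtain ⟨L, hL, hLe⟩ := exists_clog_on hKc (isOpen_univ.prod (strip_open hTo)) hg (by
    rintro ⟨s, y⟩ hy e
    obtain ⟨n, hn⟩ := h.inj _ _ (loop_mem hw₁ s) (hTS hy.2) (sub_eq_zero.1 e)
    have h2 : y.im ∈ T := hy.2
    simp only at hn
    rw [hn] at h2
    exact h1 (by simpa using h2))
  have hWd : ∀ y : ℂ, y.im ∈ T → Wd (fun s => p (w₁ + s)) (p y) (L (1, y) - L (0, y)) := fun y hy =>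
    ⟨fun s => L (s, y), hL.comp_continuous (f := fun s : ℝ => (s, y)) (by fun_prop) (fun s => ⟨trivial, hy⟩),
      fun s => hLe _ ⟨trivial, hy⟩, rfl⟩
  have h3 : ∀ x ∈ K, ((x.1 + 1, x.2) : ℝ × ℂ) ∈ K := fun x hx => ⟨trivial, hx.2⟩
  have := clog_diff hKc.isPreconnected (L₁ := fun x => L (x.1 + 1, x.2)) (L₂ := L)
    (hL.comp (by fun_prop) h3) hL (fun a ha => by
      rw [hLe _ (h3 a ha), hLe a ha]
      have := h.per (w₁ + a.1) (loop_mem hw₁ _)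
      simp only; rw [← this]; push_cast; ring_nf) (a := (0, w)) (b := (0, w')) ⟨trivial, hw⟩ ⟨trivial, hw'⟩
  have h4 : L (1, w) - L (0, w) = L (1, w') - L (0, w') := by
    simp only [zero_add] at this
    linear_combination -this
  rw [hW.uniq (hWd w hw), h4]
  exact hWd w' hw'

theorem limit_wind (h : PStrip p S) {w₁ w c : ℂ} (hw₁ : w₁.im ∈ S) {T T' : Set ℝ} (hTo : IsOpen T)
    (hTc : T.OrdConnected) (hTS : T ⊆ S) (h1 : w₁.im ∉ T) (hw : w.im ∈ T)
    (hW : Wd (fun s => p (w₁ + s)) (p w) c) (hT' : T' ⊆ T) (hT'c : ∃ A, IsClosed A ∧ T' = S ∩ A)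
    (hnc : ¬ IsCompact T') {V : Set ℂ} (hb : Bornology.IsBounded V) (hp : ∀ w : ℂ, w.im ∈ S → p w ∈ V)
    (hprop : ∀ (U : Ultrafilter ℝ) (z : ℂ), (U : Filter ℝ) ≤ 𝓟 S → Tendsto (fun s : ℝ => p (s * Complex.I)) U (𝓝 z) →
      z ∈ V → ∃ s ∈ S, (U : Filter ℝ) ≤ 𝓝 s) :
    ∃ z ∉ V, Wd (fun s => p (w₁ + s)) z c := by
  rw [isCompact_iff_ultrafilter_le_nhds] at hnc
  push Not at hnc
  obtain ⟨U, hU, hUn⟩ := hnc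
  obtain ⟨A, hA, hTA⟩ := hT'c
  have hIm : ∀ s : ℝ, (s * Complex.I : ℂ).im = s := fun s => by simp
  have hcl : IsCompact (closure V) := hb.isCompact_closure
  have hUS : (U : Filter ℝ) ≤ 𝓟 S := hU.trans (principal_mono.2 (hT'.trans hTS))
  obtain ⟨z, hz, hzl⟩ := isCompact_iff_ultrafilter_le_nhds.1 hcl (U.map fun s : ℝ => p (s * Complex.I)) (by
    rw [le_principal_iff, Ultrafilter.mem_coe, Ultrafilter.mem_map]
    filter_upwards [le_principal_iff.1 hUS] with s hs
    exact subset_closure (hp _ (by rw [hIm]; exact hs)))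
  have hzt : Tendsto (fun s : ℝ => p (s * Complex.I)) U (𝓝 z) := hzl
  have hzV : z ∉ V := fun hzV => by
    obtain ⟨s, hs, hle⟩ := hprop U z hUS hzt hzV
    refine hUn s ?_ hle
    rw [hTA]
    refine ⟨hs, ?_⟩
    refine hA.mem_of_tendsto (b := (U : Filter ℝ)) (f := id) hle ?_
    filter_upwards [le_principal_iff.1 hU] with s hs
    rw [hTA] at hs; exact hs.2
  refine ⟨z, hzV, ?_⟩
  have hγ := h.loop_cont hw₁
  have hper : ∀ s : ℝ, p (w₁ + (s + 1 : ℝ)) = p (w₁ + s) := fun s => by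
    rw [← h.per _ (loop_mem hw₁ s)]; push_cast; ring_nf
  have hpos : ∃ δ > 0, ∀ s : ℝ, δ ≤ ‖p (w₁ + s) - z‖ := by
    obtain ⟨s₀, -, hs₀⟩ := isCompact_Icc.exists_isMinOn (s := Set.Icc (0:ℝ) 1) ⟨0, by simp⟩
      (f := fun s : ℝ => ‖p (w₁ + s) - z‖) (hγ.sub continuous_const).norm.continuousOn
    refine ⟨‖p (w₁ + s₀) - z‖, norm_pos_iff.2 fun e => hzV ?_, fun s => ?_⟩
    · rw [← sub_eq_zero.1 e]; exact hp _ (loop_mem hw₁ s₀)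
    · have h2 : p (w₁ + s) = p (w₁ + Int.fract s) := by
        have := h.per_int (loop_mem hw₁ (Int.fract s)) ⌊s⌋
        rw [← this]
        congr 1
        rw [add_assoc]; congr 1
        exact_mod_cast (Int.fract_add_floor s).symm
      rw [h2]
      exact hs₀ ⟨Int.fract_nonneg s, (Int.fract_lt_one s).le⟩
  obtain ⟨δ, hδ, hδs⟩ := hpos
  have hev : ∀ᶠ s in (U : Filter ℝ), s ∈ T ∧ dist (p (s * Complex.I)) z < δ / 2 :=
    (eventually_of_mem (le_principal_iff.1 hU) hT').and (Metric.tendsto_nhds.1 hzt _ (by linarith))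
  obtain ⟨s, hs, hsd⟩ := hev.exists
  have h2 := h.wind_const hw₁ hTo hTc hTS h1 hw (w' := s * Complex.I) (by rw [hIm]; exact hs) hW
  refine Wd.near hper hγ h2 fun t => ?_
  rw [dist_eq_norm] at hsd
  have h3 := hδs t
  have h4 := norm_sub_norm_le (p (w₁ + t) - z) (p (s * Complex.I) - z)
  rw [show p (w₁ + t) - z - (p (s * Complex.I) - z) = p (w₁ + t) - p (s * Complex.I) by ring] at h4
  rw [norm_sub_rev]
  linarith

theorem exists_wind (h : PStrip p S) {V : Set ℂ} (hb : Bornology.IsBounded V) (hp : ∀ w : ℂ, w.im ∈ S → p w ∈ V)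
    (hprop : ∀ (U : Ultrafilter ℝ) (z : ℂ), (U : Filter ℝ) ≤ 𝓟 S → Tendsto (fun s : ℝ => p (s * Complex.I)) U (𝓝 z) →
      z ∈ V → ∃ s ∈ S, (U : Filter ℝ) ≤ 𝓝 s) :
    ∃ z ∉ V, ∃ w₁ : ℂ, w₁.im ∈ S ∧ ∃ c ≠ 0, Wd (fun s => p (w₁ + s)) z c := by
  obtain ⟨s₀, hs₀⟩ := h.ne
  obtain ⟨ε, hε, hball⟩ := Metric.isOpen_iff.1 h.o s₀ hs₀
  have hIm : ∀ s : ℝ, (s * Complex.I : ℂ).im = s := fun s => by simp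
  obtain ⟨C, hC1, hC2⟩ := h.two_winds (w₀ := s₀ * Complex.I) (by rwa [hIm])
  simp only [hIm] at hC1 hC2
  by_cases hC : C = 0
  · have hs1 : s₀ - ε / 2 ∈ S := hball (by rw [mem_ball, Real.dist_eq, abs_lt]; constructor <;> linarith)
    obtain ⟨z, hz, hW⟩ := h.limit_wind (w₁ := (s₀ - ε / 2 : ℝ) * Complex.I) (by rwa [hIm])
      (T := S ∩ Set.Ioi (s₀ - ε / 2)) (T' := S ∩ Set.Ici s₀)
      (h.o.inter isOpen_Ioi) (h.c.inter Set.ordConnected_Ioi) Set.inter_subset_left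
      (by rw [hIm]; intro h; simp at h) (w := s₀ * Complex.I) (by rw [hIm]; exact ⟨hs₀, by rw [Set.mem_Ioi]; linarith⟩)
      (hC1 _ (by rwa [hIm]) (by rw [hIm]; linarith))
      (Set.inter_subset_inter_right _ (fun x hx => by rw [Set.mem_Ici] at hx; rw [Set.mem_Ioi]; linarith))
      ⟨_, isClosed_Ici, rfl⟩ (fun hco => by
        obtain ⟨m, hm, hmax⟩ := hco.exists_isGreatest ⟨s₀, hs₀, Set.mem_Ici.2 le_rfl⟩
        obtain ⟨e, he, hb2⟩ := Metric.isOpen_iff.1 h.o m hm.1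
        have h2 : m + e / 2 ∈ S ∩ Set.Ici s₀ := ⟨hb2 (by rw [mem_ball, Real.dist_eq, abs_lt]; constructor <;> linarith), by
          have := Set.mem_Ici.1 hm.2
          rw [Set.mem_Ici]; linarith⟩
        have := hmax h2
        linarith) hb hp hprop
    refine ⟨z, hz, _, by rwa [hIm], _, ?_, hW⟩
    rw [hC, zero_add]; exact Complex.two_pi_I_ne_zero
  · have hs1 : s₀ + ε / 2 ∈ S := hball (by rw [mem_ball, Real.dist_eq, abs_lt]; constructor <;> linarith)
    obtain ⟨z, hz, hW⟩ := h.limit_wind (w₁ := (s₀ + ε / 2 : ℝ) * Complex.I) (by rwa [hIm])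
      (T := S ∩ Set.Iio (s₀ + ε / 2)) (T' := S ∩ Set.Iic s₀)
      (h.o.inter isOpen_Iio) (h.c.inter Set.ordConnected_Iio) Set.inter_subset_left
      (by rw [hIm]; intro h; simp at h) (w := s₀ * Complex.I) (by rw [hIm]; exact ⟨hs₀, by rw [Set.mem_Iio]; linarith⟩)
      (hC2 _ (by rwa [hIm]) (by rw [hIm]; linarith))
      (Set.inter_subset_inter_right _ (fun x hx => by rw [Set.mem_Iic] at hx; rw [Set.mem_Iio]; linarith))
      ⟨_, isClosed_Iic, rfl⟩ (fun hco => by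
        obtain ⟨m, hm, hmin⟩ := hco.exists_isLeast ⟨s₀, hs₀, Set.mem_Iic.2 le_rfl⟩
        obtain ⟨e, he, hb2⟩ := Metric.isOpen_iff.1 h.o m hm.1
        have h2 : m - e / 2 ∈ S ∩ Set.Iic s₀ := ⟨hb2 (by rw [mem_ball, Real.dist_eq, abs_lt]; constructor <;> linarith), by
          have := Set.mem_Iic.1 hm.2
          rw [Set.mem_Iic]; linarith⟩
        have := hmin h2
        linarith) hb hp hprop
    exact ⟨z, hz, _, by rwa [hIm], _, hC, hW⟩
end PStrip

namespace Cov
variable {V : Set ℂ} {q : ℂ → ℂ}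

theorem E_zpow {E : ℂ → ℂ} {g : BB ≃ₜ BB} (hgE : ∀ u : BB, E (g u) = E u + 1) (n : ℤ) (u : BB) :
    E ((g ^ n) u) = E u + n := by
  have h1 : ∀ n : ℕ, ∀ u : BB, E ((g ^ n) u) = E u + n := by
    intro n
    induction n with
    | zero => intro u; simp
    | succ n ih =>
      intro u
      rw [pow_succ']
      change E (g ((g ^ n) u)) = _
      rw [hgE, ih]; push_cast; ring
  obtain ⟨m, rfl | rfl⟩ := n.eq_nat_or_neg
  · simpa using h1 m u
  · have := h1 m ((g ^ (-m : ℤ)) u)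
    rw [← Homeomorph.mul_apply, ← zpow_natCast, ← zpow_add] at this
    simp only [add_neg_cancel, zpow_zero] at this
    rw [show (1 : BB ≃ₜ BB) u = u from rfl] at this
    rw [this]; push_cast; ring

theorem pstrip (h : Cov V q) {E R : ℂ → ℂ} {S : Set ℝ} (hC : Coord E R S) {g : BB ≃ₜ BB} (hg : g ∈ deck q)
    (hgE : ∀ u : BB, E (g u) = E u + 1) (hgen : ∀ ν ∈ deck q, ∃ n : ℤ, ν = g ^ n) :
    PStrip (fun w => q (R w)) S := by
  have hinj : ∀ w w' : ℂ, w.im ∈ S → w'.im ∈ S → q (R w) = q (R w') → ∃ n : ℤ, w' = w + n := by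
    intro w w' hw hw' e
    obtain ⟨ν, hν, hνe⟩ := h.deck_trans (a := ⟨R w, mem_ball_zero_iff.2 (hC.mR w hw)⟩)
      (e := ⟨R w', mem_ball_zero_iff.2 (hC.mR w' hw')⟩) e
    obtain ⟨n, rfl⟩ := hgen ν hν
    have h1 := E_zpow hgE n ⟨R w, mem_ball_zero_iff.2 (hC.mR w hw)⟩
    rw [hνe] at h1
    simp only [hC.ER w hw, hC.ER w' hw'] at h1
    exact ⟨n, h1⟩
  have hd : DifferentiableOn ℂ (fun w => q (R w)) {w | w.im ∈ S} :=
    h.d.comp hC.r fun w hw => mem_ball_zero_iff.2 (hC.mR w hw)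
  refine ⟨hC.o, hC.c, hC.ne, hd, ?_, ?_, hinj⟩
  · intro w hw e
    have hb := mem_ball_zero_iff.2 (hC.mR w hw)
    obtain ⟨r, hr, hball⟩ := Metric.isOpen_iff.1 h.o _ (h.m ⟨R w, hb⟩)
    obtain ⟨σ, hσd, hσm, hσ, hσ1⟩ := h.s _ r hball (R w) hb (mem_ball_self hr)
    have hσat : DifferentiableAt ℂ σ (q (R w)) := hσd.differentiableAt (ball_mem_nhds _ hr)
    have hEat : DifferentiableAt ℂ E (σ (q (R w))) := by
      rw [hσ1]; exact hC.d.differentiableAt (isOpen_ball.mem_nhds hb)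
    have hEw : E (σ (q (R w))) = w := by rw [hσ1, hC.ER w hw]
    have h1 : HasDerivAt (fun y => E (σ y)) (deriv (fun y => E (σ y)) (q (R w))) (q (R w)) :=
      (hEat.comp (q (R w)) hσat).hasDerivAt
    have h2 : HasDerivAt (fun w => q (R w)) 0 (E (σ (q (R w)))) := by
      rw [hEw, ← e]
      exact (hd.differentiableAt ((strip_open hC.o).mem_nhds hw)).hasDerivAt
    have h3 := HasDerivAt.comp (q (R w)) h2 h1
    have h4 : HasDerivAt (fun y : ℂ => y) 1 (q (R w)) := hasDerivAt_id _
    have h5 : ((fun w => q (R w)) ∘ fun y => E (σ y)) =ᶠ[𝓝 (q (R w))] fun y => y := by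
      filter_upwards [ball_mem_nhds (q (R w)) hr] with y hy
      simp only [Function.comp]
      rw [hC.RE _ (mem_ball_zero_iff.1 (hσm _ hy)), hσ y hy]
    have := (h3.congr_of_eventuallyEq h5.symm).unique h4
    simp at this
  · intro w hw
    set u : BB := ⟨R w, mem_ball_zero_iff.2 (hC.mR w hw)⟩ with hu
    have h1 := hgE u
    have h2 : E u = w := hC.ER w hw
    rw [h2] at h1
    have h3 := hC.RE _ (g u).norm_lt
    rw [h1] at h3
    rw [h3]; exact hg u

theorem exists_wind_gen (h : Cov V q) (hVb : Bornology.IsBounded V) {E R : ℂ → ℂ} {S : Set ℝ} (hC : Coord E R S)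
    {g : BB ≃ₜ BB} (hg : g ∈ deck q)
    (hgE : ∀ u : BB, E (g u) = E u + 1) (hgen : ∀ ν ∈ deck q, ∃ n : ℤ, ν = g ^ n) :
    ∃ z ∉ V, ∀ L : BB → ℂ, Continuous L → (∀ u, Complex.exp (L u) = q u - z) → ∀ u, L (g u) - L u ≠ 0 := by
  have hP := h.pstrip hC hg hgE hgen
  have hIm : ∀ s : ℝ, (s * Complex.I : ℂ).im = s := fun s => by simp
  obtain ⟨z, hz, w₁, hw₁, c, hc, hW⟩ := hP.exists_wind hVb
    (fun w hw => h.m ⟨R w, mem_ball_zero_iff.2 (hC.mR w hw)⟩) (by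
    intro U z hU ht hzV
    obtain ⟨r, hr, hball⟩ := Metric.isOpen_iff.1 h.o _ hzV
    have hS : ∀ᶠ s in (U : Filter ℝ), s ∈ S := le_principal_iff.1 hU
    have hev : ∀ᶠ s in (U : Filter ℝ), s ∈ S ∧ q (R (s * Complex.I)) ∈ ball z r :=
      hS.and (ht (ball_mem_nhds z hr))
    obtain ⟨s₁, hs₁, hb₁⟩ := hev.exists
    have hmb : ∀ s : ℝ, s ∈ S → R (s * Complex.I) ∈ ball (0:ℂ) 1 := fun s hs =>
      mem_ball_zero_iff.2 (hC.mR _ (by rw [hIm]; exact hs))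
    obtain ⟨σ, hσd, hσm, hσ, hσ1⟩ := h.s z r hball _ (hmb s₁ hs₁) hb₁
    have hzb := mem_ball_self hr (x := z)
    refine ⟨(E (σ z)).im, hC.mE _ (mem_ball_zero_iff.1 (hσm _ hzb)), ?_⟩
    have hcont : ContinuousAt (fun y => (E (σ y)).im) z := by
      have h1 : ContinuousAt σ z := hσd.continuousOn.continuousAt (ball_mem_nhds _ hr)
      have h2 : ContinuousAt E (σ z) := hC.d.continuousOn.continuousAt (isOpen_ball.mem_nhds (hσm _ hzb))
      exact Complex.continuous_im.continuousAt.comp (h2.comp h1)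
    have h3 : Tendsto (fun s : ℝ => (E (σ (q (R (s * Complex.I))))).im) U (𝓝 (E (σ z)).im) := hcont.tendsto.comp ht
    refine (h3.congr' (f₂ := id) ?_)
    filter_upwards [hev] with s ⟨hs, hb⟩
    have hm := mem_ball_zero_iff.1 (hσm _ hb)
    obtain ⟨n, hn⟩ := hP.inj (s * Complex.I) (E (σ (q (R (s * Complex.I))))) (by rw [hIm]; exact hs)
      (hC.mE _ hm) (by rw [hC.RE _ hm, hσ _ hb])
    rw [hn]; simp)
  refine ⟨z, hz, fun L hL hLe u => ?_⟩
  obtain ⟨l, hl, hle, hlc⟩ := hW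
  set x : ℝ → BB := fun s => ⟨R (w₁ + s), mem_ball_zero_iff.2 (hC.mR _ (PStrip.loop_mem hw₁ s))⟩ with hx
  have hxc : Continuous x := Continuous.subtype_mk (hC.r.continuousOn.comp_continuous (f := fun s : ℝ => w₁ + s)
    (by fun_prop) (fun s => PStrip.loop_mem hw₁ s)) _
  have hgx : ∀ s, g (x s) = x (s + 1) := by
    intro s
    have h1 := hgE (x s)
    have h2 : E (x s) = w₁ + s := hC.ER _ (PStrip.loop_mem hw₁ s)
    rw [h2] at h1
    have h3 := hC.RE _ (g (x s)).norm_lt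
    rw [h1] at h3
    apply Subtype.ext
    rw [← h3, hx]; simp only; push_cast; ring_nf
  have h1 := h.wind_loop (γ := fun s => q (x s)) hxc (fun s => rfl) hgx hL hLe hl hle
  rw [h.wind hL hLe hg u (x 0), h1, hlc]
  exact hc

/-- Two sequences of lifts converging at the base point agree eventually. -/
theorem eq_of_tendsto (h : Cov V q) {A B : ℕ → (BB ≃ₜ BB)} (hq : ∀ᶠ k in atTop, ∀ u, q (A k u) = q (B k u))
    {a c : BB} (hA : Tendsto (fun k => A k a) atTop (𝓝 c)) (hB : Tendsto (fun k => B k a) atTop (𝓝 c)) :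
    ∀ᶠ k in atTop, A k = B k := by
  obtain ⟨U, hU, hc, hi⟩ := h.locInj c
  filter_upwards [hq, hA (hU.mem_nhds hc), hB (hU.mem_nhds hc)] with k h1 h2 h3
  exact h.homeo_ext h1 (hi h2 h3 (h1 a))
end Cov

theorem homeo_pow_apply {X : Type*} [TopologicalSpace X] (f : X ≃ₜ X) (n : ℕ) (y : X) : (f ^ n) y = f^[n] y := by
  induction n with
  | zero => rfl
  | succ n ih => rw [pow_succ', Function.iterate_succ_apply', ← ih]; rfl

namespace Cov
variable {V : Set ℂ} {q : ℂ → ℂ}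

/-- The subgroup of pairs `(G, j)` with `G` a lift of `f ^ j`. -/
def liftGrp (q : ℂ → ℂ) (f : ℂ ≃ₜ ℂ) : Subgroup ((BB ≃ₜ BB) × Multiplicative ℤ) where
  carrier := {x | ∀ u, q (x.1 u) = (f ^ (Multiplicative.toAdd x.2)) (q u)}
  mul_mem' := by
    rintro ⟨G, j⟩ ⟨G', j'⟩ h h' u
    have h1 := h (G' u)
    have h2 := h' u
    simp only at h1 h2
    rw [h2] at h1
    change q (G (G' u)) = (f ^ (j.toAdd + j'.toAdd)) (q u)
    rw [h1, zpow_add]; rfl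
  one_mem' := fun u => rfl
  inv_mem' := by
    rintro ⟨G, j⟩ h u
    have h1 := h (G⁻¹ u)
    change q (G⁻¹ u) = (f ^ (-j.toAdd)) (q u)
    simp only at h1
    rw [show G (G⁻¹ u) = u from G.apply_symm_apply u] at h1
    rw [h1, zpow_neg]
    exact ((f ^ j.toAdd).symm_apply_apply _).symm

theorem mem_liftGrp {f : ℂ ≃ₜ ℂ} {x : (BB ≃ₜ BB) × Multiplicative ℤ} :
    x ∈ liftGrp q f ↔ ∀ u, q (x.1 u) = (f ^ (Multiplicative.toAdd x.2)) (q u) := Iff.rfl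

theorem final_contra (h : Cov V q) {f : ℂ ≃ₜ ℂ} (hV : ∀ y ∈ V, f y ≠ y)
    (hper : ∀ m : ℕ, 1 ≤ m → ∀ y, f^[m] y = y → f y = y)
    {n : ℕ → ℕ} (hn : Tendsto n atTop atTop) {Ψ : ℕ → (BB ≃ₜ BB)}
    (hΨ : ∀ᶠ k in atTop, ∀ u, q (Ψ k u) = f^[n k] (q u))
    (hΨt : ∀ a, Tendsto (fun k => Ψ k a) atTop (𝓝 a))
    (B : Subgroup ((BB ≃ₜ BB) × Multiplicative ℤ))
    (hB : ∀ᶠ k in atTop, (Ψ k, Multiplicative.ofAdd (n k : ℤ)) ∈ B)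
    (hB1 : ∀ l ∈ deck q, (l, (1 : Multiplicative ℤ)) ∈ B → l = 1) : False := by
  set A := B ⊓ liftGrp q f with hA
  have hinj : Function.Injective ((MonoidHom.snd (BB ≃ₜ BB) (Multiplicative ℤ)).comp A.subtype) := by
    rw [injective_iff_map_eq_one]
    rintro ⟨⟨G, j⟩, hG⟩ e
    have ej : j = 1 := e
    subst ej
    have : G = 1 := hB1 G (fun u => by
      have := hG.2 u
      simpa using this) hG.1
    subst this; rfl
  have hcyc : IsCyclic A := isCyclic_of_injective _ hinj
  obtain ⟨⟨⟨Θ₀, t₀⟩, hΘ₀⟩, hgen₀⟩ := hcyc.exists_generator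
  have hgen : ∃ Θ : BB ≃ₜ BB, ∃ t : ℕ, (∀ u, q (Θ u) = (f ^ (t:ℤ)) (q u)) ∧
      ∀ x ∈ A, ∃ j : ℤ, x = (Θ ^ j, Multiplicative.ofAdd (j * t : ℤ)) := by
    have key : ∀ x ∈ A, ∃ j : ℤ, x = (Θ₀ ^ j, t₀ ^ j) := fun x hx => by
      obtain ⟨j, hj⟩ := Subgroup.mem_zpowers_iff.1 (hgen₀ ⟨x, hx⟩)
      exact ⟨j, (congrArg Subtype.val hj).symm⟩
    obtain ⟨t, ht | ht⟩ := (Multiplicative.toAdd t₀).eq_nat_or_neg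
    · refine ⟨Θ₀, t, fun u => ?_, fun x hx => ?_⟩
      · have := hΘ₀.2 u
        simp only at this
        rw [this, ht]
      · obtain ⟨j, rfl⟩ := key x hx
        refine ⟨j, ?_⟩
        rw [← ht]; rfl
    · refine ⟨Θ₀⁻¹, t, fun u => ?_, fun x hx => ?_⟩
      · have := (inv_mem hΘ₀.2 : _ ∈ liftGrp q f) u
        simp only [Prod.inv_mk, toAdd_inv, ht, neg_neg] at this
        exact this
      · obtain ⟨j, rfl⟩ := key x hx
        refine ⟨-j, ?_⟩
        rw [inv_zpow, zpow_neg, inv_inv, neg_mul, ← mul_neg, ← ht]; rfl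
  obtain ⟨Θ, t, hΘ, hgen⟩ := hgen
  have hev : ∀ᶠ k in atTop, ∃ j : ℕ, 1 ≤ j ∧ 1 ≤ t ∧ Ψ k = Θ ^ j := by
    filter_upwards [hΨ, hB, hn.eventually_ge_atTop 1] with k h1 h2 h3
    obtain ⟨j, hj⟩ := hgen (Ψ k, Multiplicative.ofAdd (n k : ℤ)) ⟨h2, fun u => by
      simp only [toAdd_ofAdd, zpow_natCast]; rw [h1, homeo_pow_apply]⟩
    have e1 : Ψ k = Θ ^ j := congrArg Prod.fst hj
    have e2 : (n k : ℤ) = j * t := congrArg (fun x => Multiplicative.toAdd x.2) hj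
    have hpos : 0 < j * (t:ℤ) := by rw [← e2]; exact_mod_cast h3
    have ht : 0 < (t:ℤ) := by
      rcases Nat.eq_zero_or_pos t with h | h
      · rw [h] at hpos; simp at hpos
      · exact_mod_cast h
    have hj0 : 0 < j := pos_of_mul_pos_left hpos ht.le
    lift j to ℕ using hj0.le
    exact ⟨j, by exact_mod_cast hj0, by exact_mod_cast ht, by rw [e1, zpow_natCast]⟩
  have ht : 1 ≤ t := by obtain ⟨k, j, -, ht, -⟩ := hev.exists; exact ht
  -- transfer to the plane
  set e : ℂ ≃ₜ BB := Homeomorph.unitBall with he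
  set Θ' : ℂ ≃ₜ ℂ := (e.trans Θ).trans e.symm with hΘ'
  obtain ⟨W, hW⟩ := exists_isW_sq Θ'
  have hΘ't : ∀ y, e (Θ' y) = Θ (e y) := fun y => e.apply_symm_apply _
  have hfix : ∀ p, (Θ'.trans Θ') p ≠ p := by
    intro p hp
    have h1 : Θ (Θ (e p)) = e p := by
      rw [← hΘ't, ← hΘ't]; exact congrArg e hp
    have h2 : (f ^ (t:ℤ)) ((f ^ (t:ℤ)) (q (e p))) = q (e p) := by
      rw [← hΘ, ← hΘ, h1]
    rw [zpow_natCast, homeo_pow_apply, homeo_pow_apply, ← Function.iterate_add_apply] at h2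
    exact hV _ (h.m (e p)) (hper _ (by omega) _ h2)
  obtain ⟨δ, hδ, hδn⟩ := no_recurrent (Φ := Θ'.trans Θ') hW hfix (e.symm bo)
  have hit : ∀ m : ℕ, (Θ'.trans Θ')^[m] (e.symm bo) = e.symm ((Θ ^ (m + m)) bo) := by
    intro m
    induction m with
    | zero => rfl
    | succ m ih =>
      rw [Function.iterate_succ_apply', ih]
      apply e.injective
      change e (Θ' (Θ' _)) = _
      rw [hΘ't, hΘ't, e.apply_symm_apply, e.apply_symm_apply, show m + 1 + (m + 1) = (m + m) + 1 + 1 by ring,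
        pow_succ', pow_succ']
      rfl
  set N : Set BB := {u | dist (e.symm u) (e.symm bo) < δ} with hN
  have hNo : IsOpen N := isOpen_lt (by fun_prop) continuous_const
  have hNb : bo ∈ N := by
    change dist (e.symm bo) (e.symm bo) < δ
    rw [dist_self]; exact hδ
  have hno : ∀ j : ℕ, 1 ≤ j → Even j → (Θ ^ j) bo ∉ N := by
    rintro j hj ⟨m, rfl⟩ hm
    have h1 : dist (e.symm ((Θ ^ (m + m)) bo)) (e.symm bo) < δ := hm
    have h2 := hδn m (by omega)
    rw [hit] at h2
    linarith
  have hodd : ∀ᶠ k in atTop, ∃ j : ℕ, 1 ≤ j ∧ ¬ Even j ∧ Ψ k = Θ ^ j := by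
    filter_upwards [hev, hΨt bo (hNo.mem_nhds hNb)] with k ⟨j, hj, _, hje⟩ hk
    refine ⟨j, hj, fun hev => hno j hj hev ?_, hje⟩
    rw [← hje]; exact hk
  obtain ⟨l, ⟨j, hj, hj2, hje⟩, hl⟩ := (hodd.and (hΨt bo (hNo.mem_nhds hNb))).exists
  obtain ⟨k, ⟨i, hi, hi2, hie⟩, hk⟩ := (hodd.and (hΨt (Ψ l bo) (hNo.mem_nhds hl))).exists
  refine hno (i + j) (by omega) ?_ ?_
  · rw [Nat.not_even_iff_odd] at hj2 hi2; exact hi2.add_odd hj2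
  · rw [pow_add, ← hie, ← hje]; exact hk
end Cov

theorem log_path {z x b : ℂ} (hx : x ≠ z) (hb : b ≠ z) : ∃ d > 0, ∀ (φ S : ℂ → ℂ), Continuous φ → ContinuousOn S {z}ᶜ →
    (∀ y, y ≠ z → Complex.exp (S y) * (y - z) = φ y - z) → (∀ y, dist (φ y) y < d) →
    S x - S b = Complex.log (1 + (φ x - x) / (x - z)) - Complex.log (1 + (φ b - b) / (b - z)) := by
  have hpc : IsPathConnected ({z}ᶜ : Set ℂ) := isPathConnected_compl_singleton_of_one_lt_rank (by simp) z
  obtain ⟨γ, hγ⟩ := hpc.joinedIn b hb x hx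
  have hγ' : ∀ t, γ t ≠ z := fun t => hγ t
  obtain ⟨t₀, -, ht₀⟩ := isCompact_univ.exists_isMinOn (s := (Set.univ : Set unitInterval)) ⟨0, trivial⟩
    (f := fun t => ‖γ t - z‖) (by fun_prop)
  refine ⟨‖γ t₀ - z‖, norm_pos_iff.2 (sub_ne_zero.2 (hγ' t₀)), fun φ S hφ hS hSe hd => ?_⟩
  have h1 : ∀ t, ‖(φ (γ t) - γ t) / (γ t - z)‖ < 1 := fun t => by
    rw [norm_div, div_lt_one (norm_pos_iff.2 (sub_ne_zero.2 (hγ' t))), ← dist_eq_norm]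
    exact (hd _).trans_le (ht₀ (Set.mem_univ t))
  have := clog_diff (A := unitInterval) isPreconnected_univ (L₁ := fun t => S (γ t))
    (L₂ := fun t => Complex.log (1 + (φ (γ t) - γ t) / (γ t - z)))
    (hS.comp_continuous γ.continuous hγ').continuousOn
    (Continuous.clog (continuous_const.add (Continuous.div (by fun_prop) (by fun_prop)
      fun t => sub_ne_zero.2 (hγ' t))) fun t => one_add_slit (h1 t)).continuousOn
    (fun t _ => by
      have h0 := sub_ne_zero.2 (hγ' t)
      rw [Complex.exp_log (Complex.slitPlane_ne_zero (one_add_slit (h1 t)))]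
      apply mul_right_cancel₀ h0
      rw [hSe _ (hγ' t)]
      field_simp; ring) (a := 0) (b := 1) trivial trivial
  simpa using this

theorem zpow_fix {f : ℂ ≃ₜ ℂ} {z : ℂ} (hz : f z = z) (j : ℤ) : (f ^ j) z = z := by
  have h1 : ∀ m : ℕ, (f ^ m) z = z := fun m => by rw [homeo_pow_apply]; exact Function.iterate_fixed hz m
  obtain ⟨m, rfl | rfl⟩ := j.eq_nat_or_neg
  · rw [zpow_natCast, h1]
  · rw [zpow_neg, zpow_natCast]
    have := (f ^ m).symm_apply_apply z
    rw [h1] at this; exact this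

theorem eq_zero_of_exp_one {D : ℂ} (h : Complex.exp D = 1) (hn : ‖D‖ < 2 * Real.pi) : D = 0 := by
  obtain ⟨n, rfl⟩ := Complex.exp_eq_one_iff.1 h
  rw [norm_mul, Complex.norm_intCast] at hn
  have h1 : ‖(2 * Real.pi * Complex.I : ℂ)‖ = 2 * Real.pi := by
    simp [abs_of_pos Real.pi_pos]
  rw [h1] at hn
  have h2 : |(n:ℝ)| < 1 := by
    have := Real.two_pi_pos
    by_contra hc
    push Not at hc
    nlinarith
  have h3 : |n| < 1 := by exact_mod_cast h2
  rw [Int.abs_lt_one_iff] at h3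
  rw [h3]; simp

namespace Cov
variable {V : Set ℂ} {q : ℂ → ℂ}

theorem L_zpow {L : BB → ℂ} {g : BB ≃ₜ BB} {c : ℂ} (hgE : ∀ u : BB, L (g u) = L u + c) (n : ℤ) (u : BB) :
    L ((g ^ n) u) = L u + n * c := by
  have h1 : ∀ n : ℕ, ∀ u : BB, L ((g ^ n) u) = L u + n * c := by
    intro n
    induction n with
    | zero => intro u; simp
    | succ n ih =>
      intro u
      rw [pow_succ']
      change L (g ((g ^ n) u)) = _
      rw [hgE, ih]; push_cast; ring
  obtain ⟨m, rfl | rfl⟩ := n.eq_nat_or_neg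
  · simpa using h1 m u
  · have := h1 m ((g ^ (-m : ℤ)) u)
    rw [← Homeomorph.mul_apply, ← zpow_natCast, ← zpow_add] at this
    simp only [add_neg_cancel, zpow_zero] at this
    rw [show (1 : BB ≃ₜ BB) u = u from rfl] at this
    rw [this]; push_cast; ring

/-- Lifts of powers of `f` compatible with the canonical logarithm relative to a fixed point `z`. -/
def logGrp (q : ℂ → ℂ) (f : ℂ ≃ₜ ℂ) (L : BB → ℂ) (z b : ℂ) (hz : f z = z) (hb : f b = b) :
    Subgroup ((BB ≃ₜ BB) × Multiplicative ℤ) where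
  carrier := {x | x ∈ liftGrp q f ∧ ∃ S : ℂ → ℂ, ContinuousOn S {z}ᶜ ∧
    (∀ y, y ≠ z → Complex.exp (S y) * (y - z) = (f ^ (Multiplicative.toAdd x.2)) y - z) ∧ S b = 0 ∧
    ∀ u : BB, q u ≠ z → L (x.1 u) - L u = S (q u)}
  mul_mem' := by
    have hfz : ∀ j : ℤ, (f ^ j) z = z := fun j => zpow_fix hz j
    have hfb : ∀ j : ℤ, (f ^ j) b = b := fun j => zpow_fix hb j
    have hne : ∀ j : ℤ, ∀ y, y ≠ z → (f ^ j) y ≠ z := fun j y hy e => hy ((f ^ j).injective (e.trans (hfz j).symm))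
    rintro ⟨G, j⟩ ⟨G', j'⟩ ⟨hG, S, hS, hSe, hS0, hSL⟩ ⟨hG', S', hS', hSe', hS0', hSL'⟩
    refine ⟨mul_mem hG hG', fun y => S ((f ^ j'.toAdd) y) + S' y, ?_, ?_, ?_, ?_⟩
    · exact (hS.comp (f ^ j'.toAdd).continuous.continuousOn fun y hy => hne _ y hy).add hS'
    · intro y hy
      rw [Complex.exp_add, mul_assoc, hSe' y hy, hSe _ (hne _ y hy)]
      change _ = (f ^ (j.toAdd + j'.toAdd)) y - z
      rw [zpow_add]; rfl
    · simp only; rw [hfb, hS0, hS0', add_zero]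
    · intro u hu
      have h1 := hG' u
      simp only at h1
      have h2 := hSL (G' u) (by rw [h1]; exact hne _ _ hu)
      have h3 := hSL' u hu
      simp only at h2 h3 ⊢
      rw [← h1, ← h2, ← h3]
      change L (G (G' u)) - _ = _
      ring
  one_mem' := ⟨one_mem _, fun _ => 0, continuousOn_const, fun y _ => by simp, rfl, fun u _ => by simp⟩
  inv_mem' := by
    have hfz : ∀ j : ℤ, (f ^ j) z = z := fun j => zpow_fix hz j
    have hfb : ∀ j : ℤ, (f ^ j) b = b := fun j => zpow_fix hb j
    have hne : ∀ j : ℤ, ∀ y, y ≠ z → (f ^ j) y ≠ z := fun j y hy e => hy ((f ^ j).injective (e.trans (hfz j).symm))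
    rintro ⟨G, j⟩ ⟨hG, S, hS, hSe, hS0, hSL⟩
    refine ⟨inv_mem hG, fun y => - S ((f ^ (-j.toAdd)) y), ?_, ?_, ?_, ?_⟩
    · exact (hS.comp (f ^ (-j.toAdd)).continuous.continuousOn fun y hy => hne _ y hy).neg
    · intro y hy
      have h1 := hSe _ (hne (-j.toAdd) y hy)
      simp only at h1
      rw [← Homeomorph.mul_apply, ← zpow_add, add_neg_cancel, zpow_zero] at h1
      rw [Complex.exp_neg, inv_mul_eq_iff_eq_mul₀ (Complex.exp_ne_zero _)]
      exact h1.symm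
    · simp only; rw [hfb, hS0, neg_zero]
    · intro u hu
      have h1 := (inv_mem hG : _ ∈ liftGrp q f) u
      simp only [Prod.inv_mk, toAdd_inv] at h1
      have h2 := hSL (G⁻¹ u) (by rw [h1]; exact hne _ _ hu)
      simp only at h2
      rw [show G (G⁻¹ u) = u from G.apply_symm_apply u] at h2
      simp only
      rw [← h1, ← h2]
      simp

theorem exists_B (h : Cov V q) (hVb : Bornology.IsBounded V) {f : ℂ ≃ₜ ℂ} (hV : ∀ y, y ∈ V ↔ f y ≠ y)
    (hf1 : ∀ y, 1 ≤ ‖y‖ → f y = y)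
    {n : ℕ → ℕ} (hrec : ∀ ε > 0, ∀ᶠ k in atTop, ∀ y, dist (f^[n k] y) y < ε) {Ψ : ℕ → (BB ≃ₜ BB)}
    (hΨ : ∀ᶠ k in atTop, ∀ u, q (Ψ k u) = f^[n k] (q u))
    (hΨt : ∀ a, Tendsto (fun k => Ψ k a) atTop (𝓝 a)) :
    ∃ B : Subgroup ((BB ≃ₜ BB) × Multiplicative ℤ),
      (∀ᶠ k in atTop, (Ψ k, Multiplicative.ofAdd (n k : ℤ)) ∈ B) ∧
      (∀ l ∈ deck q, (l, (1 : Multiplicative ℤ)) ∈ B → l = 1) := by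
  by_cases hab : ∀ ν₁ ∈ deck q, ∀ ν₂ ∈ deck q, ν₁ * ν₂ = ν₂ * ν₁
  · by_cases htr : ∀ l ∈ deck q, l = 1
    · exact ⟨⊤, Eventually.of_forall fun k => trivial, fun l hl _ => htr l hl⟩
    push Not at htr
    obtain ⟨l, hl, hne⟩ := htr
    obtain ⟨E, R, S, hC, g, hg, hgE, hgen⟩ := h.abel_gen hl hne
    have hgen' : ∀ ν ∈ deck q, ∃ n : ℤ, ν = g ^ n := fun ν hν => hgen ν hν (hab l hl ν hν)
    obtain ⟨z, hz, hzw⟩ := h.exists_wind_gen hVb hC hg hgE hgen'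
    obtain ⟨L, hL, hLe⟩ := h.exists_L hz
    have hfz : f z = z := by
      by_contra hc; exact hz ((hV z).2 hc)
    have hbex : ∃ b : ℂ, 1 < ‖b‖ ∧ b ≠ z := by
      by_cases h3 : (3:ℂ) = z
      · refine ⟨4, by norm_num, ?_⟩
        rw [← h3]; norm_num
      · exact ⟨3, by norm_num, h3⟩
    obtain ⟨b, hb1, hbz⟩ := hbex
    have hfb : f b = b := hf1 b hb1.le
    have hqz : ∀ u : BB, q u ≠ z := fun u e => hz (e ▸ h.m u)
    refine ⟨logGrp q f L z b hfz hfb, ?_, ?_⟩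
    · set x := q bo with hx
      obtain ⟨d, hd, hdS⟩ := log_path (hqz bo) hbz
      have hit : ∀ k, f^[n k] b = b := fun k => Function.iterate_fixed hfb _
      have hitz : ∀ k, f^[n k] z = z := fun k => Function.iterate_fixed hfz _
      have hl0 : Tendsto (fun k => L (Ψ k bo) - L bo - Complex.log (1 + (f^[n k] x - x) / (x - z))) atTop (𝓝 0) := by
        have h1 : Tendsto (fun k => L (Ψ k bo)) atTop (𝓝 (L bo)) := (hL.tendsto bo).comp (hΨt bo)
        have h2 : Tendsto (fun k => f^[n k] x) atTop (𝓝 x) := Metric.tendsto_nhds.2 fun ε hε => by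
          filter_upwards [hrec ε hε] with k hk using hk x
        have h3 : Tendsto (fun k => Complex.log (1 + (f^[n k] x - x) / (x - z))) atTop (𝓝 (Complex.log (1 + (x - x) / (x - z)))) :=
          ((tendsto_const_nhds.add ((h2.sub_const x).div_const _))).clog (by simp)
        have := (h1.sub_const (L bo)).sub h3
        simpa using this
      filter_upwards [hΨ, hrec d hd, Metric.tendsto_nhds.1 hl0 _ Real.two_pi_pos] with k hk1 hk2 hk3
      refine ⟨fun u => by simp only [toAdd_ofAdd, zpow_natCast]; rw [hk1, homeo_pow_apply], ?_⟩
      obtain ⟨W, hW⟩ := exists_isW_of_local_id (f^[n k]) (f.continuous.iterate _) (f.injective.iterate _) (x₀ := b) (by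
        have : ∀ᶠ y : ℂ in 𝓝 b, 1 < ‖y‖ := continuous_norm.continuousAt.eventually (lt_mem_nhds hb1)
        filter_upwards [this] with y hy using Function.iterate_fixed (hf1 y hy.le) _)
      have hWb : Complex.exp (W (z, b)) = 1 := by
        have := hW.2 z b hbz.symm
        rw [hit, hitz] at this
        exact mul_right_cancel₀ (sub_ne_zero.2 hbz) (this.trans (one_mul _).symm)
      set S : ℂ → ℂ := fun y => W (z, y) - W (z, b) with hS
      have hSc : ContinuousOn S {z}ᶜ := by
        refine ContinuousOn.sub ?_ continuousOn_const
        exact hW.1.comp (by fun_prop) fun y hy => Ne.symm hy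
      have hSe : ∀ y, y ≠ z → Complex.exp (S y) * (y - z) = f^[n k] y - z := fun y hy => by
        rw [hS]; simp only
        rw [Complex.exp_sub, hWb, div_one, hW.2 z y hy.symm, hitz]
      have hSb : S b = 0 := by simp [hS]
      refine ⟨S, hSc, ?_, hSb, fun u _ => ?_⟩
      · intro y hy
        simp only [toAdd_ofAdd, zpow_natCast]; rw [hSe y hy, homeo_pow_apply]
      · have hSx := hdS _ S (f.continuous.iterate (n k)) hSc hSe hk2
        rw [hSb, hit, sub_self, zero_div, add_zero, Complex.log_one, sub_zero, sub_zero] at hSx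
        have hexp : ∀ u : BB, Complex.exp (L (Ψ k u) - S (q u)) = Complex.exp (L u) := fun u => by
          rw [Complex.exp_sub, div_eq_iff (Complex.exp_ne_zero _), hLe, hLe, hk1, mul_comm, hSe _ (hqz u)]
        have hD := clog_diff (A := BB) isPreconnected_univ (L₁ := fun u => L (Ψ k u) - S (q u)) (L₂ := L)
          ((hL.comp (Ψ k).continuous).sub (hSc.comp_continuous h.cont hqz)).continuousOn hL.continuousOn
          (fun u _ => hexp u) (a := bo) (b := u) trivial trivial
        have hD0 : L (Ψ k bo) - L bo - S (q bo) = 0 := by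
          apply eq_zero_of_exp_one
          · have := hexp bo
            rw [show L (Ψ k bo) - L bo - S (q bo) = (L (Ψ k bo) - S (q bo)) - L bo by ring, Complex.exp_sub, this,
              div_self (Complex.exp_ne_zero _)]
          · rw [← hx, hSx]
            rw [dist_zero_right] at hk3
            exact hk3
        simp only at hD ⊢
        linear_combination hD + hD0
    · rintro ν hν ⟨-, S, hS, hSe, hSb, hSL⟩
      have hS0 : ∀ y, y ≠ z → S y = 0 := fun y hy => by
        have := clog_diff (isConnected_compl_singleton_of_one_lt_rank (by simp) z).isPreconnected
          (L₁ := S) (L₂ := fun _ => 0) hS continuousOn_const (fun a ha => by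
            have h1 := hSe a ha
            simp only [toAdd_one, zpow_zero] at h1
            rw [Complex.exp_zero]
            exact mul_right_cancel₀ (sub_ne_zero.2 ha) (h1.trans (one_mul _).symm)) (a := b) (b := y) hbz hy
        rw [hSb] at this; simpa using this
      obtain ⟨m, rfl⟩ := hgen' ν hν
      have h1 := hSL bo (hqz bo)
      rw [hS0 _ (hqz bo)] at h1
      simp only at h1
      rw [L_zpow (L := L) (g := g) (c := L (g bo) - L bo) (fun u => by rw [← h.wind hL hLe hg u bo]; ring) m bo] at h1
      have h2 : (m:ℂ) * (L (g bo) - L bo) = 0 := by linear_combination h1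
      rcases mul_eq_zero.1 h2 with h3 | h3
      · have : m = 0 := by exact_mod_cast h3
        rw [this, zpow_zero]
      · exact absurd h3 (hzw L hL hLe bo)
  · push Not at hab
    obtain ⟨ν₁, h1, ν₂, h2, hnc⟩ := hab
    have hc : ∀ ν ∈ deck q, ∀ᶠ k in atTop, Ψ k * ν = ν * Ψ k := fun ν hν => by
      refine h.eq_of_tendsto (A := fun k => Ψ k * ν) (B := fun k => ν * Ψ k) (a := bo) (c := ν bo) ?_ (hΨt (ν bo)) ?_
      · filter_upwards [hΨ] with k hk u
        change q (Ψ k (ν u)) = q (ν (Ψ k u))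
        rw [hk, hν u, hν, hk]
      · exact (ν.continuous.tendsto bo).comp (hΨt bo)
    refine ⟨(Subgroup.centralizer {ν₁, ν₂}).comap (MonoidHom.fst _ _), ?_, ?_⟩
    · filter_upwards [hc ν₁ h1, hc ν₂ h2] with k e1 e2
      rw [Subgroup.mem_comap, Subgroup.mem_centralizer_iff]
      rintro ν (rfl | rfl)
      · exact e1.symm
      · exact e2.symm
    · intro l hl hm
      rw [Subgroup.mem_comap, Subgroup.mem_centralizer_iff] at hm
      by_contra hne
      exact hnc (h.commute_trans hl h1 h2 hne (hm ν₁ (by simp)).symm (hm ν₂ (by simp)).symm)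
end Cov

/-- Main theorem in the plane. -/
theorem main_id (f : ℂ ≃ₜ ℂ) (hf1 : ∀ y, 1 ≤ ‖y‖ → f y = y) {n : ℕ → ℕ} (hn : Tendsto n atTop atTop)
    (hrec : ∀ ε > 0, ∀ᶠ k in atTop, ∀ y, dist (f^[n k] y) y < ε) (y : ℂ) : f y = y := by
  by_contra hy
  set V : Set ℂ := {y | f y ≠ y} with hVdef
  have hVo : IsOpen V := isOpen_ne_fun f.continuous continuous_id
  have hVb : Bornology.IsBounded V := isBounded_ball.subset (s := V) (t := ball 0 1) fun x hx =>
    mem_ball_zero_iff.2 (not_le.1 fun h => hx (hf1 x h))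
  have hVf : ∀ y, f y ∈ V ↔ y ∈ V := fun y => not_congr f.injective.eq_iff
  have hVi : ∀ m y, (f ^ m : ℂ ≃ₜ ℂ) y ∈ V ↔ y ∈ V := by
    intro m
    induction m with
    | zero => intro y; rfl
    | succ m ih =>
      intro y
      rw [pow_succ']
      exact (hVf _).trans (ih y)
  obtain ⟨q, h, hq0⟩ := exists_cov hVo hVb (x := y) hy
  obtain ⟨r, hr, hball⟩ := Metric.isOpen_iff.1 hVo y hy
  have hyb : q bo ∈ ball y r := by rw [hq0]; exact mem_ball_self hr
  obtain ⟨σ, hσd, hσm, hσ, hσ1⟩ := h.s y r hball bo bo.2 hyb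
  rw [hq0] at hσ1
  have hex : ∀ k, ∃ G : BB ≃ₜ BB, dist (f^[n k] y) y < r → ((G bo : BB) : ℂ) = σ (f^[n k] y) ∧ ∀ u, q (G u) = f^[n k] (q u) := by
    intro k
    by_cases hk : dist (f^[n k] y) y < r
    · obtain ⟨G, hG, hGq⟩ := h.liftHomeo (f ^ n k) (hVi _) (a := bo) (e := ⟨σ (f^[n k] y), hσm _ hk⟩) (by
        simp only; rw [hσ _ hk, hq0, homeo_pow_apply])
      exact ⟨G, fun _ => ⟨by rw [hG], fun u => by rw [hGq, homeo_pow_apply]⟩⟩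
    · exact ⟨1, fun h => absurd h hk⟩
  choose Ψ hΨ0 using hex
  have hΨ : ∀ᶠ k in atTop, ∀ u, q (Ψ k u) = f^[n k] (q u) := by
    filter_upwards [hrec r hr] with k hk using (hΨ0 k (hk y)).2
  have hΨt : ∀ a, Tendsto (fun k => Ψ k a) atTop (𝓝 a) := by
    refine h.lift_tendsto (Ψ := fun k => Ψ k) (g := fun k => f^[n k])
      (Eventually.of_forall fun k => (Ψ k).continuous) (fun k => f.continuous.iterate _) hrec hΨ ?_
    rw [tendsto_subtype_rng]
    have h2 : Tendsto (fun k => f^[n k] y) atTop (𝓝 y) := Metric.tendsto_nhds.2 fun ε hε => by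
      filter_upwards [hrec ε hε] with k hk using hk y
    have h3 : Tendsto (fun k => σ (f^[n k] y)) atTop (𝓝 (σ y)) :=
      (hσd.continuousOn.continuousAt (ball_mem_nhds y hr)).tendsto.comp h2
    rw [hσ1] at h3
    refine h3.congr' ?_
    filter_upwards [hrec r hr] with k hk using (hΨ0 k (hk y)).1.symm
  obtain ⟨B, hB, hB1⟩ := h.exists_B hVb (fun y => Iff.rfl) hf1 hrec hΨ hΨt
  exact h.final_contra (fun y hy => hy) (fun m hm y e => per_fixed f hf1 hn hrec hm e) hn hΨ hΨt B hB hB1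

theorem d8_ee_re (t : ℝ) : ‖ee (t : ℂ)‖ = 1 := by
  rw [ee_norm]; simp

theorem d8_F_cont {f : ℂ → ℂ} (hf : Continuous f) {F : ℝ → ℝ} (hF : StrictMono F)
    (hF1 : ∀ t, F (t + 1) = F t + 1) (hFc : ∀ t : ℝ, f (ee t) = ee (F t)) : Continuous F := by
  rw [continuous_iff_continuousAt]
  intro t
  rw [hF.monotone.continuousAt_iff_leftLim_eq_rightLim]
  have hee : Continuous ee := by unfold ee; fun_prop
  have h1 : ee (Function.leftLim F t : ℝ) = f (ee t) := by
    have a := (hee.comp Complex.continuous_ofReal).continuousAt.tendsto.comp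
      (hF.monotone.tendsto_leftLim t)
    have b : Tendsto (fun s : ℝ => f (ee s)) (𝓝[<] t) (𝓝 (f (ee t))) :=
      ((hf.comp (hee.comp Complex.continuous_ofReal)).continuousAt (x := t)).tendsto.mono_left
        nhdsWithin_le_nhds
    refine tendsto_nhds_unique a (b.congr fun s => ?_)
    rw [hFc]; rfl
  have h2 : ee (Function.rightLim F t : ℝ) = f (ee t) := by
    have a := (hee.comp Complex.continuous_ofReal).continuousAt.tendsto.comp
      (hF.monotone.tendsto_rightLim t)
    have b : Tendsto (fun s : ℝ => f (ee s)) (𝓝[>] t) (𝓝 (f (ee t))) :=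
      ((hf.comp (hee.comp Complex.continuous_ofReal)).continuousAt (x := t)).tendsto.mono_left
        nhdsWithin_le_nhds
    refine tendsto_nhds_unique a (b.congr fun s => ?_)
    rw [hFc]; rfl
  rw [← h2, ee_eq] at h1
  obtain ⟨m, hm⟩ := h1
  have hm' : Function.leftLim F t = Function.rightLim F t + m := by exact_mod_cast hm
  have a1 : Function.leftLim F t ≤ Function.rightLim F t := hF.monotone.leftLim_le_rightLim le_rfl
  have a2 : F (t - 1/4) ≤ Function.leftLim F t := hF.monotone.le_leftLim (by linarith)
  have a3 : Function.rightLim F t ≤ F (t + 1/4) := hF.monotone.rightLim_le (by linarith)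
  have a4 : F (t + 1/4) < F (t - 1/4) + 1 := by
    rw [← hF1]; exact hF (by linarith)
  have b1 : (m : ℝ) ≤ 0 := by linarith
  have b2 : (-1 : ℝ) < m := by linarith
  have : m = 0 := by
    have c1 : m ≤ 0 := by exact_mod_cast b1
    have c2 : -1 < m := by exact_mod_cast b2
    omega
  rw [hm', this]; simp

theorem d8_exists {f : ℂ → ℂ} (hf : Continuous f) {F : ℝ → ℝ} (hFcont : Continuous F)
    (hF1 : ∀ t, F (t + 1) = F t + 1) (hFc : ∀ t : ℝ, f (ee t) = ee (F t)) : ∃ x, f x = x := by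
  by_contra! hno
  obtain ⟨Λ, hΛc, hΛ⟩ := exists_clog (A := ℂ) (g := fun y => f y - y) (by fun_prop)
    (fun y => sub_ne_zero.2 (hno y))
  have hee : Continuous ee := by unfold ee; fun_prop
  have hid : ∀ t : ℝ, ee (F t) - ee t = Complex.exp (Real.pi * Complex.I * (F t + t)) *
      (2 * Complex.I * Complex.sin (Real.pi * (F t - t))) := by
    intro t
    have : 2 * Complex.I * Complex.sin (Real.pi * (F t - t)) =
        Complex.exp (Real.pi * Complex.I * (F t - t)) -
        Complex.exp (-(Real.pi * Complex.I * (F t - t))) := by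
      rw [Complex.sin]
      rw [show -(Real.pi * ((F t : ℂ) - t)) * Complex.I = -(Real.pi * Complex.I * (F t - t)) by ring,
        show (Real.pi * ((F t : ℂ) - t)) * Complex.I = (Real.pi * Complex.I * (F t - t)) by ring]
      linear_combination (Complex.exp (-(Real.pi * Complex.I * (F t - t))) -
        Complex.exp (Real.pi * Complex.I * (F t - t))) * Complex.I_sq
    rw [this, mul_sub, ← Complex.exp_add, ← Complex.exp_add]
    unfold ee
    congr 2 <;> ring
  have hs0 : ∀ t : ℝ, Real.sin (Real.pi * (F t - t)) ≠ 0 := by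
    intro t h
    have h1 := hid t
    have h2 : Complex.sin (Real.pi * ((F t : ℂ) - t)) = 0 := by exact_mod_cast h
    rw [h2, mul_zero, mul_zero, ← hFc, sub_eq_zero] at h1
    exact hno _ h1
  have hsl : ∀ t : ℝ, 2 * Complex.I * Complex.sin (Real.pi * ((F t : ℂ) - t)) ∈
      Complex.slitPlane := by
    intro t
    right
    have : 2 * Complex.I * Complex.sin (Real.pi * ((F t : ℂ) - t)) =
      ((2 * Real.sin (Real.pi * (F t - t)) : ℝ) : ℂ) * Complex.I := by push_cast; ring
    rw [this, Complex.im_ofReal_mul]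
    simpa using hs0 t
  have := clog_diff (A := ℝ) (S := Set.univ) isPreconnected_univ
    (L₁ := fun t : ℝ => Λ (ee t))
    (L₂ := fun t : ℝ => Real.pi * Complex.I * (F t + t) +
      Complex.log (2 * Complex.I * Complex.sin (Real.pi * ((F t : ℂ) - t))))
    (by fun_prop)
    (by
      refine Continuous.continuousOn (Continuous.add (by fun_prop) ?_)
      exact Continuous.clog (by fun_prop) hsl)
    (fun t _ => by
      rw [hΛ, Complex.exp_add, Complex.exp_log (Complex.slitPlane_ne_zero (hsl t)), ← hid, hFc])
    (a := 0) (b := 1) trivial trivial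
  have h1 : F 1 = F 0 + 1 := by rw [← hF1]; simp
  have h2 : ee ((1 : ℝ) : ℂ) = ee ((0 : ℝ) : ℂ) := by
    rw [ee_eq]; exact ⟨1, by simp⟩
  simp only [h1, h2] at this
  push_cast at this
  rw [show (F 0 : ℂ) + 1 - 1 = F 0 - 0 by ring] at this
  have h3 : (Real.pi : ℂ) * Complex.I = 0 := by linear_combination (-1/2) * this
  simp [Real.pi_ne_zero] at h3

theorem d8_sep {K : Set ℝ} (hK : IsCompact K) {h : ℝ → ℂ} (hc : Continuous h) {p : ℂ}
    (hp : ∀ T ∈ K, h T ≠ p) : ∃ ε > 0, ∀ T ∈ K, ε ≤ dist (h T) p := by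
  rcases K.eq_empty_or_nonempty with rfl | hne
  · exact ⟨1, one_pos, by simp⟩
  obtain ⟨T, hT, hmin⟩ := hK.exists_isMinOn hne (f := fun T => dist (h T) p) (by fun_prop)
  exact ⟨dist (h T) p, dist_pos.2 (hp T hT), fun S hS => hmin hS⟩

theorem d8_iter_circle {f : ℂ → ℂ} {G : ℝ → ℝ} (hG : ∀ t : ℝ, f (ee t) = ee (G t)) (n : ℕ) (t : ℝ) :
    f^[n] (ee t) = ee ((G^[n] t : ℝ) : ℂ) := by
  induction n with
  | zero => rfl
  | succ n ih => rw [Function.iterate_succ_apply', Function.iterate_succ_apply', ih, hG]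

theorem d8_circle_id {f : ℂ → ℂ} {F : ℝ → ℝ} (hF : StrictMono F)
    (hF1 : ∀ t, F (t + 1) = F t + 1) (hFc : ∀ t : ℝ, f (ee t) = ee (F t))
    {n : ℕ → ℕ} (hn : Tendsto n atTop atTop)
    (hrec : ∀ ε > 0, ∀ᶠ k in atTop, ∀ y, ‖y‖ ≤ 1 → dist (f^[n k] y) y < ε)
    {t0 : ℝ} (ht0 : f (ee t0) = ee t0) (t : ℝ) : f (ee t) = ee t := by
  have hee : Continuous ee := by unfold ee; fun_prop
  rw [hFc, ee_eq] at ht0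
  obtain ⟨m, hm⟩ := ht0
  have hm' : F t0 = t0 + m := by exact_mod_cast hm
  let G : ℝ → ℝ := fun t => F t - m
  have hGdef : ∀ t, G t = F t - m := fun _ => rfl
  have hGm : StrictMono G := fun a b h => by simp only [hGdef]; linarith [hF h]
  have hGc : ∀ t : ℝ, f (ee t) = ee (G t) := fun t => by
    rw [hFc, ee_eq]; exact ⟨m, by simp [hGdef]⟩
  have hG0 : G t0 = t0 := by rw [hGdef, hm']; ring
  have hG1 : G (t0 + 1) = t0 + 1 := by rw [hGdef, hF1, hm']; ring
  have key : ∀ s, t0 ≤ s → s < t0 + 1 → f (ee s) = ee s := by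
    intro s hs1 hs2
    rw [hGc]
    by_contra hne
    have hsne : G s ≠ s := fun h => hne (by rw [h])
    have hs0 : t0 < s := lt_of_le_of_ne hs1 (fun h => hsne (by rw [← h, hG0]))
    have a1 : t0 < G s := by have := hGm hs0; rwa [hG0] at this
    have a2 : G s < t0 + 1 := by have := hGm hs2; rwa [hG1] at this
    have hfr : ∀ T : ℝ, T ≠ s → |T - s| < 1 → ee T ≠ ee s := by
      intro T hT1 hT2 h
      rw [ee_eq] at h
      obtain ⟨j, hj⟩ := h
      have hj' : T = s + j := by exact_mod_cast hj
      have : |(j : ℝ)| < 1 := by rwa [hj', add_sub_cancel_left] at hT2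
      have : |j| < 1 := by exact_mod_cast this
      rw [Int.abs_lt_one_iff] at this
      apply hT1; rw [hj', this]; simp
    obtain ⟨k, hk0, hk1⟩ : ∃ K : Set ℝ, IsCompact K ∧ (∀ T ∈ K, ee (T : ℂ) ≠ ee s) ∧
        ∀ j, G^[j + 1] s ∈ K := by
      rcases lt_or_gt_of_ne hsne with h | h
      · refine ⟨Set.Icc t0 (G s), isCompact_Icc, ?_, ?_⟩
        · rintro T ⟨h1, h2⟩
          exact hfr T (by linarith) (by rw [abs_lt]; constructor <;> linarith)
        · intro j
          induction j with
          | zero => exact ⟨a1.le, le_rfl⟩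
          | succ j ih =>
            rw [Function.iterate_succ_apply']
            refine ⟨?_, ?_⟩
            · have := hGm.monotone ih.1; rwa [hG0] at this
            · exact hGm.monotone (ih.2.trans h.le)
      · refine ⟨Set.Icc (G s) (t0 + 1), isCompact_Icc, ?_, ?_⟩
        · rintro T ⟨h1, h2⟩
          exact hfr T (by linarith) (by rw [abs_lt]; constructor <;> linarith)
        · intro j
          induction j with
          | zero => exact ⟨le_rfl, a2.le⟩
          | succ j ih =>
            rw [Function.iterate_succ_apply']
            refine ⟨?_, ?_⟩
            · exact hGm.monotone (h.le.trans ih.1)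
            · have := hGm.monotone ih.2; rwa [hG1] at this
    obtain ⟨ε, hε, hsep⟩ := d8_sep hk0 (h := fun T : ℝ => ee T) (by fun_prop) hk1.1
    obtain ⟨j, hj1, hj2⟩ := ((hrec ε hε).and (hn.eventually_ge_atTop 1)).exists
    have := hj1 (ee s) (d8_ee_re s).le
    rw [d8_iter_circle hGc] at this
    have h3 := hsep _ (hk1.2 (n j - 1))
    rw [Nat.sub_add_cancel hj2] at h3
    linarith
  have h1 := key (t - ⌊t - t0⌋) (by linarith [Int.floor_le (t - t0)])
    (by linarith [Int.lt_floor_add_one (t - t0)])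
  have h2 : ee ((t - ⌊t - t0⌋ : ℝ) : ℂ) = ee t := by
    rw [ee_eq]; exact ⟨-⌊t - t0⌋, by push_cast; ring⟩
  rwa [h2] at h1

theorem d8_two {f : ℂ → ℂ} (hf : Continuous f) {F : ℝ → ℝ} (hF : StrictMono F)
    (hFcont : Continuous F) (hFc : ∀ t : ℝ, f (ee t) = ee (F t))
    {n : ℕ → ℕ} (hn : Tendsto n atTop atTop)
    (hrec : ∀ ε > 0, ∀ᶠ k in atTop, ∀ y, ‖y‖ ≤ 1 → dist (f^[n k] y) y < ε)
    {z₁ z₂ : ℂ} (hz₁ : ‖z₁‖ < 1) (hz₂ : ‖z₂‖ ≤ 1) (h12 : z₂ ≠ z₁)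
    (hz₁' : ∀ y, y ≠ z₁ → f y ≠ z₁) (hfz₂ : f z₂ = z₂) : f (ee (0 : ℝ)) = ee (0 : ℝ) := by
  have hee : Continuous ee := by unfold ee; fun_prop
  by_contra hbd
  obtain ⟨L0, hL0c, hL0⟩ := exists_clog (A := ℂ) (g := fun w => f (z₁ + Complex.exp w) - z₁)
    (by fun_prop) (fun w => sub_ne_zero.2 (hz₁' _ (by simp [Complex.exp_ne_zero])))
  obtain ⟨w₂, hw₂⟩ : ∃ w, Complex.exp w = z₂ - z₁ :=
    ⟨_, Complex.exp_log (sub_ne_zero.2 h12)⟩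
  obtain ⟨L, hLc, hL, hLw⟩ : ∃ L : ℂ → ℂ, Continuous L ∧
      (∀ w, Complex.exp (L w) = f (z₁ + Complex.exp w) - z₁) ∧ L w₂ = w₂ := by
    refine ⟨fun w => L0 w - (L0 w₂ - w₂), by fun_prop, fun w => ?_, by ring⟩
    rw [Complex.exp_sub, Complex.exp_sub, hL0, hL0, hw₂]
    have : z₁ + (z₂ - z₁) = z₂ := by ring
    rw [this, hfz₂, div_self (sub_ne_zero.2 h12), div_one]
  have hLn : ∀ (j : ℕ) w, Complex.exp (L^[j] w) = f^[j] (z₁ + Complex.exp w) - z₁ := by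
    intro j
    induction j with
    | zero => intro w; simp
    | succ j ih =>
      intro w
      rw [Function.iterate_succ_apply', Function.iterate_succ_apply', hL, ih]
      congr 2; ring
  have hLnw : ∀ j : ℕ, L^[j] w₂ = w₂ := fun j => Function.iterate_fixed hLw j
  -- boundary lift
  have hq : ∀ t : ℝ, ‖-(z₁ * ee (-(t : ℂ)))‖ < 1 := fun t => by
    have := d8_ee_re (-t)
    push_cast at this
    rw [norm_neg, norm_mul, this, mul_one]; exact hz₁
  have hsl : ∀ t : ℝ, 1 + -(z₁ * ee (-(t : ℂ))) ∈ Complex.slitPlane := fun t => one_add_slit (hq t)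
  let ω : ℝ → ℂ := fun t => 2 * Real.pi * Complex.I * t + Complex.log (1 + -(z₁ * ee (-(t : ℂ))))
  have hωdef : ∀ t, ω t = 2 * Real.pi * Complex.I * t +
    Complex.log (1 + -(z₁ * ee (-(t : ℂ)))) := fun _ => rfl
  have hωc : Continuous ω := by
    refine Continuous.add (by fun_prop) (Continuous.clog (by fun_prop) hsl)
  have hω : ∀ t, Complex.exp (ω t) = ee t - z₁ := by
    intro t
    rw [hωdef, Complex.exp_add, Complex.exp_log (Complex.slitPlane_ne_zero (hsl t))]
    have h1 : ee (t : ℂ) * ee (-(t : ℂ)) = 1 := by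
      unfold ee; rw [← Complex.exp_add]; ring_nf; simp
    change ee (t : ℂ) * _ = _
    linear_combination (-z₁) * h1
  have hω1 : ∀ t (m : ℤ), ω (t + m) = ω t + m * (2 * Real.pi * Complex.I) := by
    intro t m
    have : ee (-((t + m : ℝ) : ℂ)) = ee (-(t : ℂ)) := by
      rw [ee_eq]; exact ⟨-m, by push_cast; ring⟩
    rw [hωdef, hωdef, this]; push_cast; ring
  have hz1t : ∀ t : ℝ, z₁ + (ee t - z₁) = ee t := fun t => by ring
  obtain ⟨m, hm⟩ : ∃ m : ℤ, L (ω 0) = ω (F 0) + m * (2 * Real.pi * Complex.I) := by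
    rw [← Complex.exp_eq_exp_iff_exists_int, hL, hω, hω, hz1t, hFc]
  let G : ℝ → ℝ := fun t => F t + m
  have hGdef : ∀ t, G t = F t + m := fun _ => rfl
  have hGm : StrictMono G := fun a b h => by simp only [hGdef]; linarith [hF h]
  have hLG : ∀ t, L (ω t) = ω (G t) := by
    intro t
    have := clog_diff (A := ℝ) (S := Set.univ) isPreconnected_univ
      (L₁ := fun t : ℝ => L (ω t)) (L₂ := fun t : ℝ => ω (F t))
      (by fun_prop) (by fun_prop) (fun t _ => by rw [hL, hω, hω, hz1t, hFc])
      (a := 0) (b := t) trivial trivial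
    rw [hGdef, hω1]
    linear_combination this + hm
  have hLGn : ∀ (j : ℕ) t, L^[j] (ω t) = ω (G^[j] t) := by
    intro j
    induction j with
    | zero => intro t; rfl
    | succ j ih =>
      intro t
      rw [Function.iterate_succ_apply', Function.iterate_succ_apply', ih, hLG]
  have hG0 : G 0 ≠ 0 := by
    intro h
    apply hbd
    rw [hFc, ee_eq]
    refine ⟨-m, ?_⟩
    have : F 0 = 0 + ((-m : ℤ) : ℝ) := by rw [hGdef] at h; push_cast; linarith
    exact_mod_cast this
  have hGn : ∀ j : ℕ, |G 0| ≤ |G^[j + 1] 0| := by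
    rcases lt_or_gt_of_ne hG0 with h | h
    · have : ∀ j : ℕ, G^[j + 1] 0 ≤ G 0 := by
        intro j
        induction j with
        | zero => exact le_rfl
        | succ j ih =>
          rw [Function.iterate_succ_apply']
          exact hGm.monotone (ih.trans h.le)
      intro j
      rw [abs_of_neg h, abs_of_neg ((this j).trans_lt h)]
      linarith [this j]
    · have : ∀ j : ℕ, G 0 ≤ G^[j + 1] 0 := by
        intro j
        induction j with
        | zero => exact le_rfl
        | succ j ih =>
          rw [Function.iterate_succ_apply']
          exact hGm.monotone (h.le.trans ih)
      intro j
      rw [abs_of_pos h, abs_of_pos (h.trans_le (this j))]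
      exact this j
  -- separation
  obtain ⟨ε₀, hε₀, hsep⟩ := d8_sep (K := Set.Icc (-(3/4) : ℝ) (3/4) ∩ {T | |G 0| ≤ |T|})
    (isCompact_Icc.inter_right (isClosed_le continuous_const continuous_abs)) hωc (p := ω 0) (by
      rintro T ⟨⟨h1, h2⟩, h3⟩ h
      have h4 := hω T
      rw [h, hω, sub_left_inj] at h4
      obtain ⟨j, hj⟩ := ee_eq.1 h4
      have hj' : 0 = T + j := by exact_mod_cast hj
      have h5 : (j : ℝ) < 1 := by linarith
      have h6 : (-1 : ℝ) < j := by linarith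
      have h7 : j = 0 := by
        have : j < 1 := by exact_mod_cast h5
        have : -1 < j := by exact_mod_cast h6
        omega
      rw [h7] at hj'
      have : T = 0 := by simpa using hj'.symm
      rw [Set.mem_ofPred_eq, this, abs_zero, abs_nonpos_iff] at h3
      exact hG0 h3)
  have harg : ∀ t : ℝ, |(Complex.log (1 + -(z₁ * ee (-(t : ℂ))))).im| < Real.pi / 2 := by
    intro t
    rw [Complex.log_im, Complex.abs_arg_lt_pi_div_two_iff]
    left
    have := (abs_lt.1 ((Complex.abs_re_le_norm _).trans_lt (hq t))).1
    rw [Complex.add_re, Complex.one_re]; linarith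
  have hbound : ∀ T, dist (ω T) (ω 0) < Real.pi / 2 → T ∈ Set.Icc (-(3/4) : ℝ) (3/4) := by
    intro T hT
    have h1 := (Complex.abs_im_le_norm _).trans_lt (dist_eq_norm (ω T) (ω 0) ▸ hT)
    have h2 := harg T
    have h3 := harg 0
    have h4 : (ω T - ω 0).im = 2 * Real.pi * T + (Complex.log (1 + -(z₁ * ee (-(T : ℂ))))).im -
        (Complex.log (1 + -(z₁ * ee (-((0 : ℝ) : ℂ))))).im := by
      rw [hωdef, hωdef]; simp
    rw [h4] at h1
    rw [abs_lt] at h1 h2 h3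
    have := Real.pi_pos
    constructor <;> nlinarith
  -- path
  obtain ⟨K, hKc, hKp, hKD, hK2, hK0⟩ : ∃ K : Set ℂ, IsCompact K ∧ IsPreconnected K ∧
      (∀ u ∈ K, ‖z₁ + Complex.exp u‖ ≤ 1) ∧ w₂ ∈ K ∧ ω 0 ∈ K := by
    have hseg : ∀ (a : ℂ) (s : ℝ), 0 ≤ s → ‖z₁ + Complex.exp a‖ ≤ 1 →
        ∀ u ∈ segment ℝ (a - s) a, ‖z₁ + Complex.exp u‖ ≤ 1 := by
      intro a s hs ha u hu
      obtain ⟨p, q, hp, hq, hpq, rfl⟩ := hu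
      have : p • (a - (s : ℂ)) + q • a = a + ((-(p * s) : ℝ) : ℂ) := by
        have : (p : ℂ) + q = 1 := by exact_mod_cast hpq
        simp only [Complex.real_smul]; push_cast; linear_combination a * this
      rw [this, Complex.exp_add, ← Complex.ofReal_exp]
      set l := Real.exp (-(p * s))
      have hl0 : 0 ≤ l := (Real.exp_pos _).le
      have hl1 : l ≤ 1 := Real.exp_le_one_iff.2 (by nlinarith)
      have : z₁ + Complex.exp a * (l : ℂ) = (1 - l) • z₁ + l • (z₁ + Complex.exp a) := by
        simp only [Complex.real_smul]; push_cast; ring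
      rw [this]
      refine (norm_add_le _ _).trans ?_
      rw [norm_smul, norm_smul, Real.norm_of_nonneg hl0, Real.norm_of_nonneg (by linarith)]
      nlinarith
    have hhalf : ∀ u : ℂ, u.re ≤ Real.log (1 - ‖z₁‖) → ‖z₁ + Complex.exp u‖ ≤ 1 := by
      intro u hu
      refine (norm_add_le _ _).trans ?_
      rw [Complex.norm_exp]
      have := Real.exp_le_exp.2 hu
      rw [Real.exp_log (by linarith)] at this
      linarith
    have e2 : ‖z₁ + Complex.exp w₂‖ ≤ 1 := by rw [hw₂]; simpa using hz₂
    have e0 : ‖z₁ + Complex.exp (ω 0)‖ ≤ 1 := by rw [hω, hz1t, d8_ee_re]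
    set s : ℝ := |w₂.re| + |(ω 0).re| + |Real.log (1 - ‖z₁‖)|
    have hs : 0 ≤ s := by positivity
    have hcv : ∀ a b : ℂ, IsPreconnected (segment ℝ a b) := fun a b => (convex_segment a b).isPreconnected
    have hcp : ∀ a b : ℂ, IsCompact (segment ℝ a b) := fun a b => by
      rw [segment_eq_image_lineMap]
      exact isCompact_Icc.image (AffineMap.lineMap_continuous (R := ℝ))
    refine ⟨(segment ℝ (w₂ - s) w₂ ∪ segment ℝ (w₂ - s) (ω 0 - s)) ∪ segment ℝ (ω 0 - s) (ω 0),
      ((hcp _ _).union (hcp _ _)).union (hcp _ _), ?_, ?_, ?_, ?_⟩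
    · refine IsPreconnected.union (ω 0 - s) (Or.inr (right_mem_segment _ _ _))
        (left_mem_segment _ _ _) ?_ (hcv _ _)
      exact IsPreconnected.union (w₂ - s) (left_mem_segment _ _ _) (left_mem_segment _ _ _)
        (hcv _ _) (hcv _ _)
    · rintro u ((hu | hu) | hu)
      · exact hseg _ _ hs e2 u hu
      · apply hhalf
        obtain ⟨p, q, hp, hq, hpq, rfl⟩ := hu
        have h1 := abs_le.1 (le_refl |w₂.re|)
        have h2 := abs_le.1 (le_refl |(ω 0).re|)
        have h3 := abs_le.1 (le_refl |Real.log (1 - ‖z₁‖)|)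
        have h4 := abs_nonneg w₂.re
        have h5 := abs_nonneg (ω 0).re
        have a1 : w₂.re - s ≤ Real.log (1 - ‖z₁‖) := by simp only [s]; linarith
        have a2 : (ω 0).re - s ≤ Real.log (1 - ‖z₁‖) := by simp only [s]; linarith
        simp only [Complex.add_re, Complex.real_smul, Complex.re_ofReal_mul, Complex.sub_re,
          Complex.ofReal_re]
        nlinarith
      · exact hseg _ _ hs e0 u hu
    · exact Or.inl (Or.inl (right_mem_segment _ _ _))
    · exact Or.inr (right_mem_segment _ _ _)
  obtain ⟨u₀, hu₀, hmin⟩ := hKc.exists_isMinOn ⟨_, hK2⟩ (f := fun u => ‖Complex.exp u‖) (by fun_prop)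
  set δ := ‖Complex.exp u₀‖ with hδ
  have hδ0 : 0 < δ := norm_pos_iff.2 (Complex.exp_ne_zero _)
  have hδm : ∀ u ∈ K, δ ≤ ‖Complex.exp u‖ := fun u hu => hmin hu
  set η : ℝ := min (1/2) (min (ε₀ / 2) (Real.pi / 4))
  have hη0 : 0 < η := by have := Real.pi_pos; positivity
  have hη1 : η ≤ 1/2 := min_le_left _ _
  have hη2 : η ≤ ε₀ / 2 := (min_le_right _ _).trans (min_le_left _ _)
  have hη3 : η ≤ Real.pi / 4 := (min_le_right _ _).trans (min_le_right _ _)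
  obtain ⟨k, hk1, hk2⟩ := ((hrec (δ * η) (by positivity)).and (hn.eventually_ge_atTop 1)).exists
  set N := n k
  let r : ℂ → ℂ := fun u => (f^[N] (z₁ + Complex.exp u) - (z₁ + Complex.exp u)) / Complex.exp u
  have hr : ∀ u ∈ K, ‖r u‖ < η := by
    intro u hu
    have h1 := hk1 _ (hKD u hu)
    rw [dist_eq_norm] at h1
    have h2 := hδm u hu
    simp only [r]
    rw [norm_div, div_lt_iff₀ (hδ0.trans_le h2)]
    nlinarith
  have hre : ∀ u ∈ K, Complex.exp (L^[N] u - u) = 1 + r u := by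
    intro u hu
    rw [Complex.exp_sub, hLn]
    simp only [r]
    have := Complex.exp_ne_zero u
    field_simp
    ring
  have hrs : ∀ u ∈ K, 1 + r u ∈ Complex.slitPlane := fun u hu => one_add_slit (by linarith [hr u hu])
  have hrc : Continuous r := by
    have := hf.iterate N
    exact Continuous.div (by fun_prop) (by fun_prop) (fun u => Complex.exp_ne_zero u)
  have hmain := clog_diff hKp (L₁ := fun u => L^[N] u - u) (L₂ := fun u => Complex.log (1 + r u))
    (by have := hLc.iterate N; fun_prop)
    (ContinuousOn.clog (by fun_prop) hrs)
    (fun u hu => by rw [hre u hu, Complex.exp_log (Complex.slitPlane_ne_zero (hrs u hu))]) hK2 hK0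
  have hr2 : r w₂ = 0 := by
    have := hre w₂ hK2
    rw [hLnw, sub_self, Complex.exp_zero] at this
    linear_combination -this
  simp only [hLnw, hr2, hLGn] at hmain
  have hd : dist (ω (G^[N] 0)) (ω 0) < 2 * η := by
    rw [dist_eq_norm]
    have e1 : ω (G^[N] 0) - ω 0 = Complex.log (1 + r (ω 0)) := by
      simpa using hmain
    rw [e1]
    have := Complex.norm_log_one_add_half_le_self (z := r (ω 0)) (by linarith [hr _ hK0])
    linarith [hr _ hK0, norm_nonneg (r (ω 0))]
  have h1 := hbound (G^[N] 0) (by linarith)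
  have h2 := hGn (N - 1)
  rw [Nat.sub_add_cancel hk2] at h2
  linarith [hsep _ ⟨h1, h2⟩]

theorem d8_core {f g : ℂ → ℂ} (hf : Continuous f) (hg : Continuous g)
    (hfD : ∀ y, ‖f y‖ ≤ 1) (hgD : ∀ y, ‖g y‖ ≤ 1)
    (hgf : ∀ y, ‖y‖ ≤ 1 → g (f y) = y) (hfg : ∀ y, ‖y‖ ≤ 1 → f (g y) = y)
    (hfp : ∀ y, 1 ≤ ‖y‖ → f y = f (y / (‖y‖ : ℂ)))
    (hgp : ∀ y, 1 ≤ ‖y‖ → g y = g (y / (‖y‖ : ℂ)))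
    {F : ℝ → ℝ} (hF : StrictMono F)
    (hF1 : ∀ t, F (t + 1) = F t + 1) (hFc : ∀ t : ℝ, f (ee t) = ee (F t))
    {n : ℕ → ℕ} (hn : Tendsto n atTop atTop)
    (hrec : ∀ ε > 0, ∀ᶠ k in atTop, ∀ y, ‖y‖ ≤ 1 → dist (f^[n k] y) y < ε)
    (hne : ∃ y, ‖y‖ ≤ 1 ∧ f y ≠ y) :
    ∃ x, ‖x‖ ≤ 1 ∧ f x = x ∧ ∀ y, ‖y‖ ≤ 1 → f y = y → y = x := by
  have hFcont := d8_F_cont hf hF hF1 hFc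
  have hcirc : ∀ y : ℂ, ‖y‖ = 1 → ∃ t : ℝ, y = ee t := by
    intro y hy
    refine ⟨Complex.arg y / (2 * Real.pi), ?_⟩
    have h1 := Complex.norm_mul_exp_arg_mul_I y
    rw [hy] at h1
    unfold ee
    have : (Real.pi : ℂ) ≠ 0 := by exact_mod_cast Real.pi_ne_zero
    rw [Complex.ofReal_one, one_mul] at h1
    have h2 : 2 * Real.pi * Complex.I * ((Complex.arg y / (2 * Real.pi) : ℝ) : ℂ) =
        Complex.arg y * Complex.I := by
      push_cast; field_simp
    rw [h2, h1]
  have hnorm1 : ∀ y : ℂ, 1 ≤ ‖y‖ → ‖y / (‖y‖ : ℂ)‖ = 1 := by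
    intro y hy
    rw [norm_div, Complex.norm_real, norm_norm, div_self (by linarith)]
  -- no fixed boundary point
  have hA : ∀ y, ‖y‖ = 1 → f y ≠ y := by
    intro y hy hfy
    obtain ⟨t0, rfl⟩ := hcirc y hy
    have hid : ∀ y, ‖y‖ = 1 → f y = y := by
      intro y hy
      obtain ⟨t, rfl⟩ := hcirc y hy
      exact d8_circle_id hF hF1 hFc hn hrec hfy t
    have hidg : ∀ y, ‖y‖ = 1 → g y = y := by
      intro y hy
      have := hgf y hy.le
      rwa [hid y hy] at this
    let pr : ℂ → ℂ := fun y => y / ((max 1 ‖y‖ : ℝ) : ℂ)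
    have hprc : Continuous pr := by
      refine Continuous.div (by fun_prop) (by fun_prop) (fun y => ?_)
      have : 0 < max 1 ‖y‖ := by positivity
      exact_mod_cast this.ne'
    have hpr1 : ∀ y, ‖y‖ ≤ 1 → pr y = y := fun y hy => by simp [pr, max_eq_left hy]
    have hpr2 : ∀ y, 1 ≤ ‖y‖ → pr y = y / (‖y‖ : ℂ) := fun y hy => by simp [pr, max_eq_right hy]
    let f' : ℂ → ℂ := fun y => f y + (y - pr y)
    let g' : ℂ → ℂ := fun y => g y + (y - pr y)
    have f1 : ∀ y, ‖y‖ ≤ 1 → f' y = f y := fun y hy => by simp [f', hpr1 y hy]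
    have g1 : ∀ y, ‖y‖ ≤ 1 → g' y = g y := fun y hy => by simp [g', hpr1 y hy]
    have f2 : ∀ y, 1 ≤ ‖y‖ → f' y = y := fun y hy => by
      simp only [f']
      rw [hfp y hy, hpr2 y hy, hid _ (hnorm1 y hy)]; ring
    have g2 : ∀ y, 1 ≤ ‖y‖ → g' y = y := fun y hy => by
      simp only [g']
      rw [hgp y hy, hpr2 y hy, hidg _ (hnorm1 y hy)]; ring
    let H : ℂ ≃ₜ ℂ :=
      { toFun := f'
        invFun := g'
        left_inv := fun y => by
          rcases le_total ‖y‖ 1 with h | h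
          · rw [f1 y h, g1 _ (hfD y), hgf y h]
          · rw [f2 y h, g2 y h]
        right_inv := fun y => by
          rcases le_total ‖y‖ 1 with h | h
          · rw [g1 y h, f1 _ (hgD y), hfg y h]
          · rw [g2 y h, f2 y h]
        continuous_toFun := by simp only [f']; fun_prop
        continuous_invFun := by simp only [g']; fun_prop }
    have hH : ∀ y, H y = f' y := fun _ => rfl
    have hit : ∀ (j : ℕ) y, ‖y‖ ≤ 1 → H^[j] y = f^[j] y ∧ ‖f^[j] y‖ ≤ 1 := by
      intro j y hy
      induction j with
      | zero => exact ⟨rfl, hy⟩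
      | succ j ih =>
        rw [Function.iterate_succ_apply', Function.iterate_succ_apply', ih.1, hH, f1 _ ih.2]
        exact ⟨rfl, hfD _⟩
    obtain ⟨y, hy, hfy'⟩ := hne
    apply hfy'
    rw [← f1 y hy, ← hH]
    refine main_id H (fun y hy => by rw [hH, f2 y hy]) hn (fun ε hε => ?_) y
    filter_upwards [hrec ε hε] with k hk y
    rcases le_total ‖y‖ 1 with h | h
    · rw [(hit _ y h).1]; exact hk y h
    · rw [Function.iterate_fixed (by rw [hH, f2 y h]), dist_self]; exact hε
  obtain ⟨x, hx⟩ := d8_exists hf hFcont hF1 hFc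
  have hx1 : ‖x‖ ≤ 1 := by rw [← hx]; exact hfD x
  refine ⟨x, hx1, hx, fun y hy hfy => ?_⟩
  by_contra hyx
  have hxl : ‖x‖ < 1 := lt_of_le_of_ne hx1 (fun h => hA x h hx)
  refine hA (ee (0 : ℝ)) (d8_ee_re 0) (d8_two hf hF hFcont hFc hn hrec hxl hy hyx (fun z hz h => ?_) hfy)
  rcases le_total ‖z‖ 1 with h1 | h1
  · apply hz
    rw [← hgf z h1, h]; nth_rewrite 1 [← hx]; exact hgf x hx1
  · rw [hfp z h1] at h
    have h2 := hgf _ (hnorm1 z h1).le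
    rw [h] at h2
    nth_rewrite 1 [← hx] at h2
    rw [hgf x hx1] at h2
    have := hnorm1 z h1
    rw [← h2] at this
    linarith

theorem d8_circlePt (t : ℝ) : Complex.orthonormalBasisOneI.repr (ee t) = circlePt t := by
  have h : ee (t : ℂ) = Complex.cos ((2 * Real.pi * t : ℝ) : ℂ) +
      Complex.sin ((2 * Real.pi * t : ℝ) : ℂ) * Complex.I := by
    rw [← Complex.exp_mul_I]; unfold ee; push_cast; congr 1; ring
  rw [h, ← Complex.ofReal_cos, ← Complex.ofReal_sin]
  unfold circlePt
  generalize Real.cos (2 * Real.pi * t) = a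
  generalize Real.sin (2 * Real.pi * t) = b
  ext i
  rw [Complex.orthonormalBasisOneI_repr_apply]
  fin_cases i
  · simp [EuclideanSpace.equiv]
  · simp [EuclideanSpace.equiv]

theorem d8_final (f : Disc2 ≃ₜ Disc2)
    (hrec : IsRecurrent (f : Disc2 → Disc2))
    (hor : DiscOrientationPreserving f)
    (hne : ∃ x, f x ≠ x) :
    ∃! x : Disc2, f x = x := by
  obtain ⟨n, hn, hrec⟩ := hrec
  obtain ⟨F, hF, hF1, hFc⟩ := hor
  let e := Complex.orthonormalBasisOneI.repr
  let pr : ℂ → ℂ := fun y => y / ((max 1 ‖y‖ : ℝ) : ℂ)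
  have hprc : Continuous pr := by
    refine Continuous.div (by fun_prop) (by fun_prop) (fun y => ?_)
    have : 0 < max 1 ‖y‖ := by positivity
    exact_mod_cast this.ne'
  have hpr1 : ∀ y, ‖y‖ ≤ 1 → pr y = y := fun y hy => by simp [pr, max_eq_left hy]
  have hpr2 : ∀ y, 1 ≤ ‖y‖ → pr y = y / (‖y‖ : ℂ) := fun y hy => by simp [pr, max_eq_right hy]
  have hprn : ∀ y, ‖pr y‖ ≤ 1 := fun y => by
    simp only [pr]
    have h0 : 0 < max 1 ‖y‖ := by positivity
    rw [norm_div, Complex.norm_real, Real.norm_of_nonneg h0.le, div_le_one h0]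
    exact le_max_right _ _
  have hnorm1 : ∀ y : ℂ, 1 ≤ ‖y‖ → ‖y / (‖y‖ : ℂ)‖ = 1 := by
    intro y hy
    rw [norm_div, Complex.norm_real, norm_norm, div_self (by linarith)]
  have hprp : ∀ y, 1 ≤ ‖y‖ → pr y = pr (y / (‖y‖ : ℂ)) := fun y hy => by
    rw [hpr1 _ (hnorm1 y hy).le, hpr2 y hy]
  have hen : ∀ y, ‖e y‖ = ‖y‖ := fun y => e.norm_map y
  have hsn : ∀ y, ‖e.symm y‖ = ‖y‖ := fun y => e.symm.norm_map y
  let P : ℂ → Disc2 := fun y => ⟨e (pr y), by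
    rw [mem_closedBall_zero_iff, hen]; exact hprn y⟩
  have hPc : Continuous P := Continuous.subtype_mk (e.continuous.comp hprc) _
  have hPval : ∀ y, (P y : EuclideanSpace ℝ (Fin 2)) = e (pr y) := fun _ => rfl
  let Q : Disc2 → ℂ := fun x => e.symm x.1
  have hQval : ∀ x : Disc2, Q x = e.symm x.1 := fun _ => rfl
  have hQc : Continuous Q := e.symm.continuous.comp continuous_subtype_val
  have hQn : ∀ x, ‖Q x‖ ≤ 1 := fun x => by
    rw [hQval, hsn]; exact mem_closedBall_zero_iff.1 x.2
  have hPQ : ∀ x, P (Q x) = x := fun x => by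
    apply Subtype.ext
    rw [hPval, hpr1 _ (hQn x), hQval, e.apply_symm_apply]
  have hQP : ∀ y, ‖y‖ ≤ 1 → Q (P y) = y := fun y hy => by
    rw [hQval, hPval, hpr1 _ hy, e.symm_apply_apply]
  have hPP : ∀ y, 1 ≤ ‖y‖ → P y = P (y / (‖y‖ : ℂ)) := fun y hy => by
    apply Subtype.ext
    rw [hPval, hPval, hprp y hy]
  have hit : ∀ (j : ℕ) y, ‖y‖ ≤ 1 → (fun y => Q (f (P y)))^[j] y = Q (f^[j] (P y)) := by
    intro j y hy
    induction j with
    | zero => exact (hQP y hy).symm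
    | succ j ih =>
      rw [Function.iterate_succ_apply', Function.iterate_succ_apply', ih, hPQ]
  obtain ⟨x, hx1, hx2, hx3⟩ := d8_core (f := fun y => Q (f (P y))) (g := fun y => Q (f.symm (P y)))
    (hQc.comp (f.continuous.comp hPc)) (hQc.comp (f.symm.continuous.comp hPc))
    (fun y => hQn _) (fun y => hQn _)
    (fun y hy => by simp only [hPQ, f.symm_apply_apply, hQP y hy])
    (fun y hy => by simp only [hPQ, f.apply_symm_apply, hQP y hy])
    (fun y hy => by simp only [← hPP y hy]) (fun y hy => by simp only [← hPP y hy])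
    hF hF1 (fun t => by
      have h0 : circlePt t ∈ Disc2 := by
        rw [mem_closedBall_zero_iff, ← d8_circlePt]
        change ‖e _‖ ≤ 1
        rw [hen, d8_ee_re]
      have h1 : P (ee t) = ⟨circlePt t, h0⟩ := by
        apply Subtype.ext
        rw [hPval, hpr1 _ (d8_ee_re t).le]
        exact d8_circlePt t
      rw [hQval, h1, hFc, ← d8_circlePt]
      exact e.symm_apply_apply _)
    hn (fun ε hε => by
      filter_upwards [hrec ε hε] with k hk y hy
      rw [hit _ _ hy]
      nth_rewrite 2 [← hQP y hy]
      rw [hQval, hQval, e.symm.dist_map]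
      exact hk (P y))
    (by
      obtain ⟨x, hx⟩ := hne
      refine ⟨Q x, hQn x, fun h => hx ?_⟩
      simp only [hPQ] at h
      rw [← hPQ (f x), h, hPQ])
  refine ⟨P x, ?_, fun y hy => ?_⟩
  · simp only at hx2 ⊢
    rw [← hPQ (f (P x)), hx2]
  · have := hx3 (Q y) (hQn y) (by simp only [hPQ]; rw [hy])
    rw [← this, hPQ]

/-- A non-trivial, recurrent, orientation-preserving homeomorphism of the closed
disc has a unique fixed point. -/
theorem disc_recurrent_unique_fixed_point (f : Disc2 ≃ₜ Disc2)
    (hrec : IsRecurrent (f : Disc2 → Disc2))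
    (hor : DiscOrientationPreserving f)
    (hne : ∃ x, f x ≠ x) :
    ∃! x : Disc2, f x = x := by
  exact d8_final f hrec hor hne
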